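/- arXiv:2502.02388 — 2 statements merged into one kernel-verified Lean document; each statement's English description precedes it below -/
import Mathlib

section
/- (Improved Berezin–Li–Yau inequality with regularized inradius, case γ = 1, variational form.) For every dimension d ≥ 1 and every θ ∈ (0,1) there exist constants c, c' > 0 with the following property: for every open set Ω ⊆ ℝ^d of finite Lebesgue measure, every Λ > 0, every N ∈ ℕ and every family φ_1, …, φ_N of smooth compactly supported functions on ℝ^d, each with support contained in Ω and orthonormal in L²(ℝ^d), one has Σ_{j=1}^N ( Λ − ∫_{ℝ^d} |∇φ_j(x)|² dx ) ≤ L^sc_{1,d} · |Ω| · Λ^{1+d/2} · (1 − c e^{−c' √Λ ρ_θ(Ω)}). (Since the supremum of the left-hand side over all such orthonormal families equals the Riesz mean Tr(−Δ_Ω^D − Λ)_−, this is the variational formulation of the bound Tr(−Δ_Ω^D − Λ)_− ≤ L^sc_{1,d}|Ω|Λ^{1+d/2}(1 − c e^{−c'√Λ ρ_θ(Ω)}).) -/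
open MeasureTheory Real
open scoped ENNReal

/-- The regularized inradius `ρ_θ(Ω)`: the infimum (in `ℝ≥0∞`, with `inf ∅ = ∞`) of all
`ρ > 0` such that `|Ω ∩ B_ρ(x)| ≤ θ |B_ρ(x)|` for all `x ∈ ℝ^d`. -/
noncomputable def regInradius (d : ℕ) (θ : ℝ) (Ω : Set (EuclideanSpace ℝ (Fin d))) : ℝ≥0∞ :=
  sInf (ENNReal.ofReal ''
    {ρ : ℝ | 0 < ρ ∧ ∀ x : EuclideanSpace ℝ (Fin d),
      volume (Ω ∩ Metric.ball x ρ) ≤ ENNReal.ofReal θ * volume (Metric.ball x ρ)})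

/-- The semiclassical constant `L^sc_{1,d} = Γ(2)/((4π)^{d/2} Γ(2 + d/2))`. -/
noncomputable def semiclassicalConst (d : ℕ) : ℝ :=
  Real.Gamma 2 / ((4 * π) ^ ((d : ℝ) / 2) * Real.Gamma (2 + (d : ℝ) / 2))

/-- The Dirichlet energy density `|∇φ(x)|² = Σ_k |∂_k φ(x)|²` of a function
`φ : ℝ^d → ℂ`. -/
noncomputable def gradSq (d : ℕ) (φ : EuclideanSpace ℝ (Fin d) → ℂ)
    (x : EuclideanSpace ℝ (Fin d)) : ℝ :=
  ∑ k : Fin d, ‖fderiv ℝ φ x (EuclideanSpace.single k 1)‖ ^ 2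

section


/-- Product of distances in `range m`. -/
lemma prod_dist_range (m j : ℕ) (hj : j ∈ Finset.range (m+1)) :
    ∏ k ∈ (Finset.range (m+1)).erase j, |(j:ℝ) - k| = (j.factorial : ℝ) * ((m - j).factorial : ℝ) := by
  have hjm : j ≤ m := by simpa [Nat.lt_succ_iff] using hj
  have h1 : (Finset.range (m+1)).erase j = Finset.range j ∪ Finset.Ico (j+1) (m+1) := by
    ext k; simp only [Finset.mem_erase, Finset.mem_range, Finset.mem_union, Finset.mem_Ico]; omega
  rw [h1, Finset.prod_union]
  · congr 1
    · rw [← Finset.prod_range_reflect, ← Finset.prod_range_add_one_eq_factorial, Nat.cast_prod]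
      apply Finset.prod_congr rfl
      intro k hk
      have hk' : k < j := by simpa using hk
      rw [Nat.sub_sub, Nat.cast_sub (by omega)]
      push_cast
      rw [abs_of_nonneg] <;> linarith [(Nat.cast_nonneg k : (0:ℝ) ≤ k)]
    · rw [Finset.prod_Ico_eq_prod_range, ← Finset.prod_range_add_one_eq_factorial, Nat.cast_prod]
      have : m + 1 - (j+1) = m - j := by omega
      rw [this]
      apply Finset.prod_congr rfl
      intro k hk
      push_cast
      rw [abs_of_nonpos] <;> linarith [(Nat.cast_nonneg k : (0:ℝ) ≤ k)]
  · rw [Finset.disjoint_left]; intro a; simp; omega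

/-- Lagrange interpolation bound at `0` from separated nodes. -/
lemma lagrange_bound (m : ℕ) (p : Polynomial ℂ) (hp : p.degree < ((m+1 : ℕ) : WithBot ℕ)) (t : ℕ → ℝ) (s : ℝ) (hs : 0 < s)
    (ht : ∀ j, t j ∈ Set.Icc (0:ℝ) 1)
    (hsep : ∀ j k, j ≤ m → k ≤ m → s * |(j:ℝ) - k| ≤ |t j - t k|) (Q : ℝ)
    (hQ : ∀ j, j ≤ m → ‖p.eval (t j : ℂ)‖ ≤ Q) :
    ‖p.eval 0‖ ≤ (2 / s)^m / (m.factorial : ℝ) * Q := by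
  have hinj : Set.InjOn (fun j : ℕ => (t j : ℂ)) (Finset.range (m+1) : Finset ℕ) := by
    intro j hj k hk hjk
    have hj' : j ≤ m := by simpa [Nat.lt_succ_iff] using hj
    have hk' : k ≤ m := by simpa [Nat.lt_succ_iff] using hk
    have h := hsep j k hj' hk'
    have h0 : t j = t k := Complex.ofReal_injective hjk
    rw [h0, sub_self, abs_zero] at h
    have h2 : |(j:ℝ) - k| ≤ 0 := by
      by_contra hc; push Not at hc
      linarith [mul_pos hs hc]
    have := abs_nonpos_iff.1 h2
    exact_mod_cast sub_eq_zero.1 this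
  have hint := Lagrange.eq_interpolate (f := p) hinj (by simpa using hp)
  have hev : p.eval 0 = ∑ j ∈ Finset.range (m+1), p.eval (t j : ℂ) * (Lagrange.basis (Finset.range (m+1)) (fun j : ℕ => (t j : ℂ)) j).eval 0 := by
    conv_lhs => rw [hint]
    rw [Lagrange.interpolate_apply, Polynomial.eval_finsetSum]
    simp
  have hQ0 : 0 ≤ Q := (norm_nonneg _).trans (hQ 0 (Nat.zero_le _))
  have hb : ∀ j ∈ Finset.range (m+1), ‖(Lagrange.basis (Finset.range (m+1)) (fun j : ℕ => (t j : ℂ)) j).eval 0‖ ≤ (1/s)^m / ((j.factorial : ℝ) * ((m - j).factorial : ℝ)) := by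
    intro j hj
    have hj' : j ≤ m := by simpa [Nat.lt_succ_iff] using hj
    rw [← prod_dist_range m j hj, Lagrange.basis, Polynomial.eval_prod, norm_prod]
    have hc : ((Finset.range (m+1)).erase j).card = m := by
      rw [Finset.card_erase_of_mem hj]; simp
    have : (1/s)^m / ∏ k ∈ (Finset.range (m+1)).erase j, |(j:ℝ) - k| = ∏ k ∈ (Finset.range (m+1)).erase j, (1/s) / |(j:ℝ) - k| := by
      rw [Finset.prod_div_distrib, Finset.prod_const, hc]
    rw [this]
    apply Finset.prod_le_prod
    · intros; positivity
    · intro k hk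
      have hkj : k ≠ j := (Finset.mem_erase.1 hk).1
      have hk' : k ≤ m := by have := (Finset.mem_erase.1 hk).2; simpa [Nat.lt_succ_iff] using this
      have hpos : 0 < |(j:ℝ) - k| := by
        rw [abs_pos, sub_ne_zero]; exact_mod_cast hkj.symm
      have h1 := hsep j k hj' hk'
      simp only [Lagrange.basisDivisor, Polynomial.eval_mul, Polynomial.eval_C, Polynomial.eval_sub, Polynomial.eval_X, zero_sub, norm_mul, norm_neg, norm_inv]
      rw [← Complex.ofReal_sub, Complex.norm_real, Complex.norm_real, Real.norm_eq_abs, Real.norm_eq_abs, abs_of_nonneg (ht k).1, div_div, inv_eq_one_div]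
      calc 1 / |t j - t k| * t k ≤ 1 / |t j - t k| * 1 := by
            gcongr; exact (ht k).2
        _ ≤ 1 / (s * |(j:ℝ) - k|) := by
            rw [mul_one]; gcongr
  rw [hev]
  calc _ ≤ ∑ j ∈ Finset.range (m+1), ‖p.eval (t j : ℂ) * (Lagrange.basis (Finset.range (m+1)) (fun j : ℕ => (t j : ℂ)) j).eval 0‖ := norm_sum_le _ _
    _ ≤ ∑ j ∈ Finset.range (m+1), Q * ((1/s)^m / ((j.factorial : ℝ) * ((m - j).factorial : ℝ))) := by
        apply Finset.sum_le_sum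
        intro j hj
        rw [norm_mul]
        exact mul_le_mul (hQ j (by simpa [Nat.lt_succ_iff] using hj)) (hb j hj) (norm_nonneg _) hQ0
    _ = ∑ j ∈ Finset.range (m+1), (m.choose j : ℝ) * (Q * (1/s)^m / (m.factorial : ℝ)) := by
        apply Finset.sum_congr rfl
        intro j hj
        have hj' : j ≤ m := by simpa [Nat.lt_succ_iff] using hj
        rw [Nat.cast_choose ℝ hj']
        have := Nat.factorial_pos m
        have := Nat.factorial_pos j
        have := Nat.factorial_pos (m-j)
        field_simp
    _ = _ := by
        rw [← Finset.sum_mul]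
        have : ∑ j ∈ Finset.range (m+1), (m.choose j : ℝ) = 2^m := by exact_mod_cast Nat.sum_range_choose m
        rw [this, div_pow, div_pow]
        ring

/-- Selection of separated points with small values. -/
lemma exists_points (m : ℕ) (T : Set ℝ) (hT : MeasurableSet T) (hT1 : T ⊆ Set.Icc 0 1) (δ : ℝ) (hδ : 0 < δ)
    (hvol : δ ≤ volume.real T) (u : ℝ → ℝ) (hu : IntegrableOn u T) (hu0 : ∀ t, 0 ≤ u t) :
    ∃ t : ℕ → ℝ, (∀ j, t j ∈ Set.Icc (0:ℝ) 1) ∧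
      (∀ j k, j ≤ m → k ≤ m → (δ / (2*(m+1))) * |(j:ℝ) - k| ≤ |t j - t k|) ∧
      (∀ j, j ≤ m → u (t j) ≤ (2*(m+1)/δ) * ∫ x in T, u x) := by
  set s : ℝ := δ / (2*(m+1)) with hs
  have hspos : 0 < s := by positivity
  have hfin : ∀ A : Set ℝ, volume (T ∩ A) ≠ ∞ := fun A =>
    ((measure_mono (Set.inter_subset_left.trans hT1)).trans_lt (by simp)).ne
  set F : ℝ → ℝ := fun t => volume.real (T ∩ Set.Iic t) with hF
  have hFd : ∀ a b, a ≤ b → F b - F a = volume.real (T ∩ Set.Ioc a b) := by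
    intro a b hab
    have h1 : T ∩ Set.Iic b = (T ∩ Set.Iic a) ∪ (T ∩ Set.Ioc a b) := by
      rw [← Set.inter_union_distrib_left, Set.Iic_union_Ioc_eq_Iic hab]
    have : F b = F a + volume.real (T ∩ Set.Ioc a b) := by
      simp only [hF]
      rw [h1, measureReal_union _ (hT.inter measurableSet_Ioc) (hfin _) (hfin _)]
      exact Set.disjoint_left.2 fun x hx hx' => not_lt.2 hx.2 hx'.2.1
    linarith
  have hFmono : Monotone F := by
    intro a b hab
    have := hFd a b hab
    have h2 : 0 ≤ volume.real (T ∩ Set.Ioc a b) := measureReal_nonneg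
    linarith
  have hFlip : ∀ a b, a ≤ b → F b - F a ≤ b - a := by
    intro a b hab
    rw [hFd a b hab]
    calc _ ≤ volume.real (Set.Ioc a b) := measureReal_mono Set.inter_subset_right (by simp)
      _ = b - a := by simp [Measure.real, hab]
  have hFabs : ∀ a b, |F a - F b| ≤ |a - b| := by
    intro a b
    rcases le_total a b with h | h
    · rw [abs_sub_comm, abs_sub_comm a, abs_of_nonneg (sub_nonneg.2 (hFmono h)), abs_of_nonneg (sub_nonneg.2 h)]
      exact hFlip _ _ h
    · rw [abs_of_nonneg (sub_nonneg.2 (hFmono h)), abs_of_nonneg (sub_nonneg.2 h)]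
      exact hFlip _ _ h
  have hFcont : Continuous F := by
    have : LipschitzWith 1 F := LipschitzWith.of_dist_le_mul (by
      intro a b; simpa [Real.dist_eq] using hFabs a b)
    exact this.continuous
  have hF0 : F 0 ≤ 0 := by
    have : T ∩ Set.Iic 0 ⊆ {0} := by
      rintro x ⟨hx, hx0⟩
      exact le_antisymm hx0 (hT1 hx).1
    calc F 0 ≤ volume.real ({0} : Set ℝ) := measureReal_mono this (by simp)
      _ = 0 := by simp [Measure.real]
  have hF1 : δ ≤ F 1 := by
    have : T ∩ Set.Iic 1 = T := Set.inter_eq_left.2 fun x hx => (hT1 hx).2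
    simpa [hF, this] using hvol
  have hivt : ∀ y, 0 ≤ y → y ≤ δ → ∃ a, F a = y := by
    intro y h0 h1
    obtain ⟨a, -, ha⟩ := intermediate_value_Icc (zero_le_one' ℝ) hFcont.continuousOn (show y ∈ Set.Icc (F 0) (F 1) from ⟨hF0.trans h0, h1.trans hF1⟩)
    exact ⟨a, ha⟩
  have hms : 2 * (m+1) * s = δ := by rw [hs]; field_simp
  have key : ∀ j : ℕ, ∃ t ∈ Set.Icc (0:ℝ) 1, j ≤ m → (2*j*s ≤ F t ∧ F t ≤ (2*j+1)*s ∧ u t ≤ (2*(m+1)/δ) * ∫ x in T, u x) := by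
    intro j
    by_cases hj : j ≤ m
    swap
    · exact ⟨0, by simp, fun h => absurd h hj⟩
    have hjm : (j:ℝ) ≤ m := by exact_mod_cast hj
    have hj0 : (0:ℝ) ≤ j := Nat.cast_nonneg j
    obtain ⟨a, ha⟩ := hivt (2*j*s) (by positivity) (by rw [← hms]; gcongr; linarith)
    obtain ⟨b, hb⟩ := hivt ((2*j+1)*s) (by positivity) (by rw [← hms]; gcongr; linarith)
    have hab : a ≤ b := by
      by_contra hc
      have := hFmono (not_le.1 hc).le
      rw [ha, hb] at this
      nlinarith
    have hv : volume.real (T ∩ Set.Ioc a b) = s := by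
      rw [← hFd a b hab, ha, hb]; ring
    have hne : volume (T ∩ Set.Ioc a b) ≠ 0 := by
      intro h0
      rw [Measure.real, h0] at hv
      simp at hv; linarith
    obtain ⟨t, htm, htu⟩ := exists_le_setAverage hne (hfin _) (hu.mono_set Set.inter_subset_left)
    refine ⟨t, hT1 htm.1, fun _ => ⟨?_, ?_, ?_⟩⟩
    · rw [← ha]; exact hFmono htm.2.1.le
    · rw [← hb]; exact hFmono htm.2.2
    · rw [setAverage_eq, hv, smul_eq_mul] at htu
      have : 2*((m:ℝ)+1)/δ = s⁻¹ := by rw [hs, inv_div]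
      rw [this]
      refine htu.trans ?_
      gcongr
      · exact Filter.Eventually.of_forall hu0
      · exact Set.inter_subset_left
  choose t ht1 ht2 using key
  refine ⟨t, ht1, ?_, fun j hj => (ht2 j hj).2.2⟩
  have main : ∀ j k, j < k → k ≤ m → s * |(j:ℝ) - k| ≤ |t j - t k| := by
    intro j k hjk hk
    refine le_trans ?_ (hFabs _ _)
    have h1 := (ht2 j (by omega)).2.1
    have h2 := (ht2 k hk).1
    have h3 : (j:ℝ) + 1 ≤ k := by exact_mod_cast hjk
    rw [abs_sub_comm, abs_sub_comm (F _), abs_of_nonneg (by linarith)]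
    refine le_trans ?_ (le_abs_self _)
    nlinarith
  intro j k hj hk
  rcases lt_trichotomy j k with h | h | h
  · exact main j k h hk
  · subst h; simp
  · rw [abs_sub_comm, abs_sub_comm (t j)]; exact main k j h hj

/-- `L²` Remez inequality at `0`. -/
lemma remez (δ : ℝ) (hδ : 0 < δ) : ∃ B : ℝ, 1 ≤ B ∧ ∀ (m : ℕ) (p : Polynomial ℂ),
    p.degree < ((m+1 : ℕ) : WithBot ℕ) → ∀ T : Set ℝ, MeasurableSet T → T ⊆ Set.Icc 0 1 →
    δ ≤ volume.real T → ‖p.eval 0‖^2 ≤ B^(m+1) * ∫ t in T, ‖p.eval (t:ℂ)‖^2 := by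
  set D : ℝ := 4 / δ + 4 with hD
  have hD1 : 4 ≤ D := by rw [hD]; have : 0 < 4/δ := by positivity
                         linarith
  have hD2 : 4/δ ≤ D := by linarith
  refine ⟨(D * Real.exp 1)^2 * D, ?_, ?_⟩
  · have : 1 ≤ Real.exp 1 := Real.one_le_exp (by norm_num)
    have h2 : 1 ≤ D * Real.exp 1 := by nlinarith
    nlinarith
  intro m p hp T hT hT1 hvol
  set I := ∫ t in T, ‖p.eval (t:ℂ)‖^2 with hI
  have hI0 : 0 ≤ I := integral_nonneg fun _ => by positivity
  have hcont : Continuous fun t : ℝ => ‖p.eval (t:ℂ)‖^2 := by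
    have := p.continuous
    fun_prop
  obtain ⟨t, ht, hsep, hval⟩ := exists_points m T hT hT1 δ hδ hvol (fun t : ℝ => ‖p.eval (t:ℂ)‖^2)
    ((hcont.continuousOn.integrableOn_compact isCompact_Icc).mono_set hT1) (fun _ => by positivity)
  have h := lagrange_bound m p hp t _ (by positivity) ht hsep (Real.sqrt ((2*(m+1)/δ) * I))
    (fun j hj => Real.le_sqrt_of_sq_le (hval j hj))
  have h2 : ‖p.eval 0‖^2 ≤ ((2 / (δ / (2*(m+1))))^m / (m.factorial : ℝ) * Real.sqrt ((2*(m+1)/δ) * I))^2 := by gcongr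
  refine h2.trans ?_
  rw [mul_pow, Real.sq_sqrt (by positivity)]
  have e1 : (2 / (δ / (2*((m:ℝ)+1))))^m / (m.factorial : ℝ) ≤ (D * Real.exp 1)^(m+1) := by
    have e2 : (2 / (δ / (2*((m:ℝ)+1)))) = (4/δ) * (m+1) := by field_simp; norm_num
    have e3 : ((m:ℝ)+1)^m / (m.factorial : ℝ) ≤ Real.exp 1 ^ (m+1) := by
      have := Real.pow_div_factorial_le_exp ((m:ℝ)+1) (by positivity) m
      refine this.trans ?_
      rw [← Real.exp_nat_mul]; simp
    rw [e2, mul_pow, mul_div_assoc, mul_pow]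
    have e4 : (4/δ)^m ≤ D^(m+1) := calc
      (4/δ)^m ≤ D^m := by gcongr
      _ ≤ D^(m+1) := pow_le_pow_right₀ (by linarith) (by omega)
    gcongr
  have e5 : 2*((m:ℝ)+1)/δ ≤ D^(m+1) := by
    have e6 : 2*((m:ℝ)+1)/δ ≤ D * (m+1) := by
      have : 2*((m:ℝ)+1)/δ = (4/δ) * (m+1) / 2 := by ring
      rw [this]
      have : (4/δ) * ((m:ℝ)+1) ≤ D * (m+1) := by gcongr
      have : 0 ≤ (4/δ) * ((m:ℝ)+1) := by positivity
      linarith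
    have e7 : ((m:ℝ)+1) ≤ D^m := by
      have := one_add_mul_le_pow (a := D - 1) (by linarith) m
      have e8 : (1 + (D-1)) = D := by ring
      rw [e8] at this
      have : (m:ℝ) * 1 ≤ m * (D-1) := by gcongr; linarith
      linarith
    refine e6.trans ?_
    rw [pow_succ, mul_comm]
    gcongr
  calc _ ≤ ((D * Real.exp 1)^(m+1))^2 * (D^(m+1) * I) := by gcongr
    _ = _ := by
        rw [mul_pow ((D * Real.exp 1)^2) D, ← pow_mul, ← pow_mul, mul_comm 2]
        ring

/-- Exponential tail bound. -/
lemma exp_tail (q : ℝ) (hq : 1 ≤ q) (m : ℕ) (z : ℂ) (r : ℝ) (hz : ‖z‖ ≤ r) :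
    ‖Complex.exp z - ∑ k ∈ Finset.range m, z ^ k / k.factorial‖ ≤ (q⁻¹)^m * Real.exp (q * r) := by
  refine (Complex.norm_exp_sub_sum_le_exp_norm_sub_sum z m).trans ?_
  set a := ‖z‖ with ha
  have ha0 : 0 ≤ a := norm_nonneg _
  have hsum : ∀ y : ℝ, HasSum (fun k : ℕ => y^k / (k.factorial : ℝ)) (Real.exp y) := by
    intro y
    rw [Real.exp_eq_exp_ℝ]
    exact NormedSpace.expSeries_div_hasSum_exp y
  have h1 := (hasSum_nat_add_iff' m).2 (hsum a)
  have h2 := (((hasSum_nat_add_iff' m).2 (hsum (q*a)))).mul_left ((q⁻¹)^m)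
  have h3 := hasSum_le (fun k => ?_) h1 h2
  · refine h3.trans ?_
    gcongr
    refine le_trans (sub_le_self _ (Finset.sum_nonneg fun k _ => by positivity)) ?_
    gcongr
  · have hq0 : q ≠ 0 := by positivity
    rw [mul_pow, mul_div_assoc, ← mul_assoc, pow_add q k m, ← mul_assoc, mul_comm ((q⁻¹)^m), mul_assoc (q^k), ← mul_pow, inv_mul_cancel₀ hq0, one_pow, mul_one]
    have : 1 ≤ q^k := one_le_pow₀ hq
    have h5 : 0 ≤ a ^ (k + m) / ((k + m).factorial : ℝ) := by positivity
    nlinarith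

/-- Density of directions. -/
lemma density (d : ℕ) (θ : ℝ) (hθ0 : 0 < θ) (hθ1 : θ < 1) : ∃ δ : ℝ, 0 < δ ∧
    ∀ (Ω : Set (EuclideanSpace ℝ (Fin d))), MeasurableSet Ω → ∀ ρ : ℝ, 0 < ρ →
    (∀ x : EuclideanSpace ℝ (Fin d), volume (Ω ∩ Metric.ball x ρ) ≤ ENNReal.ofReal θ * volume (Metric.ball x ρ)) →
    ∀ x : EuclideanSpace ℝ (Fin d), ENNReal.ofReal δ * volume (Metric.ball (0 : EuclideanSpace ℝ (Fin d)) ρ) ≤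
      volume (Metric.ball (0 : EuclideanSpace ℝ (Fin d)) ρ ∩
        {v | ENNReal.ofReal δ ≤ volume (Set.Icc (0:ℝ) 1 ∩ {t : ℝ | x + t • v ∉ Ω})}) := by
  -- choose t0
  obtain ⟨t0, ht00, ht01, ht0⟩ : ∃ t0 : ℝ, 0 < t0 ∧ t0 < 1 ∧ θ ≤ (1+θ)/2 * t0^d := by
    have hc : Filter.Tendsto (fun t : ℝ => (1+θ)/2 * t^d) (nhdsWithin 1 (Set.Iio 1)) (nhds ((1+θ)/2 * 1^d)) :=
      ((continuous_const.mul (continuous_pow d)).tendsto 1).mono_left nhdsWithin_le_nhds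
    have h1 : ∀ᶠ t in nhdsWithin (1:ℝ) (Set.Iio 1), θ < (1+θ)/2 * t^d :=
      hc.eventually (lt_mem_nhds (by rw [one_pow]; linarith))
    have h2 : ∀ᶠ t in nhdsWithin (1:ℝ) (Set.Iio 1), 0 < t :=
      nhdsWithin_le_nhds (lt_mem_nhds one_pos)
    have h3 : ∀ᶠ t in nhdsWithin (1:ℝ) (Set.Iio 1), t < 1 := self_mem_nhdsWithin
    obtain ⟨t, ha, hb, hc⟩ := (h1.and (h2.and h3)).exists
    exact ⟨t, hb, hc, ha.le⟩
  set δ := (1 - t0) * (1-θ)/4 with hδ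
  have hδ0 : 0 < δ := by rw [hδ]; apply div_pos (mul_pos _ _) <;> linarith
  refine ⟨δ, hδ0, ?_⟩
  intro Ω hΩ ρ hρ hdens x
  set B := Metric.ball (0 : EuclideanSpace ℝ (Fin d)) ρ with hB
  have hBfin : volume B ≠ ∞ := measure_ball_lt_top.ne
  have hmap : Measurable fun p : EuclideanSpace ℝ (Fin d) × ℝ => x + p.2 • p.1 := by fun_prop
  set W : Set (EuclideanSpace ℝ (Fin d) × ℝ) := (B ×ˢ Set.Icc (0:ℝ) 1) ∩ {p | x + p.2 • p.1 ∉ Ω} with hW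
  have hWm : MeasurableSet W := (measurableSet_ball.prod measurableSet_Icc).inter (hmap hΩ.compl)
  set τ : EuclideanSpace ℝ (Fin d) → ℝ≥0∞ := fun v => volume (Set.Icc (0:ℝ) 1 ∩ {t : ℝ | x + t • v ∉ Ω}) with hτ
  have hτ1 : ∀ v, τ v ≤ 1 := fun v => (measure_mono Set.inter_subset_left).trans (by simp)
  -- lower bound
  have hlow : ENNReal.ofReal (1 - t0) * (ENNReal.ofReal ((1-θ)/2) * volume B) ≤ (volume.prod volume) W := by
    rw [Measure.prod_apply_symm hWm]
    have hsl : ∀ t ∈ Set.Icc t0 1, ENNReal.ofReal ((1-θ)/2) * volume B ≤ volume ((fun v => (v, t)) ⁻¹' W) := by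
      intro t ht
      have htpos : 0 < t := ht00.trans_le ht.1
      have hsub : B ⊆ ((fun v => (v, t)) ⁻¹' W) ∪ (fun v => t • v) ⁻¹' ((fun y => x + y) ⁻¹' (Ω ∩ Metric.ball x ρ)) := by
        intro v hv
        by_cases hx : x + t • v ∈ Ω
        · right
          refine ⟨hx, ?_⟩
          have hv' : ‖v‖ < ρ := by simpa [hB] using hv
          simp only [Metric.mem_ball, dist_self_add_left, norm_smul, Real.norm_eq_abs, abs_of_pos htpos]
          have := ht.2
          have := norm_nonneg v
          nlinarith
        · left
          exact ⟨⟨hv, htpos.le, ht.2⟩, hx⟩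
      have hv2 : volume ((fun v : EuclideanSpace ℝ (Fin d) => t • v) ⁻¹' ((fun y => x + y) ⁻¹' (Ω ∩ Metric.ball x ρ))) ≤ ENNReal.ofReal ((1+θ)/2) * volume B := by
        rw [Measure.addHaar_preimage_smul _ htpos.ne', measure_preimage_add]
        have hbx : volume (Metric.ball x ρ) = volume B := by
          rw [hB, Measure.addHaar_ball_center]
        calc _ ≤ ENNReal.ofReal |(t ^ Module.finrank ℝ (EuclideanSpace ℝ (Fin d)))⁻¹| * (ENNReal.ofReal θ * volume B) := by
              gcongr; rw [← hbx]; exact hdens x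
          _ = ENNReal.ofReal (|(t ^ Module.finrank ℝ (EuclideanSpace ℝ (Fin d)))⁻¹| * θ) * volume B := by
              rw [← mul_assoc, ENNReal.ofReal_mul (by positivity)]
          _ ≤ _ := by
              gcongr
              rw [finrank_euclideanSpace_fin, abs_of_pos (by positivity), inv_mul_le_iff₀ (by positivity), mul_comm]
              refine ht0.trans ?_
              have : t0^d ≤ t^d := pow_le_pow_left₀ ht00.le ht.1 d
              gcongr
      have h3 : volume B ≤ volume ((fun v => (v, t)) ⁻¹' W) + ENNReal.ofReal ((1+θ)/2) * volume B :=
        (measure_mono hsub).trans ((measure_union_le _ _).trans (by gcongr))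
      have h4 : volume B = ENNReal.ofReal ((1-θ)/2) * volume B + ENNReal.ofReal ((1+θ)/2) * volume B := by
        rw [← add_mul, ← ENNReal.ofReal_add (by linarith) (by linarith)]
        have : (1-θ)/2 + (1+θ)/2 = 1 := by ring
        simp [this]
      conv at h3 => lhs; rw [h4]
      exact (ENNReal.add_le_add_iff_right (ENNReal.mul_ne_top ENNReal.ofReal_ne_top hBfin)).1 h3
    calc _ = ∫⁻ t in Set.Icc t0 1, ENNReal.ofReal ((1-θ)/2) * volume B := by
          rw [setLIntegral_const, Real.volume_Icc, mul_comm]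
      _ ≤ ∫⁻ t in Set.Icc t0 1, volume ((fun v => (v, t)) ⁻¹' W) := setLIntegral_mono' measurableSet_Icc hsl
      _ ≤ _ := setLIntegral_le_lintegral _ _
  set G := B ∩ {v | ENNReal.ofReal δ ≤ τ v} with hG
  have hup : (volume.prod volume) W ≤ volume G + ENNReal.ofReal δ * volume B := by
    rw [Measure.prod_apply hWm]
    have hpt : ∀ v, volume (Prod.mk v ⁻¹' W) ≤ G.indicator 1 v + B.indicator (fun _ => ENNReal.ofReal δ) v := by
      intro v
      by_cases hv : v ∈ B
      · have hs : Prod.mk v ⁻¹' W = Set.Icc (0:ℝ) 1 ∩ {t : ℝ | x + t • v ∉ Ω} := by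
          ext t; simp [hW, hv]
        rw [hs]
        change τ v ≤ _
        by_cases hg : ENNReal.ofReal δ ≤ τ v
        · rw [Set.indicator_of_mem (show v ∈ G from ⟨hv, hg⟩)]
          exact (hτ1 v).trans (by simp)
        · rw [Set.indicator_of_mem hv]
          exact (not_le.1 hg).le.trans (by simp)
      · have hs : Prod.mk v ⁻¹' W = ∅ := by
          ext t; simp [hW, hv]
        simp [hs]
    have hτm : Measurable τ := by
      have : MeasurableSet ((Set.univ ×ˢ Set.Icc (0:ℝ) 1) ∩ {p : EuclideanSpace ℝ (Fin d) × ℝ | x + p.2 • p.1 ∉ Ω}) :=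
        (MeasurableSet.univ.prod measurableSet_Icc).inter (hmap hΩ.compl)
      have h2 := measurable_measure_prodMk_left (ν := (volume : Measure ℝ)) this
      convert h2 using 3 with v
      ext t; simp
    have hGm : MeasurableSet G := measurableSet_ball.inter (measurableSet_le measurable_const hτm)
    refine (lintegral_mono hpt).trans ?_
    rw [lintegral_add_left (measurable_one.indicator hGm), lintegral_indicator_one hGm, lintegral_indicator_const measurableSet_ball]
  have hfin := hlow.trans hup
  have h5 : ENNReal.ofReal (1 - t0) * (ENNReal.ofReal ((1-θ)/2) * volume B) = ENNReal.ofReal δ * volume B + ENNReal.ofReal δ * volume B := by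
    rw [← mul_assoc, ← ENNReal.ofReal_mul (by linarith), ← add_mul, ← ENNReal.ofReal_add hδ0.le hδ0.le]
    congr 2
    rw [hδ]; ring
  rw [h5] at hfin
  exact (ENNReal.add_le_add_iff_right (ENNReal.mul_ne_top ENNReal.ofReal_ne_top hBfin)).1 hfin

open scoped FourierTransform SchwartzMap ContDiff

/-- Plancherel for the inverse transform of smooth compactly supported functions. -/
lemma plancherel_inv {d : ℕ} (h : EuclideanSpace ℝ (Fin d) → ℂ) (hc : HasCompactSupport h)
    (hs : ContDiff ℝ ∞ h) :
    ∫⁻ x, ENNReal.ofReal (‖𝓕⁻ h x‖^2) = ∫⁻ x, ENNReal.ofReal (‖h x‖^2) := by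
  set H : 𝓢(EuclideanSpace ℝ (Fin d), ℂ) := hc.toSchwartzMap hs with hH
  have h1 := SchwartzMap.integral_norm_sq_fourier (𝓕⁻ H)
  rw [FourierTransform.fourier_fourierInv_eq] at h1
  have hi : ∀ g : 𝓢(EuclideanSpace ℝ (Fin d), ℂ), Integrable (fun x => ‖g x‖^2) := fun g =>
    (memLp_two_iff_integrable_sq_norm g.continuous.aestronglyMeasurable).1 (g.memLp 2)
  have e1 : ∀ x, 𝓕⁻ h x = (𝓕⁻ H) x := by
    intro x; rw [SchwartzMap.fourierInv_coe]; rfl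
  simp_rw [e1]
  rw [← ofReal_integral_eq_lintegral_ofReal (hi _) (Filter.Eventually.of_forall fun _ => by positivity),
    ← h1, ofReal_integral_eq_lintegral_ofReal (hi _) (Filter.Eventually.of_forall fun _ => by positivity)]
  rfl

/-- Taylor coefficients of `𝓕⁻ h` in direction `v`. -/
noncomputable def coefA {d : ℕ} (h : EuclideanSpace ℝ (Fin d) → ℂ) (k : ℕ) (v x : EuclideanSpace ℝ (Fin d)) : ℂ :=
  ∫ ξ, Complex.exp (2 * π * inner ℝ ξ x * Complex.I) * ((2 * π * inner ℝ ξ v * Complex.I)^k / k.factorial * h ξ)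

/-- Symbol of the Taylor remainder. -/
noncomputable def remSym {d : ℕ} (h : EuclideanSpace ℝ (Fin d) → ℂ) (m : ℕ) (t : ℝ) (v ξ : EuclideanSpace ℝ (Fin d)) : ℂ :=
  (Complex.exp (t * (2 * π * inner ℝ ξ v * Complex.I)) - ∑ k ∈ Finset.range m, (t * (2 * π * inner ℝ ξ v * Complex.I))^k / k.factorial) * h ξ

lemma taylor_identity {d : ℕ} (h : EuclideanSpace ℝ (Fin d) → ℂ) (hc : HasCompactSupport h)
    (hs : Continuous h) (m : ℕ) (t : ℝ) (v x : EuclideanSpace ℝ (Fin d)) :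
    𝓕⁻ h (x + t • v) = ∑ k ∈ Finset.range m, (t:ℂ)^k * coefA h k v x + 𝓕⁻ (remSym h m t v) x := by
  have hint : ∀ g : EuclideanSpace ℝ (Fin d) → ℂ, Continuous g → Integrable (fun ξ => g ξ * h ξ) := fun g hg =>
    (hg.mul hs).integrable_of_hasCompactSupport hc.mul_left
  have hI1 : ∀ k, Integrable (fun ξ => (t:ℂ)^k * (Complex.exp (2 * π * inner ℝ ξ x * Complex.I) * ((2 * π * inner ℝ ξ v * Complex.I)^k / k.factorial * h ξ))) := by
    intro k
    convert hint (fun ξ => (t:ℂ)^k * (Complex.exp (2 * π * inner ℝ ξ x * Complex.I) * ((2 * π * inner ℝ ξ v * Complex.I)^k / k.factorial))) (by fun_prop) using 2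
    ring
  have hI2 : Integrable (fun ξ => Complex.exp (2 * π * inner ℝ ξ x * Complex.I) * remSym h m t v ξ) := by
    exact (hint (fun ξ => Complex.exp (2 * π * inner ℝ ξ x * Complex.I) * (Complex.exp (t * (2 * π * inner ℝ ξ v * Complex.I)) - ∑ k ∈ Finset.range m, (t * (2 * π * inner ℝ ξ v * Complex.I))^k / k.factorial)) (by fun_prop)).congr
      (Filter.Eventually.of_forall fun ξ => by simp only [remSym]; ring)
  rw [Real.fourierInv_eq', Real.fourierInv_eq']
  simp only [coefA, ← integral_const_mul, smul_eq_mul]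
  rw [← integral_finsetSum _ (fun k _ => hI1 k)]
  push_cast
  rw [← integral_add (integrable_finsetSum _ fun k _ => hI1 k) hI2]
  congr 1
  ext ξ
  have e : Complex.exp (2 * π * (inner ℝ ξ (x + t • v) : ℝ) * Complex.I) = Complex.exp (2 * π * inner ℝ ξ x * Complex.I) * Complex.exp (t * (2 * π * inner ℝ ξ v * Complex.I)) := by
    rw [← Complex.exp_add, inner_add_right, inner_smul_right]
    congr 1
    push_cast
    ring
  rw [e, remSym]
  have e2 : ∑ k ∈ Finset.range m, (t:ℂ)^k * (Complex.exp (2 * π * inner ℝ ξ x * Complex.I) * ((2 * π * inner ℝ ξ v * Complex.I)^k / k.factorial * h ξ))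
      = Complex.exp (2 * π * inner ℝ ξ x * Complex.I) * ((∑ k ∈ Finset.range m, (t * (2 * π * inner ℝ ξ v * Complex.I))^k / k.factorial) * h ξ) := by
    rw [Finset.sum_mul, Finset.mul_sum]
    apply Finset.sum_congr rfl
    intro k _
    rw [mul_pow]; ring
  rw [e2]; ring

lemma coefA_measurable {d : ℕ} (h : EuclideanSpace ℝ (Fin d) → ℂ) (hs : Continuous h) (k : ℕ) :
    Measurable fun p : EuclideanSpace ℝ (Fin d) × EuclideanSpace ℝ (Fin d) => coefA h k p.1 p.2 := by
  have : Continuous (Function.uncurry fun (p : EuclideanSpace ℝ (Fin d) × EuclideanSpace ℝ (Fin d)) (ξ : EuclideanSpace ℝ (Fin d)) =>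
    Complex.exp (2 * π * inner ℝ ξ p.2 * Complex.I) * ((2 * π * inner ℝ ξ p.1 * Complex.I)^k / k.factorial * h ξ)) := by
    unfold Function.uncurry
    fun_prop
  exact (this.stronglyMeasurable.integral_prod_right (ν := volume)).measurable

lemma rem_bound {d : ℕ} (h : EuclideanSpace ℝ (Fin d) → ℂ) (hc : HasCompactSupport h)
    (hs : ContDiff ℝ ∞ h) (S ρ q : ℝ) (hS : 0 ≤ S) (hq : 1 ≤ q) (hsupp : ∀ ξ, h ξ ≠ 0 → ‖ξ‖ ≤ S)
    (m : ℕ) (t : ℝ) (ht : t ∈ Set.Icc (0:ℝ) 1) (v : EuclideanSpace ℝ (Fin d)) (hv : ‖v‖ ≤ ρ) :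
    ∫⁻ x, ENNReal.ofReal (‖𝓕⁻ (remSym h m t v) x‖^2) ≤
      ENNReal.ofReal (((q⁻¹)^m * Real.exp (q * (2 * π * S * ρ)))^2) * ∫⁻ x, ENNReal.ofReal (‖𝓕⁻ h x‖^2) := by
  rw [plancherel_inv h hc hs, plancherel_inv (remSym h m t v) hc.mul_left ?_]
  · rw [← lintegral_const_mul' _ _ ENNReal.ofReal_ne_top]
    apply lintegral_mono
    intro ξ
    simp only
    rw [← ENNReal.ofReal_mul (by positivity), ← mul_pow]
    by_cases h0 : h ξ = 0
    · simp [remSym, h0]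
    apply ENNReal.ofReal_le_ofReal
    gcongr
    rw [remSym, norm_mul]
    gcongr
    apply exp_tail q hq
    have h1 : |inner ℝ ξ v| ≤ S * ρ := (abs_real_inner_le_norm ξ v).trans (mul_le_mul (hsupp ξ h0) hv (norm_nonneg _) hS)
    simp only [norm_mul, Complex.norm_real, Complex.norm_I, mul_one, Real.norm_eq_abs, Complex.norm_ofNat, abs_of_pos pi_pos, abs_of_nonneg ht.1]
    have h2 : 0 ≤ 2 * π * |inner ℝ ξ v| := by positivity
    calc t * (2 * π * |inner ℝ ξ v|) ≤ 1 * (2 * π * |inner ℝ ξ v|) := by gcongr; exact ht.2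
      _ ≤ 2 * π * S * ρ := by rw [one_mul, mul_assoc (2*π)]; gcongr
  · unfold remSym
    have hin : ContDiff ℝ ∞ fun ξ : EuclideanSpace ℝ (Fin d) => ((inner ℝ ξ v : ℝ) : ℂ) :=
      Complex.ofRealCLM.contDiff.comp (contDiff_id.inner ℝ contDiff_const)
    refine ContDiff.mul (ContDiff.sub ?_ (ContDiff.sum fun k _ => ?_)) hs
    · fun_prop
    · fun_prop

/-- Pointwise bound along a good direction. -/
lemma pointwise_bound {d : ℕ} (δ B : ℝ) (hδ : 0 < δ) (hB1 : 1 ≤ B)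
    (hB : ∀ (m : ℕ) (p : Polynomial ℂ),
    p.degree < ((m+1 : ℕ) : WithBot ℕ) → ∀ T : Set ℝ, MeasurableSet T → T ⊆ Set.Icc 0 1 →
    δ ≤ volume.real T → ‖p.eval 0‖^2 ≤ B^(m+1) * ∫ t in T, ‖p.eval (t:ℂ)‖^2)
    (Ω : Set (EuclideanSpace ℝ (Fin d))) (hΩ : MeasurableSet Ω)
    (h : EuclideanSpace ℝ (Fin d) → ℂ) (hc : HasCompactSupport h)
    (hs : Continuous h) (m : ℕ) (v x : EuclideanSpace ℝ (Fin d))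
    (hgood : ENNReal.ofReal δ ≤ volume (Set.Icc (0:ℝ) 1 ∩ {t : ℝ | x + t • v ∉ Ω})) :
    ENNReal.ofReal (‖𝓕⁻ h x‖^2) ≤ ENNReal.ofReal (2 * B^(m+1)) * ∫⁻ t in Set.Icc (0:ℝ) 1,
      (Ωᶜ.indicator (fun y => ENNReal.ofReal (‖𝓕⁻ h y‖^2)) (x + t • v) +
        ENNReal.ofReal (‖𝓕⁻ h (x + t • v) - ∑ k ∈ Finset.range (m+1), (t:ℂ)^k * coefA h k v x‖^2)) := by
  set T := Set.Icc (0:ℝ) 1 ∩ {t : ℝ | x + t • v ∉ Ω} with hT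
  have hmap : Measurable fun t : ℝ => x + t • v := by fun_prop
  have hTm : MeasurableSet T := measurableSet_Icc.inter (hmap hΩ.compl)
  have hTfin : volume T ≠ ⊤ := ((measure_mono Set.inter_subset_left).trans_lt (by simp)).ne
  set p : Polynomial ℂ := ∑ k ∈ Finset.range (m+1), Polynomial.monomial k (coefA h k v x) with hp
  have hdeg : p.degree < ((m+1 : ℕ) : WithBot ℕ) := by
    rw [hp]
    refine lt_of_le_of_lt (Polynomial.degree_sum_le _ _) ?_
    rw [Finset.sup_lt_iff (WithBot.bot_lt_coe _)]
    intro k hk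
    refine lt_of_le_of_lt (Polynomial.degree_monomial_le _ _) ?_
    exact_mod_cast Finset.mem_range.1 hk
  have hev : ∀ z : ℂ, p.eval z = ∑ k ∈ Finset.range (m+1), z^k * coefA h k v x := by
    intro z
    rw [hp, Polynomial.eval_finsetSum]
    apply Finset.sum_congr rfl
    intro k _
    rw [Polynomial.eval_monomial, mul_comm]
  have h0 : p.eval 0 = 𝓕⁻ h x := by
    rw [hev, Finset.sum_range_succ']
    simp [coefA, Real.fourierInv_eq']
  have hr := hB m p hdeg T hTm Set.inter_subset_left ((ENNReal.ofReal_le_iff_le_toReal hTfin).1 hgood)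
  have hcont : Continuous fun t : ℝ => ‖p.eval (t:ℂ)‖^2 := by
    have := p.continuous
    fun_prop
  have hint : IntegrableOn (fun t : ℝ => ‖p.eval (t:ℂ)‖^2) T :=
    (hcont.continuousOn.integrableOn_compact isCompact_Icc).mono_set Set.inter_subset_left
  rw [h0] at hr
  calc ENNReal.ofReal (‖𝓕⁻ h x‖^2) ≤ ENNReal.ofReal (B^(m+1) * ∫ t in T, ‖p.eval (t:ℂ)‖^2) := ENNReal.ofReal_le_ofReal hr
    _ = ENNReal.ofReal (B^(m+1)) * ∫⁻ t in T, ENNReal.ofReal (‖p.eval (t:ℂ)‖^2) := by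
        rw [ENNReal.ofReal_mul (by positivity), ofReal_integral_eq_lintegral_ofReal hint (Filter.Eventually.of_forall fun _ => by positivity)]
    _ ≤ ENNReal.ofReal (B^(m+1)) * ∫⁻ t in T, 2 * (Ωᶜ.indicator (fun y => ENNReal.ofReal (‖𝓕⁻ h y‖^2)) (x + t • v) +
        ENNReal.ofReal (‖𝓕⁻ h (x + t • v) - ∑ k ∈ Finset.range (m+1), (t:ℂ)^k * coefA h k v x‖^2)) := by
        refine mul_le_mul' le_rfl ?_
        apply setLIntegral_mono' hTm
        intro t ht
        rw [Set.indicator_of_mem (show x + t • v ∈ Ωᶜ from ht.2), ← ENNReal.ofReal_add (by positivity) (by positivity), hev]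
        have htwo : ∀ u : ℝ, (2:ℝ≥0∞) * ENNReal.ofReal u = ENNReal.ofReal (2 * u) := by
          intro u
          rw [ENNReal.ofReal_mul (by norm_num)]; simp
        rw [htwo]
        apply ENNReal.ofReal_le_ofReal
        set a := 𝓕⁻ h (x + t • v)
        set b := ∑ k ∈ Finset.range (m+1), (t:ℂ)^k * coefA h k v x
        have h1 : ‖b‖ ≤ ‖a‖ + ‖a - b‖ := by
          have := norm_sub_le a (a - b)
          simpa using this
        have h2 : ‖b‖^2 ≤ (‖a‖ + ‖a - b‖)^2 := by gcongr
        nlinarith [sq_nonneg (‖a‖ - ‖a - b‖)]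
    _ ≤ _ := by
        rw [lintegral_const_mul' _ _ (by simp), ← mul_assoc]
        have : ENNReal.ofReal (B^(m+1)) * 2 = ENNReal.ofReal (2 * B^(m+1)) := by
          rw [mul_comm 2, ENNReal.ofReal_mul (by positivity)]; simp
        rw [this]
        gcongr
        exact Set.inter_subset_left

lemma fourierInv_continuous {d : ℕ} (h : EuclideanSpace ℝ (Fin d) → ℂ) (hc : HasCompactSupport h)
    (hs : ContDiff ℝ ∞ h) : Continuous (𝓕⁻ h) := by
  have e1 : 𝓕⁻ h = (𝓕⁻ (hc.toSchwartzMap hs) : 𝓢(EuclideanSpace ℝ (Fin d), ℂ)) := by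
    rw [SchwartzMap.fourierInv_coe]; rfl
  rw [e1]; exact SchwartzMap.continuous _

/-- Joint measurability of the integrand in the integrated bound. -/
lemma integrand_measurable {d : ℕ} (h : EuclideanSpace ℝ (Fin d) → ℂ) (hs : Continuous h)
    (f : EuclideanSpace ℝ (Fin d) → ℂ) (hf : Measurable f) (Ω : Set (EuclideanSpace ℝ (Fin d)))
    (hΩ : MeasurableSet Ω) (m : ℕ) :
    Measurable fun p : EuclideanSpace ℝ (Fin d) × EuclideanSpace ℝ (Fin d) × ℝ =>
      (Ωᶜ.indicator (fun y => ENNReal.ofReal (‖f y‖^2)) (p.1 + p.2.2 • p.2.1) +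
        ENNReal.ofReal (‖f (p.1 + p.2.2 • p.2.1) -
          ∑ k ∈ Finset.range (m+1), (p.2.2:ℂ)^k * coefA h k p.2.1 p.1‖^2)) := by
  have hfm : Measurable fun y => ENNReal.ofReal (‖f y‖^2) := by fun_prop
  have hind : Measurable (Ωᶜ.indicator (fun y => ENNReal.ofReal (‖f y‖^2))) := hfm.indicator hΩ.compl
  have hshift : Measurable fun p : EuclideanSpace ℝ (Fin d) × EuclideanSpace ℝ (Fin d) × ℝ =>
      p.1 + p.2.2 • p.2.1 := by fun_prop
  have hA : ∀ k, Measurable fun p : EuclideanSpace ℝ (Fin d) × EuclideanSpace ℝ (Fin d) × ℝ =>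
      coefA h k p.2.1 p.1 := fun k => by
    have h1 := coefA_measurable h hs k
    generalize coefA h k = c at h1 ⊢
    have h2 : Measurable fun p : EuclideanSpace ℝ (Fin d) × EuclideanSpace ℝ (Fin d) × ℝ =>
      (p.2.1, p.1) := by fun_prop
    exact h1.comp h2
  have hf2 : Measurable fun p : EuclideanSpace ℝ (Fin d) × EuclideanSpace ℝ (Fin d) × ℝ =>
      f (p.1 + p.2.2 • p.2.1) := hf.comp hshift
  have hfirst : Measurable fun p : EuclideanSpace ℝ (Fin d) × EuclideanSpace ℝ (Fin d) × ℝ =>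
      Ωᶜ.indicator (fun y => ENNReal.ofReal (‖f y‖^2)) (p.1 + p.2.2 • p.2.1) := hind.comp hshift
  have hpw : ∀ k : ℕ, Measurable fun p : EuclideanSpace ℝ (Fin d) × EuclideanSpace ℝ (Fin d) × ℝ =>
      (p.2.2:ℂ)^k := fun k => by fun_prop
  have hsum : Measurable fun p : EuclideanSpace ℝ (Fin d) × EuclideanSpace ℝ (Fin d) × ℝ =>
      ∑ k ∈ Finset.range (m+1), (p.2.2:ℂ)^k * coefA h k p.2.1 p.1 :=
    Finset.measurable_fun_sum _ fun k _ => (hpw k).mul (hA k)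
  have hdiff := hf2.sub hsum
  have hsq := hdiff.norm.pow_const 2
  have hlast := ENNReal.measurable_ofReal.comp hsq
  exact hfirst.add hlast

/-- Integrated bound. -/
lemma integrated_bound {d : ℕ} (δ B : ℝ) (hδ : 0 < δ) (hB1 : 1 ≤ B)
    (hB : ∀ (m : ℕ) (p : Polynomial ℂ),
    p.degree < ((m+1 : ℕ) : WithBot ℕ) → ∀ T : Set ℝ, MeasurableSet T → T ⊆ Set.Icc 0 1 →
    δ ≤ volume.real T → ‖p.eval 0‖^2 ≤ B^(m+1) * ∫ t in T, ‖p.eval (t:ℂ)‖^2)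
    (Ω : Set (EuclideanSpace ℝ (Fin d))) (hΩ : MeasurableSet Ω) (ρ : ℝ) (hρ : 0 < ρ)
    (hden : ∀ x : EuclideanSpace ℝ (Fin d), ENNReal.ofReal δ * volume (Metric.ball (0 : EuclideanSpace ℝ (Fin d)) ρ) ≤
      volume (Metric.ball (0 : EuclideanSpace ℝ (Fin d)) ρ ∩
        {v | ENNReal.ofReal δ ≤ volume (Set.Icc (0:ℝ) 1 ∩ {t : ℝ | x + t • v ∉ Ω})}))
    (h : EuclideanSpace ℝ (Fin d) → ℂ) (hc : HasCompactSupport h)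
    (hs : ContDiff ℝ ∞ h) (S q : ℝ) (hS : 0 ≤ S) (hq : 1 ≤ q) (hsupp : ∀ ξ, h ξ ≠ 0 → ‖ξ‖ ≤ S) (m : ℕ) :
    ENNReal.ofReal δ * ∫⁻ x, ENNReal.ofReal (‖𝓕⁻ h x‖^2) ≤
      ENNReal.ofReal (2 * B^(m+1)) * ((∫⁻ x in Ωᶜ, ENNReal.ofReal (‖𝓕⁻ h x‖^2)) +
        ENNReal.ofReal (((q⁻¹)^(m+1) * Real.exp (q * (2 * π * S * ρ)))^2) * ∫⁻ x, ENNReal.ofReal (‖𝓕⁻ h x‖^2)) := by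
  set f := 𝓕⁻ h with hf
  have hfc : Continuous f := fourierInv_continuous h hc hs
  set b := Metric.ball (0 : EuclideanSpace ℝ (Fin d)) ρ with hb
  set I := ∫⁻ x, ENNReal.ofReal (‖f x‖^2) with hI
  set J := ∫⁻ x in Ωᶜ, ENNReal.ofReal (‖f x‖^2) with hJ
  set K := ENNReal.ofReal (2 * B^(m+1)) with hK
  set η := ENNReal.ofReal (((q⁻¹)^(m+1) * Real.exp (q * (2 * π * S * ρ)))^2) with hη
  set Φ : EuclideanSpace ℝ (Fin d) → EuclideanSpace ℝ (Fin d) → ℝ → ℝ≥0∞ := fun x v t =>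
    Ωᶜ.indicator (fun y => ENNReal.ofReal (‖f y‖^2)) (x + t • v) +
        ENNReal.ofReal (‖f (x + t • v) - ∑ k ∈ Finset.range (m+1), (t:ℂ)^k * coefA h k v x‖^2) with hΦ
  have hfm : Measurable fun y => ENNReal.ofReal (‖f y‖^2) := by
    have := hfc.measurable
    fun_prop
  have hind : Measurable (Ωᶜ.indicator (fun y => ENNReal.ofReal (‖f y‖^2))) := hfm.indicator hΩ.compl
  have hΦm : Measurable fun p : EuclideanSpace ℝ (Fin d) × EuclideanSpace ℝ (Fin d) × ℝ => Φ p.1 p.2.1 p.2.2 :=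
    integrand_measurable h hs.continuous f hfc.measurable Ω hΩ m
  -- the (v,t) measure
  set μ : Measure (EuclideanSpace ℝ (Fin d) × ℝ) := (volume.restrict b).prod (volume.restrict (Set.Icc (0:ℝ) 1)) with hμ
  have hvolb : volume b ≠ ⊤ := measure_ball_lt_top.ne
  have hvolb0 : volume b ≠ 0 := (Metric.measure_ball_pos volume _ hρ).ne'
  have step1 : ∀ x, ENNReal.ofReal δ * volume b * ENNReal.ofReal (‖f x‖^2) ≤ K * ∫⁻ w, Φ x w.1 w.2 ∂μ := by
    intro x
    have hm1 : Measurable fun p : EuclideanSpace ℝ (Fin d) × ℝ => Φ x p.1 p.2 :=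
      hΦm.comp (measurable_const.prodMk measurable_id)
    have hm2 : Measurable fun v => K * ∫⁻ t in Set.Icc (0:ℝ) 1, Φ x v t := by
      refine Measurable.const_mul ?_ _
      exact Measurable.lintegral_prod_right hm1
    have hmk := mul_meas_ge_le_lintegral (μ := volume.restrict b) hm2 (ENNReal.ofReal (‖f x‖^2))
    rw [lintegral_prod _ hm1.aemeasurable, ← lintegral_const_mul']
    swap
    · exact ENNReal.ofReal_ne_top
    refine le_trans ?_ hmk
    rw [mul_comm]
    gcongr
    rw [Measure.restrict_apply' measurableSet_ball]
    refine (hden x).trans (measure_mono ?_)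
    rintro v ⟨hv1, hv2⟩
    exact ⟨pointwise_bound δ B hδ hB1 hB Ω hΩ h hc hs.continuous m v x hv2, hv1⟩
  have step2 : ∀ w ∈ b ×ˢ Set.Icc (0:ℝ) 1, ∫⁻ x, Φ x w.1 w.2 ≤ J + η * I := by
    rintro ⟨v, t⟩ ⟨hv, ht⟩
    simp only at hv ht
    have hv' : ‖v‖ ≤ ρ := by
      have : ‖v‖ < ρ := by simpa [hb] using hv
      exact this.le
    simp only [hΦ]
    have hshift : Measurable fun x : EuclideanSpace ℝ (Fin d) => x + t • v := by fun_prop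
    have hfirst : Measurable fun x : EuclideanSpace ℝ (Fin d) =>
        Ωᶜ.indicator (fun y => ENNReal.ofReal (‖f y‖^2)) (x + t • v) := hind.comp hshift
    rw [lintegral_add_left hfirst]
    gcongr
    · rw [lintegral_add_right_eq_self (fun y => Ωᶜ.indicator (fun y => ENNReal.ofReal (‖f y‖^2)) y), lintegral_indicator hΩ.compl]
    · have := rem_bound h hc hs S ρ q hS hq hsupp (m+1) t ht v hv'
      refine le_trans (le_of_eq ?_) this
      congr 1
      ext x
      rw [hf, taylor_identity h hc hs.continuous (m+1) t v x, add_sub_cancel_left]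
  have step3 : ENNReal.ofReal δ * volume b * I ≤ K * ((J + η * I) * volume b) := by
    calc ENNReal.ofReal δ * volume b * I = ∫⁻ x, ENNReal.ofReal δ * volume b * ENNReal.ofReal (‖f x‖^2) := by
          rw [lintegral_const_mul _ hfm]
      _ ≤ ∫⁻ x, K * ∫⁻ w, Φ x w.1 w.2 ∂μ := lintegral_mono step1
      _ = K * ∫⁻ x, ∫⁻ w, Φ x w.1 w.2 ∂μ := lintegral_const_mul' _ _ ENNReal.ofReal_ne_top
      _ = K * ∫⁻ w, (∫⁻ x, Φ x w.1 w.2) ∂μ := by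
          rw [lintegral_lintegral_swap]
          exact hΦm.aemeasurable
      _ ≤ K * ∫⁻ w, (J + η * I) ∂μ := by
          refine mul_le_mul' le_rfl ?_
          apply lintegral_mono_ae
          have : μ = (volume.prod volume).restrict (b ×ˢ Set.Icc (0:ℝ) 1) := Measure.prod_restrict _ _
          rw [this]
          filter_upwards [ae_restrict_mem (measurableSet_ball.prod measurableSet_Icc)] with w hw
          exact step2 w hw
      _ = _ := by
          rw [lintegral_const, hμ, ← Set.univ_prod_univ, Measure.prod_prod]
          simp
  have : volume b * (ENNReal.ofReal δ * I) ≤ volume b * (K * (J + η * I)) := by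
    calc _ = ENNReal.ofReal δ * volume b * I := by ring
      _ ≤ _ := step3
      _ = _ := by ring
  exact (ENNReal.mul_le_mul_iff_right hvolb0 hvolb).1 this

lemma schwartz_sq_integrable {d : ℕ} (g : 𝓢(EuclideanSpace ℝ (Fin d), ℂ)) : Integrable (fun x => ‖g x‖^2) :=
  (memLp_two_iff_integrable_sq_norm g.continuous.aestronglyMeasurable).1 (g.memLp 2)

/-- Logvinenko–Sereda type inequality. -/
lemma logvinenko_sereda (d : ℕ) (θ : ℝ) (hθ0 : 0 < θ) (hθ1 : θ < 1) : ∃ A C : ℝ, 0 < A ∧ 0 < C ∧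
    ∀ (Ω : Set (EuclideanSpace ℝ (Fin d))), MeasurableSet Ω → ∀ ρ : ℝ, 0 < ρ →
    (∀ x : EuclideanSpace ℝ (Fin d), volume (Ω ∩ Metric.ball x ρ) ≤ ENNReal.ofReal θ * volume (Metric.ball x ρ)) →
    ∀ (h : EuclideanSpace ℝ (Fin d) → ℂ) (hc : HasCompactSupport h)
    (hs : ContDiff ℝ ∞ h) (S : ℝ), 0 ≤ S → (∀ ξ, h ξ ≠ 0 → ‖ξ‖ ≤ S) →
    ∫ x, ‖𝓕⁻ (hc.toSchwartzMap hs) x‖^2 ≤ A * Real.exp (C * (S * ρ)) * ∫ x in Ωᶜ, ‖𝓕⁻ (hc.toSchwartzMap hs) x‖^2 := by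
  obtain ⟨δ, hδ, hden⟩ := density d θ hθ0 hθ1
  obtain ⟨B, hB1, hB⟩ := remez δ hδ
  have he : 1 ≤ Real.exp 1 := Real.one_le_exp (by norm_num)
  have hBpos : 0 < B := by linarith
  set q : ℝ := 4 * (B * Real.exp 1) / δ + B * Real.exp 1 with hq
  have hBe : 1 ≤ B * Real.exp 1 := by nlinarith
  have hq1 : 1 ≤ q := by
    have : 0 < 4 * (B * Real.exp 1) / δ := by positivity
    linarith
  have hqa : B * Real.exp 1 / q^2 ≤ δ / 4 := by
    rw [div_le_div_iff₀ (by positivity) (by norm_num)]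
    have h1 : 4 * (B * Real.exp 1) ≤ δ * q := by
      have : δ * q = 4 * (B * Real.exp 1) + δ * (B * Real.exp 1) := by rw [hq]; field_simp
      have : 0 < δ * (B * Real.exp 1) := by positivity
      linarith
    have h2 : δ * q ≤ δ * q^2 := by
      gcongr; nlinarith
    linarith
  have hqb : B * Real.exp 1 / q^2 ≤ 1 := by
    rw [div_le_one (by positivity)]
    have : 0 < 4 * (B * Real.exp 1) / δ := by positivity
    have : B * Real.exp 1 ≤ q := by linarith
    nlinarith
  have hlogB : 0 ≤ Real.log B := Real.log_nonneg hB1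
  refine ⟨4 * B / δ, 4 * π * q * Real.log B + 1, by positivity, by positivity, ?_⟩
  intro Ω hΩ ρ hρ hdens h hc hs S hS hsupp
  set r := 4 * π * q * (S * ρ) with hr
  have hr0 : 0 ≤ r := by positivity
  set m := ⌊r⌋₊ with hm
  have hmr : (m:ℝ) ≤ r := Nat.floor_le hr0
  have hmr2 : r ≤ (m:ℝ) + 1 := (Nat.lt_floor_add_one r).le
  have hmain := integrated_bound δ B hδ hB1 hB Ω hΩ ρ hρ (hden Ω hΩ ρ hρ hdens) h hc hs S q hS hq1 hsupp m
  set f : 𝓢(EuclideanSpace ℝ (Fin d), ℂ) := 𝓕⁻ (hc.toSchwartzMap hs) with hf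
  have e1 : 𝓕⁻ h = f := by
    rw [hf, SchwartzMap.fourierInv_coe]; rfl
  have hint := schwartz_sq_integrable f
  have hnn : ∀ ν : Measure (EuclideanSpace ℝ (Fin d)), 0 ≤ᵐ[ν] fun x => ‖f x‖^2 := fun ν => Filter.Eventually.of_forall fun _ => by positivity
  rw [e1, ← ofReal_integral_eq_lintegral_ofReal hint (hnn _), ← ofReal_integral_eq_lintegral_ofReal hint.integrableOn (hnn _)] at hmain
  set I := ∫ x, ‖f x‖^2 with hI
  set J := ∫ x in Ωᶜ, ‖f x‖^2 with hJ
  have hI0 : 0 ≤ I := integral_nonneg fun _ => by positivity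
  have hJ0 : 0 ≤ J := integral_nonneg fun _ => by positivity
  set η := ((q⁻¹)^(m+1) * Real.exp (q * (2 * π * S * ρ)))^2 with hη
  rw [← ENNReal.ofReal_mul hδ.le, ← ENNReal.ofReal_mul (by positivity), ← ENNReal.ofReal_add hJ0 (by positivity), ← ENNReal.ofReal_mul (by positivity),
    ENNReal.ofReal_le_ofReal_iff (by positivity)] at hmain
  have hKη : 2 * B^(m+1) * η ≤ δ / 2 := by
    have h1 : η ≤ (Real.exp 1 / q^2)^(m+1) := by
      have : η = ((q^2)⁻¹)^(m+1) * Real.exp r := by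
        rw [hη, mul_pow, ← Real.exp_nat_mul]
        congr 1
        · rw [← pow_mul, ← inv_pow, ← pow_mul, mul_comm]
        · congr 1; rw [hr]; push_cast; ring
      rw [this, div_eq_inv_mul, mul_pow]
      gcongr
      rw [← Real.exp_nat_mul]
      gcongr
      push_cast; linarith
    have h2 : B^(m+1) * η ≤ (B * Real.exp 1 / q^2)^(m+1) := by
      rw [mul_div_assoc, mul_pow]; gcongr
    have h3 : (B * Real.exp 1 / q^2)^(m+1) ≤ B * Real.exp 1 / q^2 := by
      rw [pow_succ]
      have : (B * Real.exp 1 / q^2)^m ≤ 1 := pow_le_one₀ (by positivity) hqb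
      have : 0 ≤ B * Real.exp 1 / q^2 := by positivity
      nlinarith
    linarith
  have hKB : B^(m+1) ≤ B * Real.exp ((4 * π * q * Real.log B + 1) * (S * ρ)) := by
    rw [pow_succ, mul_comm]
    gcongr
    calc B^m = Real.exp (m * Real.log B) := by
          rw [Real.exp_nat_mul, Real.exp_log hBpos]
      _ ≤ Real.exp (r * Real.log B) := by gcongr
      _ ≤ _ := by
          apply Real.exp_le_exp.2
          rw [hr]
          have : 0 ≤ S * ρ := by positivity
          nlinarith
  have h4 : δ / 2 * I ≤ 2 * B^(m+1) * J := by
    have : 2 * B^(m+1) * η * I ≤ δ/2 * I := by gcongr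
    nlinarith
  have h5 : I ≤ (4 / δ) * B^(m+1) * J := by
    have : I = (2/δ) * (δ/2 * I) := by field_simp
    rw [this]
    calc _ ≤ (2/δ) * (2 * B^(m+1) * J) := by gcongr
      _ = _ := by ring
  calc I ≤ (4 / δ) * B^(m+1) * J := h5
    _ ≤ (4 / δ) * (B * Real.exp ((4 * π * q * Real.log B + 1) * (S * ρ))) * J := by gcongr
    _ = _ := by ring

/-- Lower bound on the high-frequency mass. -/
lemma tail_lower (d : ℕ) (θ : ℝ) (hθ0 : 0 < θ) (hθ1 : θ < 1) : ∃ a C : ℝ, 0 < a ∧ 0 < C ∧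
    ∀ (Ω : Set (EuclideanSpace ℝ (Fin d))), MeasurableSet Ω → ∀ ρ : ℝ, 0 < ρ →
    (∀ x : EuclideanSpace ℝ (Fin d), volume (Ω ∩ Metric.ball x ρ) ≤ ENNReal.ofReal θ * volume (Metric.ball x ρ)) →
    ∀ (φ : 𝓢(EuclideanSpace ℝ (Fin d), ℂ)), (∀ x ∉ Ω, φ x = 0) → ∫ x, ‖φ x‖^2 = 1 →
    ∀ R : ℝ, 0 < R → a * Real.exp (-C * (R * ρ)) ≤ ∫ ξ in {ξ | R ≤ ‖ξ‖}, ‖𝓕 φ ξ‖^2 := by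
  obtain ⟨A, C, hA, hC, hLS⟩ := logvinenko_sereda d θ hθ0 hθ1
  refine ⟨1 / (2 * (A + 1)), 2 * C, by positivity, by positivity, ?_⟩
  intro Ω hΩ ρ hρ hdens φ hφ hnorm R hR
  set χ : ContDiffBump (0 : EuclideanSpace ℝ (Fin d)) := ⟨R, 2 * R, hR, by linarith⟩ with hχ
  set h : EuclideanSpace ℝ (Fin d) → ℂ := fun ξ => (χ ξ : ℂ) * 𝓕 φ ξ with hh
  have hχc : HasCompactSupport (fun ξ => (χ ξ : ℂ)) := χ.hasCompactSupport.comp_left (g := fun r : ℝ => (r:ℂ)) (by simp)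
  have hc : HasCompactSupport h := hχc.mul_right
  have hs : ContDiff ℝ ∞ h := (Complex.ofRealCLM.contDiff.comp χ.contDiff).mul (SchwartzMap.smooth (𝓕 φ) ⊤)
  have hsupp : ∀ ξ, h ξ ≠ 0 → ‖ξ‖ ≤ 2 * R := by
    intro ξ hξ
    by_contra hcon
    apply hξ
    have : χ ξ = 0 := χ.zero_of_le_dist (by simpa [hχ] using (not_le.1 hcon).le)
    simp [hh, this]
  have hls := hLS Ω hΩ ρ hρ hdens h hc hs (2 * R) (by positivity) hsupp
  set H := hc.toSchwartzMap hs with hH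
  set f : 𝓢(EuclideanSpace ℝ (Fin d), ℂ) := 𝓕⁻ H with hf
  set g : 𝓢(EuclideanSpace ℝ (Fin d), ℂ) := φ - f with hg
  set τ := ∫ ξ in {ξ | R ≤ ‖ξ‖}, ‖𝓕 φ ξ‖^2 with hτ
  have hset : MeasurableSet {ξ : EuclideanSpace ℝ (Fin d) | R ≤ ‖ξ‖} := measurableSet_le measurable_const measurable_norm
  have hgτ : ∫ x, ‖g x‖^2 ≤ τ := by
    rw [← SchwartzMap.integral_norm_sq_fourier, hτ, ← integral_indicator hset]
    refine integral_mono (schwartz_sq_integrable _) ((schwartz_sq_integrable _).indicator hset) ?_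
    intro ξ
    have e : 𝓕 g ξ = (1 - (χ ξ : ℂ)) * 𝓕 φ ξ := by
      rw [hg, sub_eq_add_neg, FourierTransform.fourier_add, FourierTransform.fourier_neg, hf, FourierTransform.fourier_fourierInv_eq]
      have : H ξ = (χ ξ : ℂ) * 𝓕 φ ξ := rfl
      simp [this]; ring
    simp only [e]
    by_cases hξ : R ≤ ‖ξ‖
    · rw [Set.indicator_of_mem (by exact hξ)]
      have : ‖(1 - (χ ξ : ℂ))‖ ≤ 1 := by
        rw [← Complex.ofReal_one, ← Complex.ofReal_sub, Complex.norm_real, Real.norm_eq_abs, abs_le]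
        constructor <;> linarith [χ.nonneg' ξ, χ.le_one (x := ξ)]
      rw [norm_mul]
      gcongr
      have := norm_nonneg (𝓕 φ ξ)
      nlinarith
    · have : χ ξ = 1 := χ.one_of_mem_closedBall (by simpa [hχ] using (not_le.1 hξ).le)
      rw [this]
      simp
      apply Set.indicator_nonneg
      intros; positivity
  have hJ : ∫ x in Ωᶜ, ‖f x‖^2 ≤ τ := by
    refine le_trans ?_ hgτ
    have : ∫ x in Ωᶜ, ‖f x‖^2 = ∫ x in Ωᶜ, ‖g x‖^2 := by
      apply setIntegral_congr_fun hΩ.compl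
      intro x hx
      simp [hg, hφ x hx]
    rw [this]
    exact setIntegral_le_integral (schwartz_sq_integrable g) (Filter.Eventually.of_forall fun _ => by positivity)
  have h1 : 1 ≤ 2 * (∫ x, ‖f x‖^2) + 2 * ∫ x, ‖g x‖^2 := by
    rw [← hnorm, ← integral_const_mul, ← integral_const_mul,
      ← integral_add ((schwartz_sq_integrable f).const_mul 2) ((schwartz_sq_integrable g).const_mul 2)]
    refine integral_mono (schwartz_sq_integrable φ) (((schwartz_sq_integrable f).const_mul 2).add ((schwartz_sq_integrable g).const_mul 2)) ?_
    intro x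
    have e : φ x = f x + g x := by simp [hg]
    simp only [Pi.add_apply]
    have h1 : ‖φ x‖ ≤ ‖f x‖ + ‖g x‖ := by rw [e]; exact norm_add_le _ _
    have h2 : ‖φ x‖^2 ≤ (‖f x‖ + ‖g x‖)^2 := by gcongr
    nlinarith [sq_nonneg (‖f x‖ - ‖g x‖)]
  set X := Real.exp (C * (2 * R * ρ)) with hX
  have hX1 : 1 ≤ X := Real.one_le_exp (by positivity)
  have hτ0 : 0 ≤ τ := integral_nonneg fun _ => by positivity
  have h2 : ∫ x, ‖f x‖^2 ≤ A * X * τ := hls.trans (by gcongr)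
  have h3 : 1 ≤ 2 * (A + 1) * X * τ := by nlinarith
  have h4 : Real.exp (-(2 * C) * (R * ρ)) = X⁻¹ := by
    rw [hX, ← Real.exp_neg]; congr 1; ring
  rw [h4, one_div, ← mul_inv, inv_le_iff_one_le_mul₀ (by positivity)]
  linarith

open LineDeriv in
lemma grad_fourier {d : ℕ} (φ : 𝓢(EuclideanSpace ℝ (Fin d), ℂ)) :
    Integrable (fun ξ => 4 * π^2 * ‖ξ‖^2 * ‖𝓕 φ ξ‖^2) ∧
      ∫ x, gradSq d φ x = ∫ ξ, 4 * π^2 * ‖ξ‖^2 * ‖𝓕 φ ξ‖^2 := by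
  set D : Fin d → 𝓢(EuclideanSpace ℝ (Fin d), ℂ) := fun k => ∂_{(EuclideanSpace.single k (1:ℝ))} φ with hD
  have e1 : ∀ x, gradSq d φ x = ∑ k, ‖D k x‖^2 := by
    intro x
    rw [gradSq]
    rfl
  have e2 : ∀ ξ, 4 * π^2 * ‖ξ‖^2 * ‖𝓕 φ ξ‖^2 = ∑ k, ‖𝓕 (D k) ξ‖^2 := by
    intro ξ
    have : ∀ k, ‖𝓕 (D k) ξ‖^2 = 4 * π^2 * (ξ k)^2 * ‖𝓕 φ ξ‖^2 := by
      intro k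
      have ht : (inner ℝ · (EuclideanSpace.single k (1:ℝ)) : EuclideanSpace ℝ (Fin d) → ℝ).HasTemperateGrowth := by fun_prop
      rw [hD, SchwartzMap.fourier_lineDerivOp_eq]
      rw [smul_apply, SchwartzMap.smulLeftCLM_apply_apply ht]
      simp only [norm_smul, EuclideanSpace.inner_single_right]
      simp [mul_pow, abs_of_pos pi_pos]
      ring
    simp_rw [this]
    rw [EuclideanSpace.norm_sq_eq, ← Finset.sum_mul, ← Finset.mul_sum]
    simp
  simp_rw [e1, e2]
  refine ⟨integrable_finsetSum _ fun k _ => schwartz_sq_integrable _, ?_⟩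
  rw [integral_finsetSum _ fun k _ => schwartz_sq_integrable _, integral_finsetSum _ fun k _ => schwartz_sq_integrable _]
  exact Finset.sum_congr rfl fun k _ => (SchwartzMap.integral_norm_sq_fourier _).symm

/-- Bessel's inequality against plane waves. -/
lemma bessel {d N : ℕ} (φ : Fin N → 𝓢(EuclideanSpace ℝ (Fin d), ℂ)) (Ω : Set (EuclideanSpace ℝ (Fin d)))
    (hΩ : MeasurableSet Ω) (hfin : volume Ω < ⊤) (h0 : ∀ j, ∀ x ∉ Ω, φ j x = 0)
    (hon : ∀ i j, ∫ x, (starRingEnd ℂ) (φ i x) * φ j x = if i = j then 1 else 0) (ξ : EuclideanSpace ℝ (Fin d)) :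
    ∑ j, ‖𝓕 (φ j) ξ‖^2 ≤ (volume Ω).toReal := by
  set e : EuclideanSpace ℝ (Fin d) → ℂ := Ω.indicator (fun x => Complex.exp ((2 * π * inner ℝ x ξ : ℝ) * Complex.I)) with he
  have hcont : Continuous (fun x : EuclideanSpace ℝ (Fin d) => Complex.exp ((2 * π * inner ℝ x ξ : ℝ) * Complex.I)) := by fun_prop
  have hem : AEStronglyMeasurable e := hcont.aestronglyMeasurable.indicator hΩ
  have hen : ∀ x, ‖e x‖^2 = Ω.indicator 1 x := by
    intro x
    by_cases hx : x ∈ Ω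
    · simp only [he, Set.indicator_of_mem hx, Complex.norm_exp_ofReal_mul_I]; simp
    · simp [he, hx]
  have hei : Integrable (fun x => ‖e x‖^2) := by
    simp_rw [hen]
    exact (integrable_indicator_iff hΩ).2 (integrableOn_const hfin.ne)
  have heL : MemLp e 2 volume := (memLp_two_iff_integrable_sq_norm hem).2 hei
  set v : Fin N → Lp ℂ 2 (volume : Measure (EuclideanSpace ℝ (Fin d))) := fun j => (φ j).toLp 2 with hv
  have horth : Orthonormal ℂ v := by
    rw [orthonormal_iff_ite]
    intro i j
    rw [← hon i j, L2.inner_def]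
    apply integral_congr_ae
    filter_upwards [(φ i).coeFn_toLp 2 volume, (φ j).coeFn_toLp 2 volume] with x hx hy
    simp only [hv]
    rw [hx, hy, RCLike.inner_apply, mul_comm]
  have hb := horth.sum_inner_products_le (heL.toLp e) (s := Finset.univ)
  have hnorm : ‖heL.toLp e‖^2 = (volume Ω).toReal := by
    have h1 : inner ℂ (heL.toLp e) (heL.toLp e) = ((∫ x, ‖e x‖^2 : ℝ) : ℂ) := by
      rw [L2.inner_def, ← integral_complex_ofReal]
      apply integral_congr_ae
      filter_upwards [heL.coeFn_toLp] with x hx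
      rw [hx, inner_self_eq_norm_sq_to_K]
      simp
    have h2 := inner_self_eq_norm_sq_to_K (𝕜 := ℂ) (heL.toLp e)
    rw [h1] at h2
    have h3 : (∫ x, ‖e x‖^2 : ℝ) = ‖heL.toLp e‖^2 := by
      apply Complex.ofReal_injective
      rw [h2]
      simp
    rw [← h3]
    simp_rw [hen]
    rw [integral_indicator_one hΩ, Measure.real]
  rw [hnorm] at hb
  refine le_trans (le_of_eq ?_) hb
  apply Finset.sum_congr rfl
  intro j _
  congr 1
  rw [← norm_inner_symm]
  congr 1
  rw [L2.inner_def, SchwartzMap.fourier_coe, Real.fourier_eq']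
  apply integral_congr_ae
  filter_upwards [(φ j).coeFn_toLp 2 volume, heL.coeFn_toLp] with x hx hy
  simp only [hv]
  rw [hx, hy, RCLike.inner_apply, smul_eq_mul]
  by_cases hxΩ : x ∈ Ω
  · rw [he, Set.indicator_of_mem hxΩ]
    rw [← Complex.exp_conj, mul_comm]
    congr 2
    simp only [map_mul, Complex.conj_ofReal, Complex.conj_I]
    push_cast
    ring
  · simp [h0 j x hxΩ]

/-- Phase-space integral. -/
lemma phase_integral (d : ℕ) (hd : 1 ≤ d) (Λ : ℝ) (hΛ : 0 < Λ) :
    Integrable (fun ξ : EuclideanSpace ℝ (Fin d) => max (Λ - 4 * π^2 * ‖ξ‖^2) 0) ∧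
    ∫ ξ : EuclideanSpace ℝ (Fin d), max (Λ - 4 * π^2 * ‖ξ‖^2) 0 = semiclassicalConst d * Λ ^ (1 + (d : ℝ) / 2) := by
  set R := Real.sqrt Λ / (2 * π) with hR
  have hR0 : 0 < R := by positivity
  have hR2 : 4 * π^2 * R^2 = Λ := by
    rw [hR, div_pow, Real.sq_sqrt hΛ.le]; field_simp; norm_num
  have : Nonempty (Fin d) := ⟨⟨0, hd⟩⟩
  constructor
  · apply Continuous.integrable_of_hasCompactSupport (by fun_prop)
    apply HasCompactSupport.intro (isCompact_closedBall (0 : EuclideanSpace ℝ (Fin d)) R)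
    intro ξ hξ
    have : R < ‖ξ‖ := by simpa using hξ
    apply max_eq_right
    rw [← hR2]
    have : R^2 ≤ ‖ξ‖^2 := by gcongr
    have hp : 0 < 4 * π^2 := by positivity
    nlinarith
  · have h1 := integral_fun_norm_addHaar (volume : Measure (EuclideanSpace ℝ (Fin d))) (fun y : ℝ => max (Λ - 4 * π^2 * y^2) 0)
    rw [h1]
    have h2 : ∫ y in Set.Ioi (0:ℝ), y ^ (Module.finrank ℝ (EuclideanSpace ℝ (Fin d)) - 1) • max (Λ - 4 * π^2 * y^2) 0
        = ∫ y in (0:ℝ)..R, (Λ * y^(d-1) - 4 * π^2 * y^(d+1)) := by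
      rw [intervalIntegral.integral_of_le hR0.le, finrank_euclideanSpace_fin]
      rw [← integral_indicator measurableSet_Ioi, ← integral_indicator measurableSet_Ioc]
      congr 1
      ext y
      by_cases hy : 0 < y
      · rw [Set.indicator_of_mem (by exact hy), smul_eq_mul]
        by_cases hyR : y ≤ R
        · rw [Set.indicator_of_mem (by exact ⟨hy, hyR⟩), max_eq_left]
          · have : d + 1 = (d - 1) + 2 := by omega
            rw [this, pow_add]; ring
          · rw [← hR2]
            have : y^2 ≤ R^2 := by gcongr
            have hp : 0 < 4 * π^2 := by positivity
            nlinarith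
        · rw [Set.indicator_of_notMem (fun h => hyR h.2), max_eq_right, mul_zero]
          rw [← hR2]
          have : R^2 ≤ y^2 := by
            have := (not_le.1 hyR).le
            gcongr
          have hp : 0 < 4 * π^2 := by positivity
          nlinarith
      · rw [Set.indicator_of_notMem (by exact hy), Set.indicator_of_notMem (fun h => hy h.1)]
    have h3 : ∫ y in (0:ℝ)..R, (Λ * y^(d-1) - 4 * π^2 * y^(d+1)) = Λ * R^d * (2 / (d * (d+2))) := by
      rw [intervalIntegral.integral_sub (by apply Continuous.intervalIntegrable; fun_prop) (by apply Continuous.intervalIntegrable; fun_prop),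
        intervalIntegral.integral_const_mul, intervalIntegral.integral_const_mul, integral_pow, integral_pow]
      have hdd : d - 1 + 1 = d := by omega
      have hd0 : (0:ℝ) < d := by exact_mod_cast hd
      rw [hdd]
      have hcast : (((d - 1 : ℕ) : ℝ) + 1) = d := by exact_mod_cast hdd
      rw [hcast, zero_pow (by omega), zero_pow (by omega), sub_zero, sub_zero, show R^(d+1+1) = R^d * R^(1+1) by ring]
      push_cast
      have : 4 * π^2 * (R^d * R^(1+1) / ((d:ℝ) + 1 + 1)) = Λ * R^d / (d + 2) := by
        rw [← hR2]; ring
      rw [this]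
      field_simp
      ring
    rw [h2, h3, finrank_euclideanSpace_fin]
    have hd0 : (0:ℝ) < d := by exact_mod_cast hd
    have hG : 0 < Real.Gamma ((d:ℝ)/2 + 1) := Real.Gamma_pos_of_pos (by positivity)
    have h4 : volume.real (Metric.ball (0 : EuclideanSpace ℝ (Fin d)) 1) = Real.sqrt π ^ d / Real.Gamma ((d:ℝ)/2 + 1) := by
      rw [Measure.real, EuclideanSpace.volume_ball]
      simp
      positivity
    rw [h4, semiclassicalConst]
    have h5 : Real.Gamma (2 + (d:ℝ)/2) = ((d:ℝ)/2 + 1) * Real.Gamma ((d:ℝ)/2 + 1) := by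
      rw [← Real.Gamma_add_one (by positivity)]; congr 1; ring
    have h6 : (4 * π) ^ ((d:ℝ)/2) = (2 * Real.sqrt π)^d := by
      have : Real.sqrt (4 * π) = 2 * Real.sqrt π := by
        rw [Real.sqrt_mul (by norm_num)]
        congr 1
        rw [show (4:ℝ) = 2^2 by norm_num, Real.sqrt_sq (by norm_num)]
      rw [← this, Real.sqrt_eq_rpow, ← Real.rpow_natCast, ← Real.rpow_mul (by positivity)]
      congr 1; ring
    have h7 : Λ ^ (1 + (d:ℝ)/2) = Λ * Real.sqrt Λ ^ d := by
      rw [Real.rpow_add hΛ, Real.rpow_one, Real.sqrt_eq_rpow, ← Real.rpow_natCast, ← Real.rpow_mul hΛ.le]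
      congr 2; ring
    have h8 : R^d = Real.sqrt Λ ^ d / (Real.sqrt π ^ d * (2 * Real.sqrt π)^d) := by
      rw [hR, div_pow, ← mul_pow]
      congr 2
      nlinarith [Real.mul_self_sqrt pi_pos.le]
    rw [h5, h6, h7, h8, Real.Gamma_two]
    have hsp : 0 < Real.sqrt π := Real.sqrt_pos.2 pi_pos
    have hsp1 : 0 < Real.sqrt π ^ d := by positivity
    have hsp2 : 0 < (2 * Real.sqrt π)^d := by positivity
    simp only [nsmul_eq_mul, smul_eq_mul]
    field_simp

/-- Riesz mean bound with an explicit high-frequency deficit. -/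
lemma deficit_bound {d N : ℕ} (hd : 1 ≤ d) (φ : Fin N → 𝓢(EuclideanSpace ℝ (Fin d), ℂ))
    (Ω : Set (EuclideanSpace ℝ (Fin d)))
    (hΩ : MeasurableSet Ω) (hfin : volume Ω < ⊤) (h0 : ∀ j, ∀ x ∉ Ω, φ j x = 0)
    (hon : ∀ i j, ∫ x, (starRingEnd ℂ) (φ i x) * φ j x = if i = j then 1 else 0)
    (hn : ∀ j, ∫ x, ‖φ j x‖^2 = 1)
    (Λ : ℝ) (hΛ : 0 < Λ) (R : ℝ) (hR0 : 0 < R) (hR : 4 * π^2 * R^2 = 2 * Λ) (b : ℝ)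
    (hb : ∀ j, b ≤ ∫ ξ in {ξ | R ≤ ‖ξ‖}, ‖𝓕 (φ j) ξ‖^2) :
    ∑ j : Fin N, (Λ - ∫ x, gradSq d (φ j) x)
      ≤ semiclassicalConst d * (volume Ω).toReal * Λ ^ (1 + (d : ℝ) / 2) - N * (Λ * b) := by
  have hp : 0 < 4 * π^2 := by positivity
  obtain ⟨hpi, hpe⟩ := phase_integral d hd Λ hΛ
  set m : EuclideanSpace ℝ (Fin d) → ℝ := fun ξ => max (Λ - 4 * π^2 * ‖ξ‖^2) 0 with hm
  have hm0 : ∀ ξ, 0 ≤ m ξ := fun ξ => le_max_right _ _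
  have hmΛ : ∀ ξ, m ξ ≤ Λ := fun ξ => max_le (by nlinarith [sq_nonneg ‖ξ‖]) hΛ.le
  have hmc : Continuous m := by rw [hm]; fun_prop
  have hS : MeasurableSet {ξ : EuclideanSpace ℝ (Fin d) | R ≤ ‖ξ‖} :=
    (isClosed_le continuous_const continuous_norm).measurableSet
  have hmi : ∀ j, Integrable (fun ξ => m ξ * ‖𝓕 (φ j) ξ‖^2) := by
    intro j
    apply (schwartz_sq_integrable (𝓕 (φ j))).bdd_mul hmc.aestronglyMeasurable (c := Λ)
    filter_upwards with ξ
    rw [Real.norm_of_nonneg (hm0 ξ)]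
    exact hmΛ ξ
  have key : ∀ j, Λ - ∫ x, gradSq d (φ j) x ≤ (∫ ξ, m ξ * ‖𝓕 (φ j) ξ‖^2) - Λ * b := by
    intro j
    obtain ⟨hgi, hge⟩ := grad_fourier (φ j)
    have hP : ∫ ξ, ‖𝓕 (φ j) ξ‖^2 = 1 := by
      rw [← hn j]; exact SchwartzMap.integral_norm_sq_fourier _
    have hsq := schwartz_sq_integrable (𝓕 (φ j))
    have e1 : Λ - ∫ x, gradSq d (φ j) x
        = ∫ ξ, (Λ * ‖𝓕 (φ j) ξ‖^2 - 4 * π^2 * ‖ξ‖^2 * ‖𝓕 (φ j) ξ‖^2) := by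
      rw [integral_sub (hsq.const_mul Λ) hgi, integral_const_mul, hP, hge, mul_one]
    have e2 : (∫ ξ, m ξ * ‖𝓕 (φ j) ξ‖^2) - Λ * ∫ ξ in {ξ | R ≤ ‖ξ‖}, ‖𝓕 (φ j) ξ‖^2
        = ∫ ξ, (m ξ * ‖𝓕 (φ j) ξ‖^2
          - Λ * Set.indicator {ξ | R ≤ ‖ξ‖} (fun ξ => ‖𝓕 (φ j) ξ‖^2) ξ) := by
      rw [integral_sub (hmi j) ((hsq.indicator hS).const_mul Λ), integral_const_mul,
        integral_indicator hS]
    have h3 : Λ * b ≤ Λ * ∫ ξ in {ξ | R ≤ ‖ξ‖}, ‖𝓕 (φ j) ξ‖^2 :=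
      mul_le_mul_of_nonneg_left (hb j) hΛ.le
    refine le_trans ?_ (sub_le_sub_left h3 _)
    rw [e1, e2]
    apply integral_mono ((hsq.const_mul Λ).sub hgi)
      ((hmi j).sub ((hsq.indicator hS).const_mul Λ))
    intro ξ
    simp only [Pi.sub_apply]
    have hq : 0 ≤ ‖𝓕 (φ j) ξ‖^2 := by positivity
    by_cases hξ : R ≤ ‖ξ‖
    · rw [Set.indicator_of_mem (by exact hξ)]
      have h4 : R^2 ≤ ‖ξ‖^2 := by gcongr
      have h5 : Λ - 4 * π^2 * ‖ξ‖^2 ≤ m ξ - Λ := by nlinarith [hm0 ξ]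
      nlinarith
    · rw [Set.indicator_of_notMem (by exact hξ)]
      have h5 : Λ - 4 * π^2 * ‖ξ‖^2 ≤ m ξ := le_max_left _ _
      nlinarith
  calc ∑ j : Fin N, (Λ - ∫ x, gradSq d (φ j) x)
      ≤ ∑ j : Fin N, ((∫ ξ, m ξ * ‖𝓕 (φ j) ξ‖^2) - Λ * b) := Finset.sum_le_sum fun j _ => key j
    _ = (∫ ξ, m ξ * ∑ j, ‖𝓕 (φ j) ξ‖^2) - N * (Λ * b) := by
      rw [Finset.sum_sub_distrib]
      simp_rw [Finset.mul_sum]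
      rw [integral_finsetSum _ fun j _ => hmi j]
      simp
    _ ≤ (∫ ξ, m ξ * (volume Ω).toReal) - N * (Λ * b) := by
      apply sub_le_sub_right
      apply integral_mono
      · simp_rw [Finset.mul_sum]
        exact integrable_finsetSum _ fun j _ => hmi j
      · exact hpi.mul_const _
      · intro ξ
        exact mul_le_mul_of_nonneg_left (bessel φ Ω hΩ hfin h0 hon ξ) (hm0 ξ)
    _ = _ := by
      rw [integral_mul_const, hpe]; ring

/-- Near-optimal radii for the regularized inradius. -/
lemma exists_radius (d : ℕ) (hd : 1 ≤ d) (θ : ℝ) (hθ0 : 0 < θ) (Ω : Set (EuclideanSpace ℝ (Fin d)))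
    (hfin : volume Ω < ⊤) (ε : ℝ) (hε : 0 < ε) :
    ∃ ρ : ℝ, 0 < ρ ∧ (∀ x : EuclideanSpace ℝ (Fin d),
      volume (Ω ∩ Metric.ball x ρ) ≤ ENNReal.ofReal θ * volume (Metric.ball x ρ)) ∧
      ρ ≤ (regInradius d θ Ω).toReal + ε := by
  have hne : Nonempty (Fin d) := ⟨⟨0, hd⟩⟩
  have hex : ∃ ρ : ℝ, 0 < ρ ∧ (∀ x : EuclideanSpace ℝ (Fin d),
      volume (Ω ∩ Metric.ball x ρ) ≤ ENNReal.ofReal θ * volume (Metric.ball x ρ)) := by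
    set V := (volume (Metric.ball (0 : EuclideanSpace ℝ (Fin d)) 1)).toReal with hV
    have hVt : volume (Metric.ball (0 : EuclideanSpace ℝ (Fin d)) 1) ≠ ⊤ := measure_ball_lt_top.ne
    have hV0 : 0 < V := ENNReal.toReal_pos (Metric.measure_ball_pos _ _ one_pos).ne' hVt
    set M := (volume Ω).toReal with hM
    have hM0 : 0 ≤ M := ENNReal.toReal_nonneg
    set ρ := 1 + M / (θ * V) with hρ
    have hρ1 : 1 ≤ ρ := by rw [hρ]; have : 0 ≤ M / (θ * V) := by positivity
                           linarith
    refine ⟨ρ, by linarith, fun x => ?_⟩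
    refine le_trans (measure_mono Set.inter_subset_left) ?_
    rw [Measure.addHaar_ball _ _ (by linarith), finrank_euclideanSpace_fin,
      ← ENNReal.ofReal_toReal hfin.ne, ← ENNReal.ofReal_toReal hVt,
      ← ENNReal.ofReal_mul (by positivity), ← ENNReal.ofReal_mul hθ0.le]
    apply ENNReal.ofReal_le_ofReal
    have h1 : ρ ≤ ρ^d := le_self_pow₀ hρ1 (by omega)
    have h2 : M ≤ θ * V * ρ := by
      rw [hρ, mul_add, mul_div_cancel₀ _ (by positivity)]
      nlinarith [mul_pos hθ0 hV0]
    calc M ≤ θ * V * ρ := h2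
      _ ≤ θ * V * ρ^d := by gcongr
      _ = θ * (ρ^d * V) := by ring
  have hlt : regInradius d θ Ω < ⊤ := by
    obtain ⟨ρ, h1, h2⟩ := hex
    exact lt_of_le_of_lt (sInf_le ⟨ρ, ⟨h1, h2⟩, rfl⟩) ENNReal.ofReal_lt_top
  have h3 : regInradius d θ Ω < regInradius d θ Ω + ENNReal.ofReal ε :=
    ENNReal.lt_add_right hlt.ne (by simpa using hε)
  obtain ⟨_, ⟨ρ, ⟨h1, h2⟩, rfl⟩, h4⟩ := sInf_lt_iff.1 h3
  refine ⟨ρ, h1, h2, ?_⟩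
  have h5 := ENNReal.toReal_mono (ENNReal.add_ne_top.2 ⟨hlt.ne, ENNReal.ofReal_ne_top⟩) h4.le
  rwa [ENNReal.toReal_ofReal h1.le, ENNReal.toReal_add hlt.ne ENNReal.ofReal_ne_top,
    ENNReal.toReal_ofReal hε.le] at h5

end

/-- **Improved Berezin–Li–Yau inequality with regularized inradius (γ = 1, variational
form).** For every `d ≥ 1` and `θ ∈ (0,1)` there are `c, c' > 0` such that for every open
`Ω ⊆ ℝ^d` of finite measure, every `Λ > 0` and every `L²(ℝ^d)`-orthonormal family
`φ_1, …, φ_N` of smooth compactly supported functions with support in `Ω`,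
`Σ_j (Λ − ∫ |∇φ_j|²) ≤ L^sc_{1,d} |Ω| Λ^{1+d/2} (1 − c e^{−c' √Λ ρ_θ(Ω)})`. -/
theorem improved_berezin_li_yau_inradius
    (d : ℕ) (hd : 1 ≤ d) (θ : ℝ) (hθ : θ ∈ Set.Ioo (0 : ℝ) 1) :
    ∃ c c' : ℝ, 0 < c ∧ 0 < c' ∧
      ∀ (Ω : Set (EuclideanSpace ℝ (Fin d))), IsOpen Ω → volume Ω < ∞ →
      ∀ Λ : ℝ, 0 < Λ →
      ∀ (N : ℕ) (φ : Fin N → EuclideanSpace ℝ (Fin d) → ℂ),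
        (∀ j, ContDiff ℝ (⊤ : ℕ∞) (φ j)) →
        (∀ j, HasCompactSupport (φ j)) →
        (∀ j, tsupport (φ j) ⊆ Ω) →
        (∀ i j, ∫ x, (starRingEnd ℂ) (φ i x) * φ j x = if i = j then 1 else 0) →
        ∑ j : Fin N, (Λ - ∫ x, gradSq d (φ j) x)
          ≤ semiclassicalConst d * (volume Ω).toReal * Λ ^ (1 + (d : ℝ) / 2) *
              (1 - c * Real.exp (-c' * Real.sqrt Λ * (regInradius d θ Ω).toReal)) := by
  obtain ⟨hθ0, hθ1⟩ := hθ
  obtain ⟨a, C, ha, hC, htail⟩ := tail_lower d θ hθ0 hθ1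
  set c' := C * (Real.sqrt 2 / (2 * π)) with hc'
  have hc'0 : 0 < c' := by positivity
  set c1 := a * Real.exp (-c') with hc1
  have hc10 : 0 < c1 := by positivity
  refine ⟨min (1/2) (c1/2), c', by positivity, hc'0, ?_⟩
  intro Ω hΩ hfin Λ hΛ N φ hsm hcs hsupp hon
  set r := (regInradius d θ Ω).toReal with hr
  have hr0 : 0 ≤ r := ENNReal.toReal_nonneg
  set E := Real.exp (-c' * Real.sqrt Λ * r) with hE
  have hE0 : 0 < E := Real.exp_pos _
  have hE1 : E ≤ 1 := by
    rw [hE, Real.exp_le_one_iff]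
    have : 0 ≤ c' * Real.sqrt Λ * r := by positivity
    linarith
  have hL0 : 0 < semiclassicalConst d := by
    rw [semiclassicalConst]
    have h1 := Real.Gamma_pos_of_pos (show (0:ℝ) < 2 by norm_num)
    have h2 := Real.Gamma_pos_of_pos (show (0:ℝ) < 2 + (d:ℝ)/2 by positivity)
    positivity
  have hpow : Λ ^ (1 + (d : ℝ) / 2) = Λ * Λ ^ ((d : ℝ) / 2) := by
    rw [Real.rpow_add hΛ, Real.rpow_one]
  set W := semiclassicalConst d * (volume Ω).toReal * Λ ^ ((d : ℝ) / 2) with hW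
  have hW0 : 0 ≤ W := by positivity
  have hWΛ : semiclassicalConst d * (volume Ω).toReal * Λ ^ (1 + (d : ℝ) / 2) = Λ * W := by
    rw [hpow, hW]; ring
  by_cases hN : (N : ℝ) ≤ W / 2
  · have h1 : ∑ j : Fin N, (Λ - ∫ x, gradSq d (φ j) x) ≤ N * Λ := by
      calc _ ≤ ∑ j : Fin N, Λ := by
            apply Finset.sum_le_sum
            intro j _
            have : 0 ≤ ∫ x, gradSq d (φ j) x := by
              apply integral_nonneg
              intro x
              exact Finset.sum_nonneg fun k _ => by positivity
            linarith
        _ = N * Λ := by simp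
    rw [hWΛ]
    have h2 : min (1/2) (c1/2) * E ≤ 1/2 := by
      have := min_le_left (1/2 : ℝ) (c1/2)
      nlinarith [mul_le_mul this hE1 hE0.le (by norm_num)]
    have h3 : N * Λ ≤ Λ * W * (1/2) := by nlinarith
    have h4 : 0 ≤ Λ * W := by positivity
    nlinarith
  · obtain ⟨ρ, hρ0, hρ, hρr⟩ := exists_radius d hd θ hθ0 Ω hfin (1 / Real.sqrt Λ) (by positivity)
    have hsΛ : 0 < Real.sqrt Λ := Real.sqrt_pos.2 hΛ
    set R := Real.sqrt 2 * Real.sqrt Λ / (2 * π) with hR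
    have hR0 : 0 < R := by positivity
    have hR2 : 4 * π^2 * R^2 = 2 * Λ := by
      rw [hR, div_pow, mul_pow, mul_pow, Real.sq_sqrt hΛ.le, Real.sq_sqrt (by norm_num)]
      field_simp
      norm_num
    set ψ : Fin N → SchwartzMap (EuclideanSpace ℝ (Fin d)) ℂ :=
      fun j => (hcs j).toSchwartzMap (hsm j) with hψ
    have hψe : ∀ j x, ψ j x = φ j x := fun j x => rfl
    have h0 : ∀ j, ∀ x ∉ Ω, ψ j x = 0 := by
      intro j x hx
      rw [hψe]
      exact image_eq_zero_of_notMem_tsupport fun h => hx (hsupp j h)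
    have hn : ∀ j, ∫ x, ‖ψ j x‖^2 = 1 := by
      intro j
      apply Complex.ofReal_injective
      have := hon j j
      rw [if_pos rfl] at this
      rw [Complex.ofReal_one, ← this, ← integral_complex_ofReal]
      congr 1
      ext x
      rw [hψe, RCLike.conj_mul]
      simp
    have hb : ∀ j, c1 * E ≤ ∫ ξ in {ξ | R ≤ ‖ξ‖}, ‖FourierTransform.fourier (ψ j) ξ‖^2 := by
      intro j
      refine le_trans ?_ (htail Ω hΩ.measurableSet ρ hρ0 hρ (ψ j) (h0 j) (hn j) R hR0)
      rw [hc1, hE, mul_assoc, ← Real.exp_add]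
      apply mul_le_mul_of_nonneg_left _ ha.le
      apply Real.exp_le_exp.2
      have e1 : C * (R * ρ) = c' * (Real.sqrt Λ * ρ) := by
        rw [hR, hc']; ring
      have e2 : Real.sqrt Λ * ρ ≤ Real.sqrt Λ * r + 1 := by
        calc Real.sqrt Λ * ρ ≤ Real.sqrt Λ * (r + 1 / Real.sqrt Λ) := by gcongr
          _ = _ := by field_simp
      nlinarith [mul_le_mul_of_nonneg_left e2 hc'0.le]
    have hmain := deficit_bound hd ψ Ω hΩ.measurableSet hfin h0 hon hn Λ hΛ R hR0 hR2 (c1 * E) hb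
    refine le_trans hmain ?_
    rw [hWΛ]
    have h2 : min (1/2) (c1/2) * E ≤ c1 / 2 * E :=
      mul_le_mul_of_nonneg_right (min_le_right _ _) hE0.le
    have h4 : 0 ≤ Λ * W := by positivity
    have h5 : Λ * W * (min (1/2) (c1/2) * E) ≤ Λ * W * (c1 / 2 * E) :=
      mul_le_mul_of_nonneg_left h2 h4
    have h6 : W / 2 * (Λ * (c1 * E)) ≤ N * (Λ * (c1 * E)) :=
      mul_le_mul_of_nonneg_right (not_le.1 hN).le (by positivity)
    nlinarith
end

section
/- (Improved Kröger inequality with regularized inradius, case γ = 1, variational form.) For every dimension d ≥ 1 and every θ ∈ (0,1) there exist constants c, c' > 0 with the following property: for every open set Ω ⊆ ℝ^d of finite Lebesgue measure, every Λ > 0 and every ε > 0, there exist N ∈ ℕ and smooth functions φ_1, …, φ_N : Ω → ℂ, orthonormal in L²(Ω) and with |∇φ_j| ∈ L²(Ω) for each j, such that Σ_{j=1}^N ( Λ − ∫_Ω |∇φ_j(x)|² dx ) > L^sc_{1,d} · |Ω| · Λ^{1+d/2} · (1 + c e^{−c' √Λ ρ_θ(Ω)}) − ε. (Since the supremum of the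 left-hand side over all orthonormal families in the Neumann form domain H¹(Ω) equals Tr(−Δ_Ω^N − Λ)_−, this is the variational formulation of the bound Tr(−Δ_Ω^N − Λ)_− ≥ L^sc_{1,d}|Ω|Λ^{1+d/2}(1 + c e^{−c'√Λ ρ_θ(Ω)}).) -/
open MeasureTheory Real
open scoped ENNReal

namespace KI
open FourierTransform SchwartzMap

theorem fourier_ae {d : ℕ} (g : EuclideanSpace ℝ (Fin d) → ℂ) (hg : Integrable g)
    (hg2 : MemLp g 2) :
    ((𝓕 (hg2.toLp g) : Lp ℂ 2 (volume : Measure (EuclideanSpace ℝ (Fin d)))) :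
      EuclideanSpace ℝ (Fin d) → ℂ) =ᵐ[volume] 𝓕 g := by
  have hcont : Continuous (𝓕 g) := VectorFourier.fourierIntegral_continuous Real.continuous_fourierChar (by simpa using continuous_inner) hg
  apply ae_eq_of_integral_contDiff_smul_eq
  · exact (Lp.memLp _).locallyIntegrable (by norm_num)
  · exact hcont.locallyIntegrable
  · intro ψ hψ hψc
    have hψc' : HasCompactSupport (fun x => (ψ x : ℂ)) := hψc.comp_left (g := fun r : ℝ => (r : ℂ)) rfl
    have hψd : ContDiff ℝ (⊤ : ℕ∞) (fun x => (ψ x : ℂ)) := Complex.ofRealCLM.contDiff.comp hψ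
    let Ψ : 𝓢(EuclideanSpace ℝ (Fin d), ℂ) := hψc'.toSchwartzMap hψd
    have hΨ : ∀ x, Ψ x = (ψ x : ℂ) := fun x => rfl
    have h1 := Lp.fourier_toTemperedDistribution_eq (hg2.toLp g)
    have h2 := congrArg (fun T : 𝓢'(EuclideanSpace ℝ (Fin d), ℂ) => T Ψ) h1
    simp only [TemperedDistribution.fourier_apply, Lp.toTemperedDistribution_apply] at h2
    have h3 : ∫ x, ψ x • ((𝓕 (hg2.toLp g) : Lp ℂ 2 (volume : Measure (EuclideanSpace ℝ (Fin d)))) :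
      EuclideanSpace ℝ (Fin d) → ℂ) x = ∫ x, (𝓕 Ψ) x • (hg2.toLp g) x := by
      rw [h2]
      simp [hΨ]
    rw [h3]
    have h4 : ∫ x, (𝓕 Ψ) x • (hg2.toLp g) x = ∫ x, (𝓕 Ψ) x • g x := by
      apply integral_congr_ae
      filter_upwards [hg2.coeFn_toLp] with x hx
      rw [hx]
    rw [h4]
    have h5 := VectorFourier.integral_fourierIntegral_smul_eq_flip (L := innerₗ (EuclideanSpace ℝ (Fin d)))
      (μ := volume) (ν := volume) (e := Real.fourierChar) Real.continuous_fourierChar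
      (by simpa using continuous_inner) (Ψ.integrable (μ := volume)) hg
    simp only [flip_innerₗ] at h5
    have h6 : ∀ x, (𝓕 Ψ) x = VectorFourier.fourierIntegral Real.fourierChar volume (innerₗ (EuclideanSpace ℝ (Fin d))) Ψ x := by
      intro x
      rw [SchwartzMap.fourier_coe]; rfl
    simp only [h6]
    rw [h5]
    apply integral_congr_ae
    filter_upwards with x
    rw [hΨ, Complex.real_smul, smul_eq_mul]; rfl

theorem plancherel {d : ℕ} (g : EuclideanSpace ℝ (Fin d) → ℂ) (hg : Integrable g)
    (hg2 : MemLp g 2) :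
    MemLp (𝓕 g) 2 ∧ ∫⁻ x, ‖𝓕 g x‖ₑ ^ 2 = ∫⁻ x, ‖g x‖ₑ ^ 2 := by
  have h := fourier_ae g hg hg2
  have hm : MemLp (𝓕 g) 2 := (memLp_congr_ae h).1 (Lp.memLp _)
  refine ⟨hm, ?_⟩
  have key : eLpNorm (𝓕 g) 2 volume = eLpNorm g 2 volume := by
    rw [← eLpNorm_congr_ae h, ← eLpNorm_congr_ae hg2.coeFn_toLp, ← Lp.enorm_def, ← Lp.enorm_def]
    rw [← ofReal_norm, ← ofReal_norm, Lp.norm_fourier_eq]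
  have e : ∀ f : EuclideanSpace ℝ (Fin d) → ℂ, ∫⁻ x, ‖f x‖ₑ ^ 2 = (eLpNorm f 2 volume) ^ 2 := by
    intro f
    rw [eLpNorm_eq_lintegral_rpow_enorm_toReal (by norm_num) (by norm_num)]
    simp only [ENNReal.toReal_ofNat, ENNReal.rpow_ofNat]
    rw [← ENNReal.rpow_natCast, ← ENNReal.rpow_mul]
    simp
  rw [e, e, key]

end KI

namespace KI

theorem exists_points (s : ℝ) (hs : 0 < s) (n : ℕ) : ∀ G : Set ℝ, G ⊆ Set.Icc 0 1 →
    ENNReal.ofReal (n * s) < volume G →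
    ∃ t : ℕ → ℝ, (∀ i ≤ n, t i ∈ G) ∧ ∀ i < n, t i + s ≤ t (i + 1) := by
  induction n with
  | zero =>
    intro G hG h
    have : G.Nonempty := by
      by_contra hne
      rw [Set.not_nonempty_iff_eq_empty] at hne
      simp [hne] at h
    obtain ⟨x, hx⟩ := this
    exact ⟨fun _ => x, fun _ _ => hx, fun i hi => absurd hi (Nat.not_lt_zero i)⟩
  | succ n ih =>
    intro G hG h
    have hne : G.Nonempty := by
      by_contra hne
      rw [Set.not_nonempty_iff_eq_empty] at hne
      simp [hne] at h
    have hbdd : BddBelow G := ⟨0, fun x hx => (hG hx).1⟩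
    have hfin : volume G ≠ ∞ := ne_top_of_le_ne_top (by simp) (measure_mono hG)
    have h' : ((n + 1 : ℕ) : ℝ) * s < (volume G).toReal := by
      rw [← ENNReal.ofReal_lt_iff_lt_toReal (by positivity) hfin]; exact h
    set κ := ((volume G).toReal - ((n + 1 : ℕ) : ℝ) * s) / 2 with hκ
    have hκpos : 0 < κ := by rw [hκ]; linarith
    obtain ⟨t0, ht0, ht0'⟩ := Real.lt_sInf_add_pos hne hκpos
    have hsub : G ⊆ (G ∩ Set.Ici (t0 + s)) ∪ Set.Icc (sInf G) (t0 + s) := by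
      intro x hx
      by_cases hxs : t0 + s ≤ x
      · exact Or.inl ⟨hx, hxs⟩
      · exact Or.inr ⟨csInf_le hbdd hx, (not_le.1 hxs).le⟩
    have hmeas : volume G ≤ volume (G ∩ Set.Ici (t0 + s)) + ENNReal.ofReal (κ + s) := by
      refine (measure_mono hsub).trans ((measure_union_le _ _).trans ?_)
      gcongr
      rw [Real.volume_Icc]
      apply ENNReal.ofReal_le_ofReal; linarith
    have hG' : ENNReal.ofReal (n * s) < volume (G ∩ Set.Ici (t0 + s)) := by
      by_contra hcon
      rw [not_lt] at hcon
      have h1 : volume G ≤ ENNReal.ofReal (n * s + (κ + s)) := by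
        rw [ENNReal.ofReal_add (by positivity) (by positivity)]
        exact hmeas.trans (by gcongr)
      have h2 := ENNReal.toReal_le_of_le_ofReal (by positivity) h1
      push_cast at hκ h'
      linarith
    obtain ⟨t', h1, h2⟩ := ih _ (Set.inter_subset_left.trans hG) hG'
    refine ⟨fun i => Nat.casesOn i t0 t', ?_, ?_⟩
    · intro i hi
      cases i with
      | zero => exact ht0
      | succ i => exact (h1 i (by omega)).1
    · intro i hi
      cases i with
      | zero => exact (h1 0 (by omega)).2
      | succ i => exact h2 i (by omega)

theorem points_gap (s : ℝ) (n : ℕ) (t : ℕ → ℝ) (h : ∀ i < n, t i + s ≤ t (i + 1)) (i k : ℕ)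
    (hik : i + k ≤ n) : k * s ≤ t (i + k) - t i := by
  induction k with
  | zero => simp
  | succ k ih =>
    have h1 := ih (by omega)
    have h2 := h (i + k) (by omega)
    rw [← add_assoc]
    push_cast
    linarith

theorem points_gap_abs (s : ℝ) (n : ℕ) (t : ℕ → ℝ) (h : ∀ i < n, t i + s ≤ t (i + 1)) (i j : ℕ)
    (hi : i ≤ n) (hj : j ≤ n) : |(i : ℝ) - j| * s ≤ |t i - t j| := by
  rcases le_total i j with hij | hij
  · obtain ⟨k, rfl⟩ := Nat.exists_eq_add_of_le hij
    have := points_gap s n t h i k hj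
    rw [abs_sub_comm, abs_sub_comm (t i)]
    refine le_trans ?_ (le_trans this (le_abs_self _))
    push_cast; simp
  · obtain ⟨k, rfl⟩ := Nat.exists_eq_add_of_le hij
    have := points_gap s n t h j k hi
    refine le_trans ?_ (le_trans this (le_abs_self _))
    push_cast; simp

theorem prod_abs_fact (n i : ℕ) (hi : i ≤ n) :
    ∏ j ∈ (Finset.range (n + 1)).erase i, |(i : ℝ) - j| = (i.factorial : ℝ) * (n - i).factorial := by
  have hsplit : (Finset.range (n + 1)).erase i =
      (Finset.range i) ∪ (Finset.Ico (i + 1) (n + 1)) := by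
    ext j; simp; omega
  have hdisj : Disjoint (Finset.range i) (Finset.Ico (i + 1) (n + 1)) := by
    rw [Finset.disjoint_left]; intro j; simp; omega
  rw [hsplit, Finset.prod_union hdisj]
  congr 1
  · rw [← Finset.prod_range_reflect, ← Finset.prod_range_add_one_eq_factorial]
    push_cast
    apply Finset.prod_congr rfl
    intro j hj
    rw [Finset.mem_range] at hj
    have : ((i - 1 - j : ℕ) : ℝ) = i - 1 - j := by
      rw [Nat.cast_sub (by omega), Nat.cast_sub (by omega)]; simp
    rw [this]
    rw [abs_of_nonneg] <;> ring_nf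
    positivity
  · rw [Finset.prod_Ico_eq_prod_range, ← Finset.prod_range_add_one_eq_factorial]
    have : n + 1 - (i + 1) = n - i := by omega
    rw [this]
    push_cast
    apply Finset.prod_congr rfl
    intro j hj
    rw [abs_sub_comm, abs_of_nonneg] <;> ring_nf
    positivity

theorem lagrange_bound (s : ℝ) (hs : 0 < s) (n : ℕ) (t : ℕ → ℝ)
    (h : ∀ i < n, t i + s ≤ t (i + 1)) (h01 : ∀ i ≤ n, t i ∈ Set.Icc (0 : ℝ) 1)
    (P : Polynomial ℂ) (hP : P.degree < (n + 1 : ℕ)) (M : ℝ)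
    (hM : ∀ i ≤ n, ‖P.eval (t i : ℂ)‖ ≤ M) :
    ‖P.eval 0‖ ≤ M * ((2 / s) ^ n / n.factorial) := by
  have hgap := points_gap_abs s n t h
  have hinj : Set.InjOn (fun i : ℕ => (t i : ℂ)) (Finset.range (n + 1) : Set ℕ) := by
    intro i hi j hj hij
    simp only [Finset.coe_range, Set.mem_Iio] at hi hj
    have h1 := hgap i j (by omega) (by omega)
    have h2 : t i = t j := by simpa using hij
    rw [h2, sub_self, abs_zero] at h1
    have h3 : |(i : ℝ) - j| ≤ 0 := by
      by_contra hc
      rw [not_le] at hc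
      have := mul_pos hc hs
      linarith
    have h4 := abs_nonpos_iff.1 h3
    have h5 : (i : ℝ) = j := by linarith
    exact_mod_cast h5
  have hM0 : 0 ≤ M := (norm_nonneg _).trans (hM 0 (Nat.zero_le _))
  have hI := Lagrange.eq_interpolate (s := Finset.range (n + 1)) (f := P) hinj (by simpa using hP)
  have hE := congrArg (Polynomial.eval 0) hI
  rw [Lagrange.interpolate_apply, Polynomial.eval_finsetSum] at hE
  rw [hE]
  refine (norm_sum_le _ _).trans ?_
  have hterm : ∀ i ∈ Finset.range (n + 1),
      ‖Polynomial.eval 0 (Polynomial.C (Polynomial.eval (t i : ℂ) P) *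
        Lagrange.basis (Finset.range (n + 1)) (fun i : ℕ => (t i : ℂ)) i)‖
      ≤ M * ((s⁻¹) ^ n / n.factorial * (n.choose i)) := by
    intro i hi
    have hi' : i ≤ n := by simpa [Nat.lt_succ_iff] using hi
    rw [Polynomial.eval_mul, Polynomial.eval_C, norm_mul]
    refine mul_le_mul (hM i hi') ?_ (norm_nonneg _) hM0
    rw [Lagrange.basis, Polynomial.eval_prod, norm_prod]
    have hle : ∀ j ∈ (Finset.range (n + 1)).erase i,
        ‖Polynomial.eval 0 (Lagrange.basisDivisor ((fun i : ℕ => (t i : ℂ)) i) ((fun i : ℕ => (t i : ℂ)) j))‖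
          ≤ s⁻¹ * (|(i : ℝ) - j|)⁻¹ := by
      intro j hj
      rw [Finset.mem_erase, Finset.mem_range] at hj
      have hj' : j ≤ n := by omega
      have hpos : 0 < |(i : ℝ) - j| := by
        rw [abs_pos, sub_ne_zero]; exact_mod_cast hj.1.symm
      simp only [Lagrange.basisDivisor, Polynomial.eval_mul, Polynomial.eval_C,
        Polynomial.eval_sub, Polynomial.eval_X, norm_mul, norm_inv, zero_sub, norm_neg]
      rw [← Complex.ofReal_sub, Complex.norm_real, Complex.norm_real, Real.norm_eq_abs,
        Real.norm_eq_abs, ← mul_inv]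
      have h1 := hgap i j hi' hj'
      have h2 := h01 j hj'
      calc |t i - t j|⁻¹ * |t j| ≤ |t i - t j|⁻¹ * 1 := by
            gcongr; rw [abs_of_nonneg h2.1]; exact h2.2
        _ = |t i - t j|⁻¹ := mul_one _
        _ ≤ (s * |(i : ℝ) - j|)⁻¹ := by
            apply inv_anti₀ (by positivity); linarith
    refine (Finset.prod_le_prod (fun _ _ => norm_nonneg _) hle).trans (le_of_eq ?_)
    rw [Finset.prod_mul_distrib, Finset.prod_const, Finset.prod_inv_distrib, prod_abs_fact n i hi',
      Finset.card_erase_of_mem hi, Finset.card_range, Nat.add_sub_cancel]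
    rw [Nat.cast_choose ℝ hi']
    field_simp
  refine (Finset.sum_le_sum hterm).trans (le_of_eq ?_)
  rw [← Finset.mul_sum, ← Finset.mul_sum, ← Nat.cast_sum, Nat.sum_range_choose]
  rw [div_pow, inv_pow]
  push_cast
  field_simp

/-- The constant in the one-dimensional Remez inequality. -/
noncomputable def remezC (n : ℕ) (η : ℝ) : ℝ := 2 * (4 / η) ^ n * Real.exp (n + 1)

theorem remezC_pos (n : ℕ) (η : ℝ) (hη : 0 < η) : 0 < remezC n η := by
  unfold remezC; positivity

theorem remez (n : ℕ) (η : ℝ) (hη : 0 < η) (G : Set ℝ) (hG : MeasurableSet G)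
    (hG1 : G ⊆ Set.Icc 0 1) (hGη : ENNReal.ofReal η ≤ volume G)
    (P : Polynomial ℂ) (hP : P.degree < (n + 1 : ℕ)) :
    ‖P.eval 0‖ₑ ^ 2 ≤ ENNReal.ofReal (remezC n η ^ 2 * (2 / η)) *
      ∫⁻ t in G, ‖P.eval (t : ℂ)‖ₑ ^ 2 := by
  have hC := remezC_pos n η hη
  by_cases hP0 : P.eval 0 = 0
  · simp [hP0]
  have hP0' : 0 < ‖P.eval 0‖ := norm_pos_iff.2 hP0
  have hcont : Continuous (fun t : ℝ => ‖P.eval (t : ℂ)‖) := by fun_prop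
  set A := ‖P.eval 0‖ / remezC n η with hA
  have hApos : 0 < A := by positivity
  set G' := G ∩ {t | ‖P.eval (t : ℂ)‖ ≤ A} with hG'
  set G'' := G ∩ {t | A ≤ ‖P.eval (t : ℂ)‖} with hG''
  have hsmall : volume G' ≤ ENNReal.ofReal (η / 2) := by
    by_contra hcon
    rw [not_le] at hcon
    set s := η / (2 * (n + 1)) with hs
    have hspos : 0 < s := by positivity
    have hns : ENNReal.ofReal (n * s) < volume G' := by
      refine lt_of_le_of_lt (ENNReal.ofReal_le_ofReal ?_) hcon
      rw [hs]
      rw [mul_div_assoc', div_le_div_iff₀ (by positivity) (by positivity)]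
      nlinarith
    obtain ⟨t, ht1, ht2⟩ := exists_points s hspos n G' (Set.inter_subset_left.trans hG1) hns
    have := lagrange_bound s hspos n t ht2 (fun i hi => hG1 (ht1 i hi).1) P hP A
      (fun i hi => (ht1 i hi).2)
    have hfac : (2 / s) ^ n / n.factorial ≤ remezC n η / 2 := by
      have h2s : 2 / s = (4 / η) * (n + 1) := by rw [hs]; field_simp; ring
      rw [h2s, mul_pow, mul_div_assoc]
      have := Real.pow_div_factorial_le_exp ((n : ℝ) + 1) (by positivity) n
      unfold remezC
      calc (4 / η) ^ n * (((n : ℝ) + 1) ^ n / n.factorial) ≤ (4 / η) ^ n * Real.exp (n + 1) := by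
            gcongr
        _ = _ := by ring
    have h3 : ‖P.eval 0‖ ≤ A * (remezC n η / 2) := this.trans (by gcongr)
    rw [hA] at h3
    have h4 : ‖P.eval 0‖ / remezC n η * (remezC n η / 2) = ‖P.eval 0‖ / 2 := by field_simp
    linarith
  have hlarge : ENNReal.ofReal (η / 2) ≤ volume G'' := by
    have hsub : G ⊆ G' ∪ G'' := by
      intro x hx
      rcases le_total (‖P.eval (x : ℂ)‖) A with h | h
      · exact Or.inl ⟨hx, h⟩
      · exact Or.inr ⟨hx, h⟩
    have h1 : ENNReal.ofReal η ≤ ENNReal.ofReal (η / 2) + volume G'' :=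
      hGη.trans ((measure_mono hsub).trans ((measure_union_le _ _).trans (by gcongr)))
    have h2 : ENNReal.ofReal η = ENNReal.ofReal (η / 2) + ENNReal.ofReal (η / 2) := by
      rw [← ENNReal.ofReal_add (by positivity) (by positivity)]; ring_nf
    rw [h2] at h1
    exact (ENNReal.add_le_add_iff_left ENNReal.ofReal_ne_top).1 h1
  have hIntg : ENNReal.ofReal (A ^ 2) * ENNReal.ofReal (η / 2) ≤
      ∫⁻ t in G, ‖P.eval (t : ℂ)‖ₑ ^ 2 := by
    calc _ ≤ ENNReal.ofReal (A ^ 2) * volume G'' := by gcongr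
      _ = ∫⁻ t in G'', ENNReal.ofReal (A ^ 2) := by simp
      _ ≤ ∫⁻ t in G'', ‖P.eval (t : ℂ)‖ₑ ^ 2 := by
          apply setLIntegral_mono' (hG.inter (measurableSet_le measurable_const hcont.measurable))
          intro t ht
          rw [← ofReal_norm, ← ENNReal.ofReal_pow (norm_nonneg _)]
          apply ENNReal.ofReal_le_ofReal
          exact pow_le_pow_left₀ hApos.le ht.2 2
      _ ≤ _ := lintegral_mono_set Set.inter_subset_left
  calc ‖P.eval 0‖ₑ ^ 2 = ENNReal.ofReal (remezC n η ^ 2 * (2 / η)) *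
        (ENNReal.ofReal (A ^ 2) * ENNReal.ofReal (η / 2)) := by
        rw [← ENNReal.ofReal_mul (by positivity), ← ENNReal.ofReal_mul (by positivity),
          ← ofReal_norm, ← ENNReal.ofReal_pow (norm_nonneg _), hA]
        congr 1
        field_simp
    _ ≤ _ := by gcongr

end KI

namespace KI

/-- times along the segment from `x` to `x + y` spent in `E` -/
def Gset {d : ℕ} (E : Set (EuclideanSpace ℝ (Fin d))) (x y : EuclideanSpace ℝ (Fin d)) : Set ℝ :=
  {t | t ∈ Set.Icc (0 : ℝ) 1 ∧ x + t • y ∈ E}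

theorem Gset_meas {d : ℕ} {E : Set (EuclideanSpace ℝ (Fin d))} (hE : MeasurableSet E)
    (x y : EuclideanSpace ℝ (Fin d)) : MeasurableSet (Gset E x y) := by
  apply measurableSet_Icc.inter
  have : Measurable (fun t : ℝ => x + t • y) := by fun_prop
  exact this hE

theorem Gset_vol_meas {d : ℕ} {E : Set (EuclideanSpace ℝ (Fin d))} (hE : MeasurableSet E) :
    Measurable (fun p : EuclideanSpace ℝ (Fin d) × EuclideanSpace ℝ (Fin d) =>
      volume (Gset E p.1 p.2)) := by
  have hS : MeasurableSet {q : (EuclideanSpace ℝ (Fin d) × EuclideanSpace ℝ (Fin d)) × ℝ |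
      q.2 ∈ Set.Icc (0 : ℝ) 1 ∧ q.1.1 + q.2 • q.1.2 ∈ E} := by
    apply MeasurableSet.inter
    · exact measurable_snd measurableSet_Icc
    · have : Measurable (fun q : (EuclideanSpace ℝ (Fin d) × EuclideanSpace ℝ (Fin d)) × ℝ =>
        q.1.1 + q.2 • q.1.2) := by fun_prop
      exact this hE
  exact measurable_measure_prodMk_left hS

theorem scale_vol {d : ℕ} (Ω : Set (EuclideanSpace ℝ (Fin d))) (x : EuclideanSpace ℝ (Fin d))
    (ρ t : ℝ) (ht : 0 < t) (ht1 : t ≤ 1) :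
    volume {y | y ∈ Metric.ball (0 : EuclideanSpace ℝ (Fin d)) ρ ∧ x + t • y ∈ Ω} ≤
      ENNReal.ofReal ((t ^ d)⁻¹) * volume (Ω ∩ Metric.ball x ρ) := by
  have hsub : {y | y ∈ Metric.ball (0 : EuclideanSpace ℝ (Fin d)) ρ ∧ x + t • y ∈ Ω} ⊆
      (fun y => t • y) ⁻¹' ((fun z => x + z) ⁻¹' (Ω ∩ Metric.ball x ρ)) := by
    intro y hy
    refine ⟨hy.2, ?_⟩
    have h1 : ‖y‖ < ρ := by simpa using hy.1
    simp only [Metric.mem_ball, dist_self_add_left, norm_smul, Real.norm_eq_abs, abs_of_pos ht]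
    nlinarith [norm_nonneg y]
  refine (measure_mono hsub).trans ?_
  rw [Measure.addHaar_preimage_smul _ ht.ne', measure_preimage_add]
  simp [abs_of_pos ht]

theorem geo (d : ℕ) (θ : ℝ) (hθ : θ ∈ Set.Ioo (0 : ℝ) 1) :
    ∃ η : ℝ, 0 < η ∧ η ≤ 1 ∧ ∀ Ω : Set (EuclideanSpace ℝ (Fin d)), MeasurableSet Ω →
      ∀ ρ : ℝ, 0 < ρ →
      (∀ x : EuclideanSpace ℝ (Fin d),
        volume (Ω ∩ Metric.ball x ρ) ≤ ENNReal.ofReal θ * volume (Metric.ball x ρ)) →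
      ∀ x, ENNReal.ofReal η * volume (Metric.ball (0 : EuclideanSpace ℝ (Fin d)) ρ) ≤
        volume {y | y ∈ Metric.ball (0 : EuclideanSpace ℝ (Fin d)) ρ ∧
          ENNReal.ofReal η ≤ volume (Gset Ωᶜ x y)} := by
  obtain ⟨t0, ht0, ht01, hlt⟩ : ∃ t0 : ℝ, 0 < t0 ∧ t0 < 1 ∧ (t0 ^ d)⁻¹ * θ ≤ (1 + θ) / 2 := by
    have hc : ContinuousAt (fun t : ℝ => (t ^ d)⁻¹ * θ) 1 := by
      apply ContinuousAt.mul _ continuousAt_const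
      apply ContinuousAt.inv₀ (by fun_prop) (by simp)
    have h1 : (fun t : ℝ => (t ^ d)⁻¹ * θ) 1 < (1 + θ) / 2 := by
      simp; linarith [hθ.2]
    have h2 : ∀ᶠ t in nhdsWithin (1 : ℝ) (Set.Iio 1), (t ^ d)⁻¹ * θ < (1 + θ) / 2 :=
      (hc.eventually_lt continuousAt_const h1).filter_mono nhdsWithin_le_nhds
    have h3 : ∀ᶠ t in nhdsWithin (1 : ℝ) (Set.Iio 1), t ∈ Set.Ioo (0 : ℝ) 1 :=
      Ioo_mem_nhdsLT (by norm_num)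
    obtain ⟨t, ht, ht'⟩ := (h2.and h3).exists
    exact ⟨t, ht'.1, ht'.2, ht.le⟩
  have hθ1 := hθ.1
  have hθ2 := hθ.2
  set η := (1 - t0) * ((1 - θ) / 2) / 2 with hη
  have hηpos : 0 < η := by
    rw [hη]; apply div_pos (mul_pos (by linarith) (by linarith)) (by norm_num)
  have hη1 : η ≤ 1 := by rw [hη]; nlinarith
  refine ⟨η, hηpos, hη1, ?_⟩
  intro Ω hΩ ρ hρ hthick x
  set B := Metric.ball (0 : EuclideanSpace ℝ (Fin d)) ρ with hB
  have hBfin : volume B ≠ ∞ := measure_ball_lt_top.ne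
  have hvB : volume (Metric.ball x ρ) = volume B := by
    rw [hB]; exact Measure.addHaar_ball_center _ _ _
  set Y := {y | y ∈ B ∧ ENNReal.ofReal η ≤ volume (Gset Ωᶜ x y)} with hY
  -- slices in `t`
  have hslice : ∀ t ∈ Set.Icc t0 1, ENNReal.ofReal ((1 - θ) / 2) * volume B ≤
      volume {y | y ∈ B ∧ x + t • y ∈ Ωᶜ} := by
    intro t ht
    have htpos : 0 < t := lt_of_lt_of_le ht0 ht.1
    have h1 : volume {y | y ∈ B ∧ x + t • y ∈ Ω} ≤ ENNReal.ofReal ((1 + θ) / 2) * volume B := by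
      refine (scale_vol Ω x ρ t htpos ht.2).trans ?_
      calc _ ≤ ENNReal.ofReal ((t ^ d)⁻¹) * (ENNReal.ofReal θ * volume (Metric.ball x ρ)) := by
            gcongr; exact hthick x
        _ = ENNReal.ofReal ((t ^ d)⁻¹ * θ) * volume B := by
            rw [hvB, ← mul_assoc, ← ENNReal.ofReal_mul (by positivity)]
        _ ≤ _ := by
            gcongr
            refine le_trans ?_ hlt
            gcongr
            exact ht.1
    have h2 : volume B ≤ volume {y | y ∈ B ∧ x + t • y ∈ Ω} + volume {y | y ∈ B ∧ x + t • y ∈ Ωᶜ} := by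
      refine le_trans (measure_mono ?_) (measure_union_le _ _)
      intro y hy
      by_cases h : x + t • y ∈ Ω
      · exact Or.inl ⟨hy, h⟩
      · exact Or.inr ⟨hy, h⟩
    have h3 : volume B = ENNReal.ofReal ((1 + θ) / 2) * volume B + ENNReal.ofReal ((1 - θ) / 2) * volume B := by
      rw [← add_mul, ← ENNReal.ofReal_add (by linarith) (by linarith)]
      have : (1 + θ) / 2 + (1 - θ) / 2 = 1 := by ring
      rw [this]; simp
    have h4 : ENNReal.ofReal ((1 + θ) / 2) * volume B + ENNReal.ofReal ((1 - θ) / 2) * volume B ≤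
        ENNReal.ofReal ((1 + θ) / 2) * volume B + volume {y | y ∈ B ∧ x + t • y ∈ Ωᶜ} := by
      rw [← h3]
      exact h2.trans (by gcongr)
    exact (ENNReal.add_le_add_iff_left (ENNReal.mul_ne_top ENNReal.ofReal_ne_top hBfin)).1 h4
  -- Tonelli
  have hmeasS : MeasurableSet {q : EuclideanSpace ℝ (Fin d) × ℝ |
      q.1 ∈ B ∧ q.2 ∈ Set.Icc (0 : ℝ) 1 ∧ x + q.2 • q.1 ∈ Ωᶜ} := by
    apply MeasurableSet.inter
    · exact measurable_fst measurableSet_ball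
    apply MeasurableSet.inter
    · exact measurable_snd measurableSet_Icc
    · have : Measurable (fun q : EuclideanSpace ℝ (Fin d) × ℝ => x + q.2 • q.1) := by fun_prop
      exact this hΩ.compl
  have hT1 : (volume.prod volume) {q : EuclideanSpace ℝ (Fin d) × ℝ |
      q.1 ∈ B ∧ q.2 ∈ Set.Icc (0 : ℝ) 1 ∧ x + q.2 • q.1 ∈ Ωᶜ} =
      ∫⁻ y, volume {t | y ∈ B ∧ t ∈ Set.Icc (0 : ℝ) 1 ∧ x + t • y ∈ Ωᶜ} :=
    Measure.prod_apply hmeasS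
  have hT2 : (volume.prod volume) {q : EuclideanSpace ℝ (Fin d) × ℝ |
      q.1 ∈ B ∧ q.2 ∈ Set.Icc (0 : ℝ) 1 ∧ x + q.2 • q.1 ∈ Ωᶜ} =
      ∫⁻ t, volume {y | y ∈ B ∧ t ∈ Set.Icc (0 : ℝ) 1 ∧ x + t • y ∈ Ωᶜ} :=
    Measure.prod_apply_symm hmeasS
  have hlow : ENNReal.ofReal (2 * η) * volume B ≤
      ∫⁻ t, volume {y | y ∈ B ∧ t ∈ Set.Icc (0 : ℝ) 1 ∧ x + t • y ∈ Ωᶜ} := by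
    calc ENNReal.ofReal (2 * η) * volume B
        = ∫⁻ t in Set.Icc t0 1, ENNReal.ofReal ((1 - θ) / 2) * volume B := by
          rw [setLIntegral_const, Real.volume_Icc, mul_right_comm,
            ← ENNReal.ofReal_mul (by linarith)]
          congr 2; rw [hη]; ring
      _ ≤ ∫⁻ t in Set.Icc t0 1, volume {y | y ∈ B ∧ t ∈ Set.Icc (0 : ℝ) 1 ∧ x + t • y ∈ Ωᶜ} := by
          apply setLIntegral_mono' measurableSet_Icc
          intro t ht
          refine (hslice t ht).trans (measure_mono ?_)
          intro y hy
          exact ⟨hy.1, ⟨ht0.le.trans ht.1, ht.2⟩, hy.2⟩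
      _ ≤ _ := setLIntegral_le_lintegral _ _
  have hYm : MeasurableSet Y := by
    apply MeasurableSet.inter measurableSet_ball
    have := (Gset_vol_meas hΩ.compl).comp (measurable_prodMk_left (x := x))
    exact measurableSet_le measurable_const this
  have hup : ∫⁻ y, volume {t | y ∈ B ∧ t ∈ Set.Icc (0 : ℝ) 1 ∧ x + t • y ∈ Ωᶜ} ≤
      ENNReal.ofReal η * volume B + volume Y := by
    calc _ ≤ ∫⁻ y, (B.indicator (fun _ => ENNReal.ofReal η) y + Y.indicator (fun _ => 1) y) := by
          apply lintegral_mono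
          intro y
          by_cases hy : y ∈ B
          · by_cases hyY : y ∈ Y
            · simp only [Set.indicator_of_mem hyY]
              refine le_trans (le_trans (measure_mono (t := Set.Icc (0 : ℝ) 1) ?_) ?_) le_add_self
              · intro t ht; exact ht.2.1
              · simp
            · simp only [Set.indicator_of_mem hy, Set.indicator_of_notMem hyY, add_zero]
              have h1 : ¬ ENNReal.ofReal η ≤ volume (Gset Ωᶜ x y) := fun h => hyY ⟨hy, h⟩
              refine le_trans (measure_mono ?_) (not_le.1 h1).le
              intro t ht; exact ht.2
          · simp [hy]
      _ = _ := by
          rw [lintegral_add_left (measurable_const.indicator measurableSet_ball),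
            lintegral_indicator measurableSet_ball, lintegral_indicator hYm]
          simp [hB]
  have hfinal := hlow.trans ((hT2.symm.trans hT1).le.trans hup)
  have h2 : ENNReal.ofReal (2 * η) * volume B = ENNReal.ofReal η * volume B + ENNReal.ofReal η * volume B := by
    rw [← add_mul, ← ENNReal.ofReal_add (by linarith) (by linarith)]; ring_nf
  rw [h2] at hfinal
  exact (ENNReal.add_le_add_iff_left (ENNReal.mul_ne_top ENNReal.ofReal_ne_top hBfin)).1 hfinal

end KI

namespace KI
open FourierTransform

/-- remainder of the exponential series -/
noncomputable def Er (n : ℕ) (z : ℂ) : ℂ := Complex.exp z - ∑ m ∈ Finset.range n, z ^ m / m.factorial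

theorem Er_bound (n : ℕ) (z : ℂ) : ‖Er n z‖ ≤ ‖z‖ ^ n / n.factorial * Real.exp ‖z‖ := by
  refine (Complex.norm_exp_sub_sum_le_exp_norm_sub_sum z n).trans ?_
  set r := ‖z‖ with hr
  have hr0 : 0 ≤ r := norm_nonneg _
  have hs : HasSum (fun m : ℕ => r ^ m / m.factorial) (Real.exp r) := by
    rw [Real.exp_eq_exp_ℝ]; exact NormedSpace.expSeries_div_hasSum_exp r
  have h1 : Real.exp r - ∑ m ∈ Finset.range n, r ^ m / m.factorial =
      ∑' m : ℕ, r ^ (m + n) / (m + n).factorial := by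
    have := hs.summable.sum_add_tsum_nat_add n
    rw [hs.tsum_eq] at this
    linarith
  rw [h1, ← hs.tsum_eq, ← tsum_mul_left]
  apply Summable.tsum_le_tsum _ ((summable_nat_add_iff n).2 hs.summable) (hs.summable.mul_left _)
  intro m
  rw [div_mul_div_comm, ← pow_add, add_comm n m]
  have : (n.factorial : ℝ) * m.factorial ≤ (m + n).factorial := by
    rw [mul_comm]
    exact_mod_cast Nat.le_of_dvd (Nat.factorial_pos _) (Nat.factorial_mul_factorial_dvd_factorial_add m n)
  gcongr

theorem Er_continuous (n : ℕ) : Continuous (Er n) := by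
  unfold Er; fun_prop

/-- phase `-2πi⟨ξ,y⟩` -/
noncomputable def zz {d : ℕ} (y ξ : EuclideanSpace ℝ (Fin d)) : ℂ :=
  ((-2 * π * inner ℝ ξ y : ℝ) : ℂ) * Complex.I

theorem zz_norm {d : ℕ} (y ξ : EuclideanSpace ℝ (Fin d)) : ‖zz y ξ‖ ≤ 2 * π * (‖ξ‖ * ‖y‖) := by
  unfold zz
  rw [norm_mul, Complex.norm_I, mul_one, Complex.norm_real, Real.norm_eq_abs, abs_mul]
  have : |(-2 * π)| = 2 * π := by rw [abs_of_nonpos] <;> nlinarith [Real.pi_pos]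
  rw [this]
  have := abs_real_inner_le_norm ξ y
  have := Real.pi_pos
  gcongr

theorem zz_cont {d : ℕ} : Continuous (fun p : EuclideanSpace ℝ (Fin d) × EuclideanSpace ℝ (Fin d) =>
    zz p.1 p.2) := by
  unfold zz; fun_prop

theorem char_shift {d : ℕ} (x y ξ : EuclideanSpace ℝ (Fin d)) (t : ℝ) (c : ℂ) :
    Real.fourierChar (-inner ℝ ξ (x + t • y)) • c =
      Real.fourierChar (-inner ℝ ξ x) • (Complex.exp (t * zz y ξ) * c) := by
  simp only [Circle.smul_def, Real.fourierChar_apply, smul_eq_mul, ← mul_assoc, ← Complex.exp_add]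
  congr 2
  rw [inner_add_right, real_inner_smul_right, zz]
  push_cast
  ring

theorem mul_int {d : ℕ} {g : EuclideanSpace ℝ (Fin d) → ℂ} (hg : Integrable g)
    (hg2 : MemLp g 2) {S : ℝ} (hsupp : ∀ ξ, S < ‖ξ‖ → g ξ = 0)
    (m : EuclideanSpace ℝ (Fin d) → ℂ) (hm : Continuous m) (C : ℝ)
    (hC : ∀ ξ, ‖ξ‖ ≤ S → ‖m ξ‖ ≤ C) :
    Integrable (fun ξ => m ξ * g ξ) ∧ MemLp (fun ξ => m ξ * g ξ) 2 ∧
      ∀ ξ, ‖m ξ * g ξ‖ ≤ C * ‖g ξ‖ := by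
  have hb : ∀ ξ, ‖m ξ * g ξ‖ ≤ C * ‖g ξ‖ := by
    intro ξ
    by_cases h : ‖ξ‖ ≤ S
    · rw [norm_mul]; gcongr; exact hC ξ h
    · rw [hsupp ξ (not_le.1 h)]; simp
  refine ⟨?_, ?_, hb⟩
  · exact (hg.norm.const_mul C).mono' (hm.aestronglyMeasurable.mul hg.1) (Filter.Eventually.of_forall hb)
  · exact hg2.of_le_mul (hm.aestronglyMeasurable.mul hg.1) (Filter.Eventually.of_forall hb)

/-- Fourier-side remainder -/
noncomputable def WW {d : ℕ} (n : ℕ) (g : EuclideanSpace ℝ (Fin d) → ℂ)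
    (x y : EuclideanSpace ℝ (Fin d)) (t : ℝ) : ℂ :=
  𝓕 (fun ξ => Er (n + 1) (t * zz y ξ) * g ξ) x

/-- Taylor polynomial of `t ↦ 𝓕 g (x + t y)` -/
noncomputable def PP {d : ℕ} (n : ℕ) (g : EuclideanSpace ℝ (Fin d) → ℂ)
    (x y : EuclideanSpace ℝ (Fin d)) : Polynomial ℂ :=
  ∑ k ∈ Finset.range (n + 1),
    Polynomial.C (𝓕 (fun ξ => (zz y ξ) ^ k / k.factorial * g ξ) x) * Polynomial.X ^ k

theorem PP_degree {d : ℕ} (n : ℕ) (g : EuclideanSpace ℝ (Fin d) → ℂ)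
    (x y : EuclideanSpace ℝ (Fin d)) : (PP n g x y).degree < (n + 1 : ℕ) := by
  unfold PP
  apply lt_of_le_of_lt (Polynomial.degree_sum_le _ _)
  rw [Finset.sup_lt_iff (by exact WithBot.bot_lt_coe _)]
  intro k hk
  refine lt_of_le_of_lt (Polynomial.degree_C_mul_X_pow_le _ _) ?_
  exact_mod_cast Finset.mem_range.1 hk

theorem PP_zero {d : ℕ} (n : ℕ) (g : EuclideanSpace ℝ (Fin d) → ℂ)
    (x y : EuclideanSpace ℝ (Fin d)) : (PP n g x y).eval 0 = 𝓕 g x := by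
  unfold PP
  rw [Polynomial.eval_finsetSum, Finset.sum_eq_single 0]
  · simp
  · intro k _ hk
    simp [hk]
  · simp

theorem integrable_char {d : ℕ} {g : EuclideanSpace ℝ (Fin d) → ℂ} (hg : Integrable g)
    (x : EuclideanSpace ℝ (Fin d)) :
    Integrable (fun ξ => Real.fourierChar (-inner ℝ ξ x) • g ξ) := by
  have := (VectorFourier.fourierIntegral_convergent_iff (μ := volume) Real.continuous_fourierChar
    (L := innerₗ (EuclideanSpace ℝ (Fin d))) (by simpa using continuous_inner) (f := g) x).2 hg
  simpa using this

theorem taylor_id {d : ℕ} {g : EuclideanSpace ℝ (Fin d) → ℂ} (hg : Integrable g)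
    (hg2 : MemLp g 2) {S : ℝ} (hsupp : ∀ ξ, S < ‖ξ‖ → g ξ = 0) (n : ℕ)
    (x y : EuclideanSpace ℝ (Fin d)) (t : ℝ) :
    𝓕 g (x + t • y) = (PP n g x y).eval (t : ℂ) + WW n g x y t := by
  have hIntg : ∀ k : ℕ, Integrable (fun ξ => (zz y ξ) ^ k / k.factorial * g ξ) := by
    intro k
    refine (mul_int hg hg2 hsupp (fun ξ => (zz y ξ) ^ k / k.factorial) ?_
      ((2 * π * (S * ‖y‖)) ^ k / k.factorial) ?_).1
    · have : Continuous (fun ξ => zz y ξ) := zz_cont.comp (Continuous.prodMk_right y)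
      fun_prop
    · intro ξ hξ
      rw [norm_div, norm_pow]
      simp only [RCLike.norm_natCast]
      have h2 := (zz_norm y ξ).trans (by gcongr : 2 * π * (‖ξ‖ * ‖y‖) ≤ 2 * π * (S * ‖y‖))
      gcongr
  have hE : Integrable (fun ξ => Complex.exp (t * zz y ξ) * g ξ) := by
    have := integrable_char hg (t • y)
    refine this.congr (Filter.Eventually.of_forall fun ξ => ?_)
    have h := char_shift 0 y ξ t (g ξ)
    simpa using h
  have hEr : (fun ξ => Er (n + 1) (t * zz y ξ) * g ξ) = fun ξ =>
      Complex.exp (t * zz y ξ) * g ξ -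
        ∑ k ∈ Finset.range (n + 1), (t : ℂ) ^ k * ((zz y ξ) ^ k / k.factorial * g ξ) := by
    ext ξ
    rw [Er, sub_mul, Finset.sum_mul]
    congr 1
    apply Finset.sum_congr rfl
    intro k _
    rw [mul_pow]; ring
  unfold WW PP
  rw [hEr, Polynomial.eval_finsetSum]
  simp only [Real.fourier_eq, Polynomial.eval_mul, Polynomial.eval_C, Polynomial.eval_pow,
    Polynomial.eval_X, smul_sub, Finset.smul_sum]
  rw [integral_sub (integrable_char hE x)
    (integrable_finsetSum _ fun k _ => integrable_char ((hIntg k).const_mul _) x),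
    integral_finsetSum _ (fun k _ => integrable_char ((hIntg k).const_mul _) x)]
  have : ∀ k : ℕ, ∫ ξ, Real.fourierChar (-inner ℝ ξ x) • ((t : ℂ) ^ k * ((zz y ξ) ^ k / k.factorial * g ξ))
      = (∫ ξ, Real.fourierChar (-inner ℝ ξ x) • ((zz y ξ) ^ k / k.factorial * g ξ)) * (t : ℂ) ^ k := by
    intro k
    rw [← integral_mul_const]
    congr 1; ext ξ
    simp only [Circle.smul_def, smul_eq_mul]; ring
  simp only [this]
  simp only [char_shift]
  ring

theorem WW_bound {d : ℕ} {g : EuclideanSpace ℝ (Fin d) → ℂ} (hg : Integrable g)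
    (hg2 : MemLp g 2) {S : ℝ} (hS : 0 ≤ S) (hsupp : ∀ ξ, S < ‖ξ‖ → g ξ = 0) (n : ℕ)
    (y : EuclideanSpace ℝ (Fin d)) (t : ℝ) (ρ : ℝ) (hy : ‖y‖ ≤ ρ) (ht : t ∈ Set.Icc (0 : ℝ) 1)
    (r : ℝ) (hr : 2 * π * S * ρ ≤ r) :
    ∫⁻ x, ‖WW n g x y t‖ₑ ^ 2 ≤
      ENNReal.ofReal ((r ^ (n + 1) / (n + 1).factorial * Real.exp r) ^ 2) * ∫⁻ x, ‖g x‖ₑ ^ 2 := by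
  have hcont : Continuous (fun ξ => Er (n + 1) (t * zz y ξ)) := by
    have : Continuous (fun ξ => zz y ξ) := zz_cont.comp (Continuous.prodMk_right y)
    exact (Er_continuous _).comp (by fun_prop)
  have hρ : 0 ≤ ρ := (norm_nonneg y).trans hy
  have hr0 : 0 ≤ r := le_trans (by positivity) hr
  obtain ⟨h1, h2, h3⟩ := mul_int hg hg2 hsupp (fun ξ => Er (n + 1) (t * zz y ξ)) hcont
    (r ^ (n + 1) / (n + 1).factorial * Real.exp r) (by
      intro ξ hξ
      have hz : ‖(t : ℂ) * zz y ξ‖ ≤ r := by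
        rw [norm_mul, Complex.norm_real, Real.norm_eq_abs, abs_of_nonneg ht.1]
        calc t * ‖zz y ξ‖ ≤ 1 * (2 * π * (‖ξ‖ * ‖y‖)) := by
              gcongr
              · exact ht.2
              · exact zz_norm y ξ
          _ ≤ 1 * (2 * π * (S * ρ)) := by gcongr
          _ ≤ r := by linarith
      refine (Er_bound _ _).trans ?_
      gcongr)
  unfold WW
  rw [(plancherel _ h1 h2).2, ← lintegral_const_mul' _ _ ENNReal.ofReal_ne_top]
  apply lintegral_mono
  intro ξ
  simp only
  rw [← ofReal_norm, ← ofReal_norm, ← ENNReal.ofReal_pow (norm_nonneg _),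
    ← ENNReal.ofReal_pow (norm_nonneg _), ← ENNReal.ofReal_mul (by positivity)]
  apply ENNReal.ofReal_le_ofReal
  rw [← mul_pow]
  exact pow_le_pow_left₀ (norm_nonneg _) (h3 ξ) 2

theorem WW_meas {d : ℕ} {g : EuclideanSpace ℝ (Fin d) → ℂ} (hgm : StronglyMeasurable g) (n : ℕ) :
    Measurable (fun p : (EuclideanSpace ℝ (Fin d) × EuclideanSpace ℝ (Fin d)) × ℝ =>
      WW n g p.1.1 p.1.2 p.2) := by
  unfold WW
  simp only [Real.fourier_eq]
  apply StronglyMeasurable.measurable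
  apply StronglyMeasurable.integral_prod_right'
    (f := fun q : ((EuclideanSpace ℝ (Fin d) × EuclideanSpace ℝ (Fin d)) × ℝ) × EuclideanSpace ℝ (Fin d) =>
      Real.fourierChar (-inner ℝ q.2 q.1.1.1) • (Er (n + 1) (q.1.2 * zz q.1.1.2 q.2) * g q.2))
  simp only [Circle.smul_def, smul_eq_mul]
  apply StronglyMeasurable.mul
  · apply Continuous.stronglyMeasurable
    have := Real.continuous_fourierChar
    fun_prop
  · apply StronglyMeasurable.mul
    · apply Continuous.stronglyMeasurable
      have h1 := Er_continuous (n + 1)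
      have h2 : Continuous (fun q : ((EuclideanSpace ℝ (Fin d) × EuclideanSpace ℝ (Fin d)) × ℝ) × EuclideanSpace ℝ (Fin d) => zz q.1.1.2 q.2) :=
        zz_cont.comp (g := fun p : EuclideanSpace ℝ (Fin d) × EuclideanSpace ℝ (Fin d) => zz p.1 p.2)
          (f := fun q : ((EuclideanSpace ℝ (Fin d) × EuclideanSpace ℝ (Fin d)) × ℝ) × EuclideanSpace ℝ (Fin d) => (q.1.1.2, q.2)) (by fun_prop)
      exact h1.comp (by fun_prop)
    · exact hgm.comp_measurable measurable_snd

end KI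

namespace KI
open FourierTransform

theorem enorm_sub_sq (a b : ℂ) : ‖a - b‖ₑ ^ 2 ≤ 2 * (‖a‖ₑ ^ 2 + ‖b‖ₑ ^ 2) := by
  have h : ‖a - b‖ ^ 2 ≤ 2 * (‖a‖ ^ 2 + ‖b‖ ^ 2) := by
    have h1 := norm_sub_le a b
    nlinarith [norm_nonneg (a - b), norm_nonneg a, norm_nonneg b, sq_nonneg (‖a‖ - ‖b‖)]
  have h2 : ∀ c : ℂ, ‖c‖ₑ ^ 2 = ENNReal.ofReal (‖c‖ ^ 2) := fun c => by
    rw [← ofReal_norm, ENNReal.ofReal_pow (norm_nonneg _)]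
  rw [h2, h2, h2, ← ENNReal.ofReal_add (by positivity) (by positivity)]
  have : (2 : ℝ≥0∞) = ENNReal.ofReal 2 := by simp
  rw [this, ← ENNReal.ofReal_mul (by norm_num)]
  exact ENNReal.ofReal_le_ofReal h

theorem fourier_cont {d : ℕ} {g : EuclideanSpace ℝ (Fin d) → ℂ} (hg : Integrable g) :
    Continuous (𝓕 g) :=
  VectorFourier.fourierIntegral_continuous Real.continuous_fourierChar
    (by simpa using continuous_inner) hg

theorem ls1 {d : ℕ} {g : EuclideanSpace ℝ (Fin d) → ℂ} (hg : Integrable g)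
    (hg2 : MemLp g 2) (hgm : StronglyMeasurable g) {S : ℝ} (hS : 0 ≤ S)
    (hsupp : ∀ ξ, S < ‖ξ‖ → g ξ = 0) (n : ℕ)
    (E : Set (EuclideanSpace ℝ (Fin d))) (hE : MeasurableSet E)
    (ρ η r : ℝ) (hρ : 0 < ρ) (hη : 0 < η) (hr : 2 * π * S * ρ ≤ r)
    (hthick : ∀ x, ENNReal.ofReal η * volume (Metric.ball (0 : EuclideanSpace ℝ (Fin d)) ρ) ≤
        volume {y | y ∈ Metric.ball (0 : EuclideanSpace ℝ (Fin d)) ρ ∧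
          ENNReal.ofReal η ≤ volume (Gset E x y)}) :
    ENNReal.ofReal η * ∫⁻ x, ‖𝓕 g x‖ₑ ^ 2 ≤
      ENNReal.ofReal (remezC n η ^ 2 * (2 / η)) * 2 * ((∫⁻ x in E, ‖𝓕 g x‖ₑ ^ 2) +
      ENNReal.ofReal ((r ^ (n + 1) / (n + 1).factorial * Real.exp r) ^ 2) * ∫⁻ x, ‖g x‖ₑ ^ 2) := by
  set B := Metric.ball (0 : EuclideanSpace ℝ (Fin d)) ρ with hB
  have hBfin : volume B ≠ ∞ := measure_ball_lt_top.ne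
  have hBpos : volume B ≠ 0 := (Metric.measure_ball_pos _ _ hρ).ne'
  set K := ENNReal.ofReal (remezC n η ^ 2 * (2 / η)) with hK
  set I := Set.Icc (0 : ℝ) 1 with hI
  set FE := ∫⁻ x in E, ‖𝓕 g x‖ₑ ^ 2 with hFE
  set T := ENNReal.ofReal ((r ^ (n + 1) / (n + 1).factorial * Real.exp r) ^ 2) * ∫⁻ x, ‖g x‖ₑ ^ 2
    with hT
  have hfc := fourier_cont hg
  have hfm : Measurable (fun x => ‖𝓕 g x‖ₑ ^ 2) := (hfc.measurable.enorm).pow_const 2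
  have hfE : Measurable (E.indicator (fun x => ‖𝓕 g x‖ₑ ^ 2)) := hfm.indicator hE
  let H : EuclideanSpace ℝ (Fin d) → EuclideanSpace ℝ (Fin d) → ℝ → ℝ≥0∞ := fun x y t =>
    E.indicator (fun x => ‖𝓕 g x‖ₑ ^ 2) (x + t • y) + ‖WW n g x y t‖ₑ ^ 2
  have hHm : Measurable (fun p : (EuclideanSpace ℝ (Fin d) × EuclideanSpace ℝ (Fin d)) × ℝ =>
      H p.1.1 p.1.2 p.2) := by
    apply Measurable.add
    · exact hfE.comp (by fun_prop)
    · exact ((WW_meas hgm n).enorm).pow_const 2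
  -- pointwise bound
  have hpt : ∀ x y, ENNReal.ofReal η ≤ volume (Gset E x y) →
      ‖𝓕 g x‖ₑ ^ 2 ≤ K * 2 * ∫⁻ t in I, H x y t := by
    intro x y hy
    have h1 := remez n η hη (Gset E x y) (Gset_meas hE x y) (fun t ht => ht.1) hy (PP n g x y)
      (PP_degree n g x y)
    rw [PP_zero] at h1
    refine h1.trans ?_
    rw [mul_assoc]
    gcongr
    rw [← lintegral_const_mul' _ _ (by norm_num)]
    refine le_trans (setLIntegral_mono' (g := fun t => 2 * H x y t) (Gset_meas hE x y) ?_)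
      (lintegral_mono_set fun t ht => ht.1)
    intro t ht
    have h2 : (PP n g x y).eval (t : ℂ) = 𝓕 g (x + t • y) - WW n g x y t := by
      rw [taylor_id hg hg2 hsupp n x y t]; ring
    rw [h2]
    refine (enorm_sub_sq _ _).trans ?_
    simp only [H]
    rw [Set.indicator_of_mem ht.2]
  -- integrate in y
  have hx : ∀ x, ENNReal.ofReal η * volume B * ‖𝓕 g x‖ₑ ^ 2 ≤
      ∫⁻ y in B, K * 2 * ∫⁻ t in I, H x y t := by
    intro x
    set Y := {y | y ∈ B ∧ ENNReal.ofReal η ≤ volume (Gset E x y)} with hY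
    have hYm : MeasurableSet Y := by
      apply MeasurableSet.inter measurableSet_ball
      have := (Gset_vol_meas hE).comp (measurable_prodMk_left (x := x))
      exact measurableSet_le measurable_const this
    calc ENNReal.ofReal η * volume B * ‖𝓕 g x‖ₑ ^ 2 ≤ volume Y * ‖𝓕 g x‖ₑ ^ 2 := by
          gcongr; exact hthick x
      _ = ∫⁻ y in Y, ‖𝓕 g x‖ₑ ^ 2 := by rw [setLIntegral_const, mul_comm]
      _ ≤ ∫⁻ y in Y, K * 2 * ∫⁻ t in I, H x y t := by
          apply setLIntegral_mono' hYm
          intro y hy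
          exact hpt x y hy.2
      _ ≤ _ := lintegral_mono_set fun y hy => hy.1
  have hxx : ENNReal.ofReal η * volume B * ∫⁻ x, ‖𝓕 g x‖ₑ ^ 2 ≤
      ∫⁻ x, ∫⁻ y in B, K * 2 * ∫⁻ t in I, H x y t := by
    rw [← lintegral_const_mul' _ _ (ENNReal.mul_ne_top ENNReal.ofReal_ne_top hBfin)]
    exact lintegral_mono hx
  have hKfin : K * 2 ≠ ∞ := ENNReal.mul_ne_top ENNReal.ofReal_ne_top (by norm_num)
  have hHt : Measurable (fun p : EuclideanSpace ℝ (Fin d) × EuclideanSpace ℝ (Fin d) =>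
      ∫⁻ t in I, H p.1 p.2 t) := hHm.lintegral_prod_right'
  have hin : ∀ y ∈ B, ∫⁻ x, ∫⁻ t in I, H x y t ≤ FE + T := by
    intro y hy
    have hyn : ‖y‖ ≤ ρ := by
      have : ‖y‖ < ρ := by simpa [hB] using hy
      exact this.le
    rw [lintegral_lintegral_swap]
    · calc ∫⁻ t in I, ∫⁻ x, H x y t ≤ ∫⁻ t in I, (FE + T) := by
            apply setLIntegral_mono' measurableSet_Icc
            intro t ht
            have hm1 : Measurable (fun x => E.indicator (fun x => ‖𝓕 g x‖ₑ ^ 2) (x + t • y)) :=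
              hfE.comp (by fun_prop)
            simp only [H]
            rw [lintegral_add_left hm1]
            gcongr
            · rw [lintegral_add_right_eq_self (fun x => E.indicator (fun x => ‖𝓕 g x‖ₑ ^ 2) x),
                lintegral_indicator hE]
            · exact WW_bound hg hg2 hS hsupp n y t ρ hyn ht r hr
        _ = FE + T := by rw [setLIntegral_const]; simp [hI]
    · have : Measurable (fun p : EuclideanSpace ℝ (Fin d) × ℝ => H p.1 y p.2) :=
        hHm.comp (f := fun p : EuclideanSpace ℝ (Fin d) × ℝ => ((p.1, y), p.2)) (by fun_prop)
      exact this.aemeasurable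
  have hup : ∫⁻ x, ∫⁻ y in B, K * 2 * ∫⁻ t in I, H x y t ≤ K * 2 * (FE + T) * volume B := by
    rw [lintegral_lintegral_swap]
    · calc _ ≤ ∫⁻ y in B, K * 2 * (FE + T) := by
            apply setLIntegral_mono' measurableSet_ball
            intro y hy
            rw [lintegral_const_mul' _ _ hKfin]
            gcongr
            exact hin y hy
        _ = _ := by rw [setLIntegral_const]
    · exact (hHt.const_mul (K * 2)).aemeasurable
  have hfin := hxx.trans hup
  rw [mul_right_comm] at hfin
  exact (ENNReal.mul_le_mul_iff_left hBpos hBfin).1 hfin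

end KI

namespace KI
open FourierTransform

theorem numer (η : ℝ) (hη : 0 < η) (hη1 : η ≤ 1) : ∃ c c' : ℝ, 0 < c ∧ 0 < c' ∧ c ≤ 1 / 2 ∧
    ∀ r : ℝ, 0 ≤ r → ∃ n : ℕ, c * Real.exp (-c' * r) * (8 * remezC n η ^ 2) ≤ η ^ 2 ∧
      8 * remezC n η ^ 2 * (r ^ (n + 1) / (n + 1).factorial * Real.exp r) ^ 2 ≤ η ^ 2 := by
  set q : ℝ := η / (8 * Real.exp 3) with hq
  have hq0 : 0 < q := by positivity
  have he3 : 1 ≤ Real.exp 3 := Real.one_le_exp (by norm_num)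
  have hq1 : q ≤ 1 := by
    rw [hq, div_le_one (by positivity)]; linarith
  set L : ℝ := Real.log (4 * Real.exp 1 / η) with hL
  have he1 : 1 ≤ Real.exp 1 := Real.one_le_exp (by norm_num)
  have hbig : 1 < 4 * Real.exp 1 / η := by
    rw [lt_div_iff₀ hη]; linarith
  have hL0 : 0 < L := Real.log_pos hbig
  have hLe : Real.exp L = 4 * Real.exp 1 / η := Real.exp_log (by linarith)
  refine ⟨η ^ 2 / 32 * Real.exp (-(4 * L)), 2 * L / q, by positivity, by positivity, ?_, ?_⟩
  · have : Real.exp (-(4 * L)) ≤ 1 := Real.exp_le_one_iff.2 (by linarith)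
    have h2 : η ^ 2 ≤ 1 := by nlinarith
    have h3 := (Real.exp_pos (-(4 * L))).le
    nlinarith
  intro r hr
  refine ⟨⌈r / q⌉₊, ?_, ?_⟩
  · set n := ⌈r / q⌉₊ with hn
    have hnle : (n : ℝ) ≤ r / q + 1 := (Nat.ceil_lt_add_one (by positivity)).le
    have hM : remezC n η ≤ 2 * Real.exp (L * (r / q + 2)) := by
      unfold remezC
      have h1 : (4 / η) ^ n * Real.exp (n + 1) ≤ Real.exp L ^ (n + 1) := by
        rw [hLe]
        have : Real.exp ((n : ℝ) + 1) = Real.exp 1 ^ (n + 1) := by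
          rw [← Real.exp_nat_mul]; push_cast; ring_nf
        rw [this]
        have h4 : 1 ≤ 4 / η := by rw [le_div_iff₀ hη]; linarith
        have : 4 * Real.exp 1 / η = 4 / η * Real.exp 1 := by ring
        rw [this, mul_pow]
        gcongr
        · omega
      have h2 : Real.exp L ^ (n + 1) ≤ Real.exp (L * (r / q + 2)) := by
        rw [← Real.exp_nat_mul]
        apply Real.exp_le_exp.2
        push_cast
        nlinarith
      nlinarith
    have hM0 := remezC_pos n η hη
    calc η ^ 2 / 32 * Real.exp (-(4 * L)) * Real.exp (-(2 * L / q) * r) * (8 * remezC n η ^ 2)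
        ≤ η ^ 2 / 32 * Real.exp (-(4 * L)) * Real.exp (-(2 * L / q) * r) *
          (8 * (2 * Real.exp (L * (r / q + 2))) ^ 2) := by gcongr
      _ = η ^ 2 * (Real.exp (-(4 * L)) * Real.exp (-(2 * L / q) * r) * Real.exp (L * (r / q + 2))
            * Real.exp (L * (r / q + 2))) := by ring
      _ = η ^ 2 := by
          rw [← Real.exp_add, ← Real.exp_add, ← Real.exp_add]
          have : -(4 * L) + -(2 * L / q) * r + L * (r / q + 2) + L * (r / q + 2) = 0 := by
            field_simp; ring
          rw [this]; simp
  · set n := ⌈r / q⌉₊ with hn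
    have hnr : r ≤ q * (n + 1 : ℝ) := by
      have := Nat.le_ceil (r / q)
      rw [div_le_iff₀ hq0] at this
      nlinarith
    set T := r ^ (n + 1) / (n + 1).factorial * Real.exp r with hT
    have hT0 : 0 ≤ T := by positivity
    have hM0 := remezC_pos n η hη
    have key : remezC n η * T ≤ η / 4 := by
      have h1 : r ^ (n + 1) / (n + 1).factorial ≤ q ^ (n + 1) * Real.exp (n + 1 : ℝ) := by
        have := Real.pow_div_factorial_le_exp (n + 1 : ℝ) (by positivity) (n + 1)
        calc r ^ (n + 1) / (n + 1).factorial ≤ (q * (n + 1 : ℝ)) ^ (n + 1) / (n + 1).factorial := by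
              gcongr
          _ = q ^ (n + 1) * ((n + 1 : ℝ) ^ (n + 1) / (n + 1).factorial) := by
              rw [mul_pow, mul_div_assoc]
          _ ≤ _ := by gcongr
      have h2 : Real.exp r ≤ Real.exp (n + 1 : ℝ) := by
        apply Real.exp_le_exp.2
        nlinarith [hnr]
      have hex : Real.exp (n + 1 : ℝ) * Real.exp (n + 1 : ℝ) * Real.exp (n + 1 : ℝ)
          = Real.exp 3 ^ (n + 1) := by
        rw [← Real.exp_add, ← Real.exp_add, ← Real.exp_nat_mul]; push_cast; ring_nf
      calc remezC n η * T ≤ 2 * (4 / η) ^ n * Real.exp (n + 1) *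
            (q ^ (n + 1) * Real.exp (n + 1 : ℝ) * Real.exp (n + 1 : ℝ)) := by
            unfold remezC; rw [hT]; gcongr
        _ = 2 * (4 / η) ^ n * q ^ (n + 1) * (Real.exp (n + 1 : ℝ) * Real.exp (n + 1 : ℝ) * Real.exp (n + 1 : ℝ)) := by ring
        _ = η / 2 * ((4 / η) ^ (n + 1) * q ^ (n + 1) * Real.exp 3 ^ (n + 1)) := by
            rw [hex]; rw [pow_succ (4 / η)]; field_simp; ring
        _ = η / 2 * (1 / 2) ^ (n + 1) := by
            rw [← mul_pow, ← mul_pow]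
            congr 2
            rw [hq]; field_simp; norm_num
        _ ≤ η / 2 * (1 / 2) := by
            gcongr
            exact pow_le_of_le_one (by norm_num) (by norm_num) (by omega)
        _ = η / 4 := by ring
    have : (remezC n η * T) ^ 2 ≤ (η / 4) ^ 2 := by gcongr
    nlinarith [sq_nonneg η]

/-- Quantitative Logvinenko-Sereda in the complement form. -/
theorem ls2 (d : ℕ) (θ : ℝ) (hθ : θ ∈ Set.Ioo (0 : ℝ) 1) : ∃ c c' : ℝ, 0 < c ∧ 0 < c' ∧ c ≤ 1 / 2 ∧
    ∀ (Ω : Set (EuclideanSpace ℝ (Fin d))), MeasurableSet Ω → ∀ ρ : ℝ, 0 < ρ →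
    (∀ x, volume (Ω ∩ Metric.ball x ρ) ≤ ENNReal.ofReal θ * volume (Metric.ball x ρ)) →
    ∀ S : ℝ, 0 ≤ S → ∀ g : EuclideanSpace ℝ (Fin d) → ℂ, Integrable g → MemLp g 2 →
    StronglyMeasurable g → (∀ ξ, S < ‖ξ‖ → g ξ = 0) →
    ∫⁻ x in Ω, ‖𝓕 g x‖ₑ ^ 2 ≤
      ENNReal.ofReal (1 - c * Real.exp (-c' * (2 * π * S * ρ))) * ∫⁻ x, ‖g x‖ₑ ^ 2 := by
  obtain ⟨η, hη, hη1, hgeo⟩ := geo d θ hθ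
  obtain ⟨c, c', hc, hc', hc2, hnum⟩ := numer η hη hη1
  refine ⟨c, c', hc, hc', hc2, ?_⟩
  intro Ω hΩ ρ hρ hth S hS g hg hg2 hgm hsupp
  set r := 2 * π * S * ρ with hr
  have hr0 : 0 ≤ r := by positivity
  obtain ⟨n, hn1, hn2⟩ := hnum r hr0
  have h1 := ls1 hg hg2 hgm hS hsupp n Ωᶜ hΩ.compl ρ η r hρ hη le_rfl (hgeo Ω hΩ ρ hρ hth)
  obtain ⟨hf2, hpl⟩ := plancherel g hg hg2
  set M := remezC n η
  have hM : 0 < M := remezC_pos n η hη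
  set T := r ^ (n + 1) / (n + 1).factorial * Real.exp r
  have hsplit := lintegral_add_compl (μ := volume) (fun x => ‖𝓕 g x‖ₑ ^ 2) hΩ
  rw [hpl] at h1 hsplit
  have hfin : ∫⁻ x, ‖g x‖ₑ ^ 2 ≠ ∞ := by
    have := hg2.eLpNorm_lt_top
    have h := lintegral_rpow_enorm_lt_top_of_eLpNorm_lt_top (by norm_num) (by norm_num) this
    simpa using h.ne
  set X := ∫⁻ x, ‖g x‖ₑ ^ 2
  set Y := ∫⁻ x in Ωᶜ, ‖𝓕 g x‖ₑ ^ 2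
  set Z := ∫⁻ x in Ω, ‖𝓕 g x‖ₑ ^ 2
  have hZ : Z ≠ ∞ := fun h => hfin (by rw [← hsplit, h]; simp)
  have hY : Y ≠ ∞ := fun h => hfin (by rw [← hsplit, h]; simp)
  clear_value X Y Z
  lift X to NNReal using hfin
  lift Y to NNReal using hY
  lift Z to NNReal using hZ
  have hs : (Z : ℝ) + Y = X := by exact_mod_cast hsplit
  have hX : (X : ℝ≥0∞) = ENNReal.ofReal X := by simp
  have hYe : (Y : ℝ≥0∞) = ENNReal.ofReal Y := by simp
  have hZe : (Z : ℝ≥0∞) = ENNReal.ofReal Z := by simp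
  have h2e : (2 : ℝ≥0∞) = ENNReal.ofReal 2 := by simp
  rw [hX, hYe, h2e, ← ENNReal.ofReal_mul hη.le, ← ENNReal.ofReal_mul (by positivity),
    ← ENNReal.ofReal_mul (by positivity), ← ENNReal.ofReal_add (by positivity) (by positivity),
    ← ENNReal.ofReal_mul (by positivity), ENNReal.ofReal_le_ofReal_iff (by positivity)] at h1
  have hX0 : (0 : ℝ) ≤ X := X.2
  have h3 : η ^ 2 * X ≤ 4 * M ^ 2 * (Y + T ^ 2 * X) := by
    calc η ^ 2 * X = η * (η * X) := by ring
      _ ≤ η * (M ^ 2 * (2 / η) * 2 * (Y + T ^ 2 * X)) := by gcongr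
      _ = _ := by field_simp; ring
  set δ := c * Real.exp (-c' * r)
  have hδ : δ ≤ 1 / 2 := by
    have : Real.exp (-c' * r) ≤ 1 := Real.exp_le_one_iff.2 (by nlinarith)
    have h0 := Real.exp_pos (-c' * r)
    calc δ ≤ c * 1 := by unfold δ; gcongr
      _ ≤ _ := by linarith
  have h4 : δ * X ≤ Y := by
    have h5 : 8 * M ^ 2 * T ^ 2 * X ≤ η ^ 2 * X := by gcongr
    have h6 : δ * (8 * M ^ 2) * X ≤ η ^ 2 * X := by gcongr
    have h7 : 8 * M ^ 2 * (δ * X) ≤ 8 * M ^ 2 * Y := by nlinarith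
    exact le_of_mul_le_mul_left h7 (by positivity)
  rw [hX, hZe, ← ENNReal.ofReal_mul (by linarith)]
  apply ENNReal.ofReal_le_ofReal
  linarith

end KI

namespace KI

theorem absG {ι H H' : Type*} [Fintype ι] [NormedAddCommGroup H] [InnerProductSpace ℂ H]
    [NormedAddCommGroup H'] [InnerProductSpace ℂ H'] [CompleteSpace H']
    (a : ι → H) (b : ι → H')
    (hab : ∀ c : ι → ℂ, ∑ k, c k • a k = 0 → ∑ k, c k • b k = 0)
    (κ : ℝ)
    (hκ : ∀ c : ι → ℂ, ‖∑ k, c k • a k‖ ^ 2 ≤ κ * ∑ k, ‖c k‖ ^ 2) (Λ : ℝ) :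
    ∃ (N : ℕ) (c : Fin N → ι → ℂ), Orthonormal ℂ (fun j => ∑ k, c j k • a k) ∧
      ∑ k, (Λ * ‖a k‖ ^ 2 - ‖b k‖ ^ 2) ≤ κ * ∑ j, (Λ - ‖∑ k, c j k • b k‖ ^ 2) := by
  classical
  set T : (ι → ℂ) →ₗ[ℂ] H := Fintype.linearCombination ℂ a with hT
  set S : (ι → ℂ) →ₗ[ℂ] H' := Fintype.linearCombination ℂ b with hS
  have hTa : ∀ c, T c = ∑ k, c k • a k := fun c => Fintype.linearCombination_apply ℂ a c
  have hSa : ∀ c, S c = ∑ k, c k • b k := fun c => Fintype.linearCombination_apply ℂ b c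
  obtain ⟨g, hg⟩ := T.rangeRestrict.exists_rightInverse_of_surjective T.range_rangeRestrict
  have hTg : ∀ v : LinearMap.range T, T (g v) = v := by
    intro v
    have := LinearMap.congr_fun hg v
    exact congrArg Subtype.val this
  set S' : LinearMap.range T →ₗ[ℂ] H' := S ∘ₗ g with hS'
  have hS'T : ∀ c, S' (T.rangeRestrict c) = S c := by
    intro c
    have h1 : T (g (T.rangeRestrict c) - c) = 0 := by
      rw [map_sub, hTg]; simp
    have h2 : S (g (T.rangeRestrict c) - c) = 0 := by
      rw [hSa]; apply hab; rw [← hTa]; exact h1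
    rw [map_sub, sub_eq_zero] at h2
    exact h2
  have : CompleteSpace (LinearMap.range T) := FiniteDimensional.complete ℂ _
  set A : LinearMap.range T →L[ℂ] H' := LinearMap.toContinuousLinearMap S' with hA
  have hAS : ∀ v, A v = S' v := fun v => rfl
  set Q : LinearMap.range T →ₗ[ℂ] LinearMap.range T :=
    (ContinuousLinearMap.adjoint A ∘L A : LinearMap.range T →L[ℂ] LinearMap.range T).toLinearMap with hQ
  have hQi : ∀ v w, inner ℂ (Q v) w = inner ℂ (S' v) (S' w) := by
    intro v w
    exact ContinuousLinearMap.adjoint_inner_left A w (A v)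
  have hQs : Q.IsSymmetric := by
    intro v w
    rw [hQi, ← inner_conj_symm v, hQi, inner_conj_symm]
  set n := Module.finrank ℂ (LinearMap.range T) with hn
  set e := hQs.eigenvectorBasis hn.symm with he
  set μ := hQs.eigenvalues hn.symm with hμ
  have hnorm : ∀ v, ‖S' v‖ ^ 2 = ∑ j, μ j * ‖inner ℂ (e j) v‖ ^ 2 := by
    intro v
    have h1 : (‖S' v‖ ^ 2 : ℂ) = inner ℂ (Q v) v := by
      rw [hQi, inner_self_eq_norm_sq_to_K]; rfl
    rw [← e.sum_inner_mul_inner] at h1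
    have h2 : ∀ j, inner ℂ (Q v) (e j) * inner ℂ (e j) v =
        ((μ j * ‖inner ℂ (e j) v‖ ^ 2 : ℝ) : ℂ) := by
      intro j
      rw [hQs v (e j), he, hQs.apply_eigenvectorBasis, inner_smul_right, ← inner_conj_symm v,
        mul_assoc, Complex.conj_mul']
      push_cast
      rfl
    rw [Finset.sum_congr rfl (fun j _ => h2 j), ← Complex.ofReal_sum] at h1
    exact_mod_cast h1
  have hpars : ∀ v : LinearMap.range T, ‖v‖ ^ 2 = ∑ j, ‖inner ℂ (e j) v‖ ^ 2 := by
    intro v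
    exact (e.sum_sq_norm_inner_right v).symm
  have hSe : ∀ j, ‖S' (e j)‖ ^ 2 = μ j := by
    intro j
    rw [hnorm, Finset.sum_eq_single j]
    · rw [inner_self_eq_norm_sq_to_K, e.orthonormal.1 j]; simp
    · intro i _ hij
      rw [e.orthonormal.2 hij]; simp
    · simp
  set a' : ι → LinearMap.range T := fun k => T.rangeRestrict (Pi.single k 1) with ha'
  have haa : ∀ k, (a' k : H) = a k := by
    intro k; simp [ha', hT]
  have hbb : ∀ k, S' (a' k) = b k := by
    intro k; rw [ha', hS'T]; simp [hS]
  set W : Fin n → ℝ := fun j => ∑ k, ‖inner ℂ (e j) (a' k)‖ ^ 2 with hW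
  have hW0 : ∀ j, 0 ≤ W j := fun j => Finset.sum_nonneg fun k _ => by positivity
  have hWκ : ∀ j, W j ≤ κ := by
    intro j
    set c : ι → ℂ := fun k => (starRingEnd ℂ) (inner ℂ (e j) (a' k)) with hc
    set h : LinearMap.range T := ∑ k, c k • a' k with hh
    have h1 : inner ℂ (e j) h = (W j : ℂ) := by
      rw [hh, inner_sum, hW]
      push_cast
      refine Finset.sum_congr rfl fun k _ => ?_
      rw [inner_smul_right, hc, Complex.conj_mul']
    have h2 : W j ≤ ‖h‖ := by
      have := norm_inner_le_norm (𝕜 := ℂ) (e j) h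
      rw [h1, e.orthonormal.1 j, one_mul, Complex.norm_real, Real.norm_of_nonneg (hW0 j)] at this
      exact this
    have h3 : ‖h‖ ^ 2 ≤ κ * W j := by
      have := hκ c
      have h4 : ∑ k, c k • a k = (h : H) := by
        rw [hh]; push_cast; simp [haa]
      rw [h4] at this
      have h5 : ∑ k, ‖c k‖ ^ 2 = W j := by
        simp only [hc, hW, RCLike.norm_conj]
      rw [h5] at this
      exact this
    by_contra hcon
    push Not at hcon
    have h6 : W j ^ 2 ≤ κ * W j := (pow_le_pow_left₀ (hW0 j) h2 2).trans h3
    rcases (hW0 j).eq_or_lt with h0 | h0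
    · rw [← h0] at hcon h3 h6 h2
      -- here κ is negative while the norm bound forces a vector to vanish
      have h7 := hκ (fun k => (g (e j)) k)
      rw [← hTa, hTg] at h7
      have h8 : ‖((e j : LinearMap.range T) : H)‖ = 1 := e.orthonormal.1 j
      rw [h8] at h7
      have : 0 ≤ ∑ k, ‖g (e j) k‖ ^ 2 := Finset.sum_nonneg fun k _ => by positivity
      nlinarith
    · nlinarith
  have hsum : ∑ k, (Λ * ‖a k‖ ^ 2 - ‖b k‖ ^ 2) = ∑ j, (Λ - μ j) * W j := by
    have : ∀ k, Λ * ‖a k‖ ^ 2 - ‖b k‖ ^ 2 = ∑ j, (Λ - μ j) * ‖inner ℂ (e j) (a' k)‖ ^ 2 := by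
      intro k
      have h1 : ‖a k‖ = ‖a' k‖ := by rw [← haa]; rfl
      rw [h1, hpars, ← hbb, hnorm, Finset.mul_sum, ← Finset.sum_sub_distrib]
      exact Finset.sum_congr rfl fun j _ => by ring
    rw [Finset.sum_congr rfl (fun k _ => this k), Finset.sum_comm]
    exact Finset.sum_congr rfl fun j _ => by rw [hW, Finset.mul_sum]
  set J := {j : Fin n // μ j < Λ}
  set N := Fintype.card J
  set eq : Fin N ≃ J := (Fintype.equivFin J).symm
  refine ⟨N, fun j => g (e (eq j).1), ?_, ?_⟩
  · have h1 : (fun j => ∑ k, g (e (eq j).1) k • a k) =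
        fun j => ((e (eq j).1 : LinearMap.range T) : H) := by
      funext j
      rw [← hTa, hTg]
    rw [h1]
    have h2 : Orthonormal ℂ (fun j => ((e j : LinearMap.range T) : H)) :=
      e.orthonormal.comp_linearIsometry (LinearMap.range T).subtypeₗᵢ
    exact h2.comp (fun j => (eq j).1) (Subtype.val_injective.comp eq.injective)
  · rw [hsum]
    have h1 : ∀ j : Fin N, Λ - ‖∑ k, g (e (eq j).1) k • b k‖ ^ 2 = Λ - μ (eq j).1 := by
      intro j
      rw [← hSa]
      have : S (g (e (eq j).1)) = S' (e (eq j).1) := rfl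
      rw [this, hSe]
    rw [Finset.sum_congr rfl (fun j _ => h1 j), Equiv.sum_comp eq (fun x : J => Λ - μ x.1)]
    have h2 : ∑ x : J, (Λ - μ x.1) = ∑ j ∈ Finset.univ.filter (fun j => μ j < Λ), (Λ - μ j) := by
      rw [Finset.sum_subtype (p := fun j => μ j < Λ)]
      simp
    rw [h2, Finset.mul_sum, Finset.sum_filter]
    refine Finset.sum_le_sum fun j _ => ?_
    split_ifs with h
    · nlinarith [hWκ j]
    · nlinarith [hW0 j]

end KI

namespace KI
open FourierTransform

/-- Square integrable functions on the closed frequency ball. -/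
abbrev XX (d : ℕ) (S : ℝ) : Type :=
  Lp ℂ 2 ((volume : Measure (EuclideanSpace ℝ (Fin d))).restrict (Metric.closedBall 0 S))

/-- Extension by zero. -/
noncomputable def gu {d : ℕ} {S : ℝ} (u : XX d S) : EuclideanSpace ℝ (Fin d) → ℂ :=
  (Metric.closedBall 0 S).indicator u

theorem gu_supp {d : ℕ} {S : ℝ} (u : XX d S) (ξ : EuclideanSpace ℝ (Fin d)) (h : S < ‖ξ‖) :
    gu u ξ = 0 := by
  unfold gu
  rw [Set.indicator_of_notMem]
  simpa using h

theorem gu_sm {d : ℕ} {S : ℝ} (u : XX d S) : StronglyMeasurable (gu u) :=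
  (Lp.stronglyMeasurable u).indicator Metric.isClosed_closedBall.measurableSet

theorem gu_memLp {d : ℕ} {S : ℝ} (u : XX d S) : MemLp (gu u) 2 :=
  (memLp_indicator_iff_restrict Metric.isClosed_closedBall.measurableSet).2 (Lp.memLp u)

instance finB (d : ℕ) (S : ℝ) : IsFiniteMeasure
    ((volume : Measure (EuclideanSpace ℝ (Fin d))).restrict (Metric.closedBall 0 S)) :=
  ⟨by rw [Measure.restrict_apply_univ]; exact measure_closedBall_lt_top⟩

theorem gu_int {d : ℕ} {S : ℝ} (u : XX d S) : Integrable (gu u) :=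
  (integrable_indicator_iff Metric.isClosed_closedBall.measurableSet).2
    ((Lp.memLp u).integrable (by norm_num))

theorem Emem {d : ℕ} (S : ℝ) (m : EuclideanSpace ℝ (Fin d) → ℂ) (hm : Continuous m)
    (x : EuclideanSpace ℝ (Fin d)) :
    MemLp (fun v => m v * (𝐞 (inner ℝ v x) : ℂ)) 2
      ((volume : Measure (EuclideanSpace ℝ (Fin d))).restrict (Metric.closedBall 0 S)) := by
  obtain ⟨C, hC⟩ := (isCompact_closedBall (0 : EuclideanSpace ℝ (Fin d)) S).exists_bound_of_continuousOn
    hm.continuousOn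
  have hcont : Continuous (fun v => m v * (𝐞 (inner ℝ v x) : ℂ)) := by fun_prop
  refine MemLp.of_bound hcont.aestronglyMeasurable C ?_
  filter_upwards [ae_restrict_mem Metric.isClosed_closedBall.measurableSet] with v hv
  rw [norm_mul, Circle.norm_coe, mul_one]
  exact hC v hv

/-- The Fourier coefficient as an inner product. -/
theorem four_inner {d : ℕ} {S : ℝ} (u : XX d S) (m : EuclideanSpace ℝ (Fin d) → ℂ)
    (hm : Continuous m) (x : EuclideanSpace ℝ (Fin d)) :
    inner ℂ ((Emem S m hm x).toLp) u = 𝓕 (fun v => (starRingEnd ℂ) (m v) * gu u v) x := by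
  rw [L2.inner_def, Real.fourier_eq]
  have h1 : ∀ v, 𝐞 (-inner ℝ v x) • ((starRingEnd ℂ) (m v) * gu u v) =
      (Metric.closedBall (0 : EuclideanSpace ℝ (Fin d)) S).indicator
        (fun v => 𝐞 (-inner ℝ v x) • ((starRingEnd ℂ) (m v) * u v)) v := by
    intro v
    unfold gu
    by_cases h : v ∈ Metric.closedBall (0 : EuclideanSpace ℝ (Fin d)) S
    · simp only [Set.indicator_of_mem h]
    · simp only [Set.indicator_of_notMem h]; simp
  simp_rw [h1]
  rw [integral_indicator Metric.isClosed_closedBall.measurableSet]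
  apply integral_congr_ae
  filter_upwards [(Emem S m hm x).coeFn_toLp] with v hv
  rw [hv, RCLike.inner_apply, Circle.smul_def, smul_eq_mul, map_mul]
  have : (starRingEnd ℂ) (𝐞 (inner ℝ v x) : ℂ) = (𝐞 (-inner ℝ v x) : ℂ) := by
    rw [AddChar.map_neg_eq_inv, Circle.coe_inv_eq_conj]
  rw [this]; ring

theorem parseval_pt {d : ℕ} {S : ℝ} {ι : Type*} (b : HilbertBasis ι ℂ (XX d S))
    (m : EuclideanSpace ℝ (Fin d) → ℂ)
    (hm : Continuous m) (x : EuclideanSpace ℝ (Fin d)) :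
    ∑' k, ‖𝓕 (fun v => m v * gu (b k) v) x‖ₑ ^ 2 =
      ENNReal.ofReal (∫ v in Metric.closedBall (0 : EuclideanSpace ℝ (Fin d)) S, ‖m v‖ ^ 2) := by
  have hm' : Continuous (fun v => (starRingEnd ℂ) (m v)) := Complex.continuous_conj.comp hm
  set w := (Emem S _ hm' x).toLp with hw
  have h1 := b.hasSum_inner_mul_inner w w
  have h2 : ∀ k, inner ℂ w (b k) * inner ℂ (b k) w =
      ((‖𝓕 (fun v => m v * gu (b k) v) x‖ ^ 2 : ℝ) : ℂ) := by
    intro k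
    have h3 := four_inner (b k) _ hm' x
    simp only [Complex.conj_conj] at h3
    rw [← inner_conj_symm (b k), ← hw] at *
    rw [h3, Complex.mul_conj']
    push_cast; rfl
  have h4 : inner ℂ w w = ((∫ v in Metric.closedBall (0 : EuclideanSpace ℝ (Fin d)) S, ‖m v‖ ^ 2 : ℝ) : ℂ) := by
    rw [L2.inner_def, ← integral_complex_ofReal]
    apply integral_congr_ae
    filter_upwards [(Emem S _ hm' x).coeFn_toLp] with v hv
    rw [hv, inner_self_eq_norm_sq_to_K, norm_mul, Circle.norm_coe, mul_one, RCLike.norm_conj]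
    push_cast; rfl
  rw [h4] at h1
  simp_rw [h2] at h1
  have h5 := Complex.hasSum_ofReal.1 h1
  rw [← h5.tsum_eq, ENNReal.ofReal_tsum_of_nonneg (fun k => by positivity) h5.summable]
  congr 1
  funext k
  rw [← ofReal_norm, ENNReal.ofReal_pow (norm_nonneg _)]

theorem mgu_int {d : ℕ} {S : ℝ} (u : XX d S) (m : EuclideanSpace ℝ (Fin d) → ℂ)
    (hm : Continuous m) : Integrable (fun v => m v * gu u v) ∧ MemLp (fun v => m v * gu u v) 2 := by
  obtain ⟨C, hC⟩ := (isCompact_closedBall (0 : EuclideanSpace ℝ (Fin d)) S).exists_bound_of_continuousOn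
    hm.continuousOn
  have := mul_int (gu_int u) (gu_memLp u) (gu_supp u) m hm C (fun ξ hξ => hC ξ (by simpa using hξ))
  exact ⟨this.1, this.2.1⟩

theorem parseval_int {d : ℕ} {S : ℝ} {ι : Type*} [Countable ι] (b : HilbertBasis ι ℂ (XX d S))
    (m : EuclideanSpace ℝ (Fin d) → ℂ) (hm : Continuous m)
    (Ω : Set (EuclideanSpace ℝ (Fin d))) (hΩ : volume Ω < ∞) :
    HasSum (fun k => ∫ x in Ω, ‖𝓕 (fun v => m v * gu (b k) v) x‖ ^ 2)
      ((volume Ω).toReal *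
        ∫ v in Metric.closedBall (0 : EuclideanSpace ℝ (Fin d)) S, ‖m v‖ ^ 2) := by
  set I := ∫ v in Metric.closedBall (0 : EuclideanSpace ℝ (Fin d)) S, ‖m v‖ ^ 2 with hI
  have hI0 : 0 ≤ I := integral_nonneg fun v => by positivity
  have hc : ∀ k, Continuous (𝓕 (fun v => m v * gu (b k) v)) := fun k =>
    fourier_cont (mgu_int (b k) m hm).1
  have h1 : ∑' k, ∫⁻ x in Ω, ‖𝓕 (fun v => m v * gu (b k) v) x‖ₑ ^ 2 =
      ENNReal.ofReal ((volume Ω).toReal * I) := by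
    rw [← lintegral_tsum (fun k => by have := hc k; fun_prop)]
    simp_rw [parseval_pt b m hm]
    rw [setLIntegral_const, ENNReal.ofReal_mul ENNReal.toReal_nonneg, ENNReal.ofReal_toReal hΩ.ne,
      mul_comm]
  have h2 : ∀ k, ∫ x in Ω, ‖𝓕 (fun v => m v * gu (b k) v) x‖ ^ 2 =
      (∫⁻ x in Ω, ‖𝓕 (fun v => m v * gu (b k) v) x‖ₑ ^ 2).toReal := by
    intro k
    rw [integral_eq_lintegral_of_nonneg_ae (Filter.Eventually.of_forall fun x => by positivity)
      (by have := hc k; exact (by fun_prop : Continuous _).aestronglyMeasurable)]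
    congr 2
    funext x
    rw [← ofReal_norm, ENNReal.ofReal_pow (norm_nonneg _)]
  simp_rw [h2]
  have h3 : ∑' k, ∫⁻ x in Ω, ‖𝓕 (fun v => m v * gu (b k) v) x‖ₑ ^ 2 ≠ ∞ := by
    rw [h1]; exact ENNReal.ofReal_ne_top
  have h4 := ENNReal.hasSum_toReal h3
  rw [← ENNReal.tsum_toReal_eq (fun k => ENNReal.ne_top_of_tsum_ne_top h3 k), h1, ENNReal.toReal_ofReal (by positivity)] at h4
  exact h4

theorem basis_countable {d : ℕ} {S : ℝ} {ι : Type*} (b : HilbertBasis ι ℂ (XX d S)) :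
    Countable ι := by
  have : Fact ((2 : ℝ≥0∞) ≠ ∞) := ⟨by norm_num⟩
  have : TopologicalSpace.SeparableSpace (XX d S) := inferInstance
  have hdis : ∀ i j, i ≠ j → 1 < ‖b i - b j‖ := by
    intro i j hij
    have h := @norm_sub_sq ℂ _ _ _ _ (b i) (b j)
    rw [b.orthonormal.1 i, b.orthonormal.1 j, b.orthonormal.2 hij] at h
    simp at h
    nlinarith [norm_nonneg (b i - b j)]
  have hd : Pairwise (Function.onFun Disjoint (fun i => Metric.ball (b i) (1/2))) := by
    intro i j hij
    apply Metric.ball_disjoint_ball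
    rw [dist_eq_norm]
    linarith [hdis i j hij]
  exact hd.countable_of_isOpen_disjoint (fun i => Metric.isOpen_ball)
    (fun i => ⟨b i, by simp⟩)

end KI

namespace KI
open FourierTransform

theorem semi_int (d : ℕ) (hd : 1 ≤ d) (Λ : ℝ) (hΛ : 0 < Λ) :
    ∫ v in Metric.closedBall (0 : EuclideanSpace ℝ (Fin d)) (√Λ / (2 * π)),
      (Λ - 4 * π ^ 2 * ‖v‖ ^ 2) = semiclassicalConst d * Λ ^ (1 + (d : ℝ) / 2) := by
  set S := √Λ / (2 * π) with hS
  have hS0 : 0 < S := by positivity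
  have hSΛ : 4 * π ^ 2 * S ^ 2 = Λ := by
    rw [hS, div_pow, Real.sq_sqrt hΛ.le]; field_simp; ring
  have : Nonempty (Fin d) := ⟨⟨0, hd⟩⟩
  obtain ⟨e, rfl⟩ : ∃ e, d = e + 1 := ⟨d - 1, by omega⟩
  rw [← integral_indicator Metric.isClosed_closedBall.measurableSet]
  have h1 : ∀ v : EuclideanSpace ℝ (Fin (e + 1)), (Metric.closedBall (0 : EuclideanSpace ℝ (Fin (e+1))) S).indicator
      (fun v => Λ - 4 * π ^ 2 * ‖v‖ ^ 2) v =
      (fun y : ℝ => (Set.Iic S).indicator (fun y => Λ - 4 * π ^ 2 * y ^ 2) y) ‖v‖ := by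
    intro v
    by_cases h : ‖v‖ ≤ S
    · rw [Set.indicator_of_mem (by simpa using h)]
      simp [h]
    · rw [Set.indicator_of_notMem (by simpa using h)]
      simp [h]
  simp_rw [h1]
  rw [integral_fun_norm_addHaar volume
    (fun y : ℝ => (Set.Iic S).indicator (fun y => Λ - 4 * π ^ 2 * y ^ 2) y)]
  rw [finrank_euclideanSpace, Fintype.card_fin, Nat.add_sub_cancel]
  have h2 : ∀ y : ℝ, y ^ e • (Set.Iic S).indicator (fun y => Λ - 4 * π ^ 2 * y ^ 2) y =
      (Set.Iic S).indicator (fun y => y ^ e * (Λ - 4 * π ^ 2 * y ^ 2)) y := by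
    intro y
    by_cases h : y ≤ S
    · simp [h]
    · simp [h]
  simp_rw [h2]
  rw [setIntegral_indicator measurableSet_Iic, Set.Ioi_inter_Iic,
    ← intervalIntegral.integral_of_le hS0.le]
  have h3 : ∫ y in (0 : ℝ)..S, y ^ e * (Λ - 4 * π ^ 2 * y ^ 2) =
      Λ * (S ^ (e + 1) / (e + 1)) - 4 * π ^ 2 * (S ^ (e + 3) / (e + 3)) := by
    have : ∀ y : ℝ, y ^ e * (Λ - 4 * π ^ 2 * y ^ 2) = Λ * y ^ e - 4 * π ^ 2 * y ^ (e + 2) := by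
      intro y; ring
    simp_rw [this]
    rw [intervalIntegral.integral_sub (by apply Continuous.intervalIntegrable; fun_prop)
      (by apply Continuous.intervalIntegrable; fun_prop), intervalIntegral.integral_const_mul,
      intervalIntegral.integral_const_mul, integral_pow, integral_pow]
    push_cast
    simp
    ring
  have h3' : ∫ y in (0 : ℝ)..S, y ^ e * (Λ - 4 * π ^ 2 * y ^ 2) =
      2 * Λ * S ^ (e + 1) / ((e + 1) * (e + 3)) := by
    have : S ^ (e + 3) = S ^ (e + 1) * S ^ 2 := by ring
    rw [h3, this, ← hSΛ]
    field_simp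
    ring
  rw [h3', measureReal_def, EuclideanSpace.volume_ball]
  simp only [Fintype.card_fin, ENNReal.ofReal_one, one_pow, one_mul, nsmul_eq_mul, smul_eq_mul]
  rw [ENNReal.toReal_ofReal (by positivity)]
  unfold semiclassicalConst
  have hG : Real.Gamma (2 + ((e + 1 : ℕ) : ℝ) / 2) =
      (((e + 1 : ℕ) : ℝ) / 2 + 1) * Real.Gamma (((e + 1 : ℕ) : ℝ) / 2 + 1) := by
    rw [← Real.Gamma_add_one (by positivity)]; ring_nf
  have hG0 : 0 < Real.Gamma (((e + 1 : ℕ) : ℝ) / 2 + 1) := Real.Gamma_pos_of_pos (by positivity)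
  have hp : (4 * π) ^ (((e + 1 : ℕ) : ℝ) / 2) = (2 * √π) ^ (e + 1) := by
    have : 4 * π = (2 * √π) ^ (2 : ℝ) := by
      rw [Real.rpow_two, mul_pow, Real.sq_sqrt pi_pos.le]; norm_num
    rw [this, ← Real.rpow_mul (by positivity), ← Real.rpow_natCast]
    congr 1
    ring
  have hL : Λ ^ (1 + ((e + 1 : ℕ) : ℝ) / 2) = Λ * √Λ ^ (e + 1) := by
    rw [Real.rpow_add hΛ, Real.rpow_one, Real.sqrt_eq_rpow, ← Real.rpow_natCast,
      ← Real.rpow_mul hΛ.le]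
    congr 2; ring
  have hSp : S ^ (e + 1) = √Λ ^ (e + 1) / ((2 * √π) ^ (e + 1) * √π ^ (e + 1)) := by
    rw [hS, div_pow]
    congr 1
    rw [← mul_pow, mul_assoc, Real.mul_self_sqrt pi_pos.le]
  rw [hG, hp, hL, Real.Gamma_two, hSp]
  push_cast
  field_simp
  ring

theorem pow_gu_int {d : ℕ} {S : ℝ} (u : XX d S) (n : ℕ) :
    Integrable (fun v => ‖v‖ ^ n * ‖gu u v‖) := by
  have := (mgu_int u (fun v => ((‖v‖ ^ n : ℝ) : ℂ)) (by fun_prop)).1.norm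
  refine this.congr (Filter.Eventually.of_forall fun v => ?_)
  simp

theorem contDiff_f {d : ℕ} {S : ℝ} (u : XX d S) : ContDiff ℝ (⊤ : ℕ∞) (𝓕 (gu u)) :=
  Real.contDiff_fourier fun n _ => pow_gu_int u n

theorem deriv_f {d : ℕ} {S : ℝ} (u : XX d S) (k : Fin d) (x : EuclideanSpace ℝ (Fin d)) :
    fderiv ℝ (𝓕 (gu u)) x (EuclideanSpace.single k 1) =
      𝓕 (fun v => (-(2 * π * Complex.I) * (v k : ℂ)) * gu u v) x := by
  have hi := pow_gu_int u 1
  simp only [pow_one] at hi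
  rw [Real.fderiv_fourier (gu_int u) hi, Real.fourier_eq, Real.fourier_eq]
  have hIntg : Integrable (fun v => 𝐞 (-inner ℝ v x) • VectorFourier.fourierSMulRight (innerSL ℝ) (gu u) v) := by
    have h0 : Integrable (VectorFourier.fourierSMulRight (innerSL ℝ) (gu u)) := by
      refine (hi.const_mul (2 * π * ‖(innerSL ℝ : EuclideanSpace ℝ (Fin d) →L[ℝ] _)‖)).mono' ?_ ?_
      · exact AEStronglyMeasurable.fourierSMulRight (L := innerSL ℝ) (gu_int u).1
      · filter_upwards with v
        have := VectorFourier.norm_fourierSMulRight_le (innerSL ℝ) (gu u) v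
        linarith
    exact (Real.fourierIntegral_convergent_iff x).2 h0
  rw [ContinuousLinearMap.integral_apply hIntg]
  congr 1
  funext v
  change 𝐞 (-inner ℝ v x) • (VectorFourier.fourierSMulRight (innerSL ℝ) (gu u) v)
    (EuclideanSpace.single k 1) = _
  rw [VectorFourier.fourierSMulRight_apply]
  congr 1
  rw [innerSL_apply_apply]
  simp [EuclideanSpace.inner_single_right]
  ring

end KI

namespace KI
open FourierTransform

/-- The Fourier multiplier of the partial derivative. -/
noncomputable def mk {d : ℕ} (k : Fin d) (v : EuclideanSpace ℝ (Fin d)) : ℂ :=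
  -(2 * π * Complex.I) * (v k : ℂ)

theorem mk_cont {d : ℕ} (k : Fin d) : Continuous (mk k) := by
  unfold mk; fun_prop

theorem mk_norm {d : ℕ} (k : Fin d) (v : EuclideanSpace ℝ (Fin d)) :
    ‖mk k v‖ ^ 2 = 4 * π ^ 2 * (v k) ^ 2 := by
  unfold mk
  rw [norm_mul, norm_neg, norm_mul, norm_mul, Complex.norm_I, Complex.norm_real, Complex.norm_real,
    Real.norm_eq_abs, Real.norm_eq_abs, mul_pow, mul_pow, mul_pow, sq_abs, sq_abs]
  norm_num

theorem sq_int {d : ℕ} {S : ℝ} (u : XX d S) (m : EuclideanSpace ℝ (Fin d) → ℂ)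
    (hm : Continuous m) : Integrable (fun x => ‖𝓕 (fun v => m v * gu u v) x‖ ^ 2) := by
  obtain ⟨h1, h2⟩ := mgu_int u m hm
  exact (plancherel _ h1 h2).1.norm.integrable_sq

theorem gradSq_f {d : ℕ} {S : ℝ} (u : XX d S) (x : EuclideanSpace ℝ (Fin d)) :
    gradSq d (𝓕 (gu u)) x = ∑ k, ‖𝓕 (fun v => mk k v * gu u v) x‖ ^ 2 := by
  unfold gradSq
  refine Finset.sum_congr rfl fun k _ => ?_
  rw [deriv_f]; rfl

theorem trace_sum {d : ℕ} (hd : 1 ≤ d) {Λ : ℝ} (hΛ : 0 < Λ) {ι : Type*}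
    (b : HilbertBasis ι ℂ (XX d (√Λ / (2 * π))))
    (Ω : Set (EuclideanSpace ℝ (Fin d))) (hΩ : volume Ω < ∞) :
    HasSum (fun k => Λ * (∫ x in Ω, ‖𝓕 (gu (b k)) x‖ ^ 2) - ∫ x in Ω, gradSq d (𝓕 (gu (b k))) x)
      (semiclassicalConst d * (volume Ω).toReal * Λ ^ (1 + (d : ℝ) / 2)) := by
  have := basis_countable b
  set B := Metric.closedBall (0 : EuclideanSpace ℝ (Fin d)) (√Λ / (2 * π)) with hB
  have h0 := (parseval_int b (fun _ => 1) continuous_const Ω hΩ).mul_left Λ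
  simp only [one_mul] at h0
  have h1 : HasSum (fun k => ∫ x in Ω, gradSq d (𝓕 (gu (b k))) x)
      (∑ k : Fin d, (volume Ω).toReal * ∫ v in B, ‖mk k v‖ ^ 2) := by
    have := hasSum_sum (s := (Finset.univ : Finset (Fin d)))
      (fun k _ => parseval_int b (mk k) (mk_cont k) Ω hΩ)
    have he : (fun k => ∫ x in Ω, gradSq d (𝓕 (gu (b k))) x) =
        fun i => ∑ k : Fin d, ∫ x in Ω, ‖𝓕 (fun v => mk k v * gu (b i) v) x‖ ^ 2 := by
      funext i
      simp_rw [gradSq_f]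
      rw [integral_finsetSum]
      intro k _
      exact (sq_int (b i) (mk k) (mk_cont k)).restrict
    rw [he]
    exact this
  have h2 := h0.sub h1
  suffices hE : semiclassicalConst d * (volume Ω).toReal * Λ ^ (1 + (d : ℝ) / 2) =
      Λ * ((volume Ω).toReal * ∫ v in B, ‖(1 : ℂ)‖ ^ 2) -
        ∑ k : Fin d, (volume Ω).toReal * ∫ v in B, ‖mk k v‖ ^ 2 by
    rw [hE]; exact h2
  rw [← Finset.mul_sum, ← integral_finsetSum]
  · have hI : IntegrableOn (fun v : EuclideanSpace ℝ (Fin d) => 4 * π ^ 2 * ‖v‖ ^ 2) B :=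
      ContinuousOn.integrableOn_compact (isCompact_closedBall _ _) (by fun_prop)
    have hJ : IntegrableOn (fun v : EuclideanSpace ℝ (Fin d) => Λ) B :=
      ContinuousOn.integrableOn_compact (isCompact_closedBall _ _) (by fun_prop)
    have h3 := semi_int d hd Λ hΛ
    rw [integral_sub hJ hI] at h3
    have h4 : ∫ v in B, ∑ k, ‖mk k v‖ ^ 2 = ∫ v in B, 4 * π ^ 2 * ‖v‖ ^ 2 := by
      congr 1; funext v
      simp_rw [mk_norm, EuclideanSpace.real_norm_sq_eq, Finset.mul_sum]
    have h5 : ∫ v in B, Λ = Λ * ∫ v in B, ‖(1 : ℂ)‖ ^ 2 := by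
      rw [← integral_const_mul]; simp
    rw [h4]
    rw [h5] at h3
    linear_combination (-(volume Ω).toReal) * h3
  · intro k _
    have := mk_cont k
    exact ContinuousOn.integrableOn_compact (isCompact_closedBall _ _) (by fun_prop)

theorem four_lin {d : ℕ} (S : ℝ) (m : EuclideanSpace ℝ (Fin d) → ℂ) (hm : Continuous m)
    (x : EuclideanSpace ℝ (Fin d)) : ∃ w : XX d S, ∀ u : XX d S,
    𝓕 (fun v => m v * gu u v) x = inner ℂ w u := by
  have hm' : Continuous (fun v => (starRingEnd ℂ) (m v)) := Complex.continuous_conj.comp hm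
  refine ⟨(Emem S _ hm' x).toLp, fun u => ?_⟩
  rw [four_inner u _ hm' x]
  simp only [Complex.conj_conj]

theorem toLp_normsq {α E : Type*} [MeasurableSpace α] {μ : Measure α} [NormedAddCommGroup E]
    [InnerProductSpace ℂ E] {f : α → E} (hf : MemLp f 2 μ) :
    ‖hf.toLp f‖ ^ 2 = ∫ x, ‖f x‖ ^ 2 ∂μ := by
  have h1 : ((‖hf.toLp f‖ ^ 2 : ℝ) : ℂ) = inner ℂ (hf.toLp f) (hf.toLp f) := by
    rw [inner_self_eq_norm_sq_to_K]; push_cast; rfl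
  rw [L2.inner_def] at h1
  have h2 : ∫ x, inner ℂ (hf.toLp f x) (hf.toLp f x) ∂μ = ((∫ x, ‖f x‖ ^ 2 ∂μ : ℝ) : ℂ) := by
    rw [← integral_complex_ofReal]
    apply integral_congr_ae
    filter_upwards [hf.coeFn_toLp] with v hv
    rw [hv, inner_self_eq_norm_sq_to_K]
    push_cast; rfl
  rw [h2] at h1
  exact_mod_cast h1

theorem f_memLp {d : ℕ} {S : ℝ} (Ω : Set (EuclideanSpace ℝ (Fin d))) (u : XX d S) :
    MemLp (𝓕 (gu u)) 2 (volume.restrict Ω) :=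
  (plancherel _ (gu_int u) (gu_memLp u)).1.restrict Ω

/-- The gradient as a vector field. -/
noncomputable def GG {d : ℕ} {S : ℝ} (u : XX d S) (x : EuclideanSpace ℝ (Fin d)) :
    EuclideanSpace ℂ (Fin d) :=
  WithLp.toLp 2 (fun k => 𝓕 (fun v => mk k v * gu u v) x)

theorem GG_norm {d : ℕ} {S : ℝ} (u : XX d S) (x : EuclideanSpace ℝ (Fin d)) :
    ‖GG u x‖ ^ 2 = gradSq d (𝓕 (gu u)) x := by
  rw [gradSq_f, EuclideanSpace.norm_sq_eq]; rfl

theorem gradSq_int {d : ℕ} {S : ℝ} (u : XX d S) :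
    Integrable (fun x => gradSq d (𝓕 (gu u)) x) := by
  simp_rw [gradSq_f]
  exact integrable_finsetSum _ fun k _ => sq_int u (mk k) (mk_cont k)

theorem GG_memLp {d : ℕ} {S : ℝ} (Ω : Set (EuclideanSpace ℝ (Fin d))) (u : XX d S) :
    MemLp (GG u) 2 (volume.restrict Ω) := by
  have hc : Continuous (GG u) := by
    unfold GG
    have : ∀ k, Continuous (𝓕 (fun v => mk k v * gu u v)) := fun k =>
      fourier_cont (mgu_int u (mk k) (mk_cont k)).1
    exact (PiLp.continuous_toLp 2 _).comp (continuous_pi this)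
  rw [memLp_two_iff_integrable_sq_norm hc.aestronglyMeasurable]
  simp_rw [GG_norm]
  exact (gradSq_int u).restrict

theorem f_lin {d : ℕ} (S : ℝ) (x : EuclideanSpace ℝ (Fin d)) : ∃ w : XX d S, ∀ u : XX d S,
    𝓕 (gu u) x = inner ℂ w u := by
  obtain ⟨w, hw⟩ := four_lin S (fun _ => 1) continuous_const x
  refine ⟨w, fun u => ?_⟩
  rw [← hw]; simp

theorem GG_add {d : ℕ} {S : ℝ} (u v : XX d S) (x : EuclideanSpace ℝ (Fin d)) :
    GG (u + v) x = GG u x + GG v x := by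
  ext k
  obtain ⟨w, hw⟩ := four_lin S (mk k) (mk_cont k) x
  simp [GG, hw, inner_add_right]

theorem GG_smul {d : ℕ} {S : ℝ} (c : ℂ) (u : XX d S) (x : EuclideanSpace ℝ (Fin d)) :
    GG (c • u) x = c • GG u x := by
  ext k
  obtain ⟨w, hw⟩ := four_lin S (mk k) (mk_cont k) x
  simp [GG, hw, inner_smul_right]

/-- Restriction of the Fourier transform to the domain. -/
noncomputable def TA {d : ℕ} (S : ℝ) (Ω : Set (EuclideanSpace ℝ (Fin d))) :
    XX d S →ₗ[ℂ] Lp ℂ 2 (volume.restrict Ω) where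
  toFun u := (f_memLp Ω u).toLp
  map_add' u v := by
    rw [← MemLp.toLp_add]
    apply MemLp.toLp_congr
    refine Filter.Eventually.of_forall fun x => ?_
    obtain ⟨w, hw⟩ := f_lin S x
    simp [hw, inner_add_right]
  map_smul' c u := by
    rw [RingHom.id_apply, ← MemLp.toLp_const_smul]
    apply MemLp.toLp_congr
    refine Filter.Eventually.of_forall fun x => ?_
    obtain ⟨w, hw⟩ := f_lin S x
    simp [hw, inner_smul_right]

/-- Restriction of the gradient to the domain. -/
noncomputable def TB {d : ℕ} (S : ℝ) (Ω : Set (EuclideanSpace ℝ (Fin d))) :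
    XX d S →ₗ[ℂ] Lp (EuclideanSpace ℂ (Fin d)) 2 (volume.restrict Ω) where
  toFun u := (GG_memLp Ω u).toLp
  map_add' u v := by
    rw [← MemLp.toLp_add]
    apply MemLp.toLp_congr
    exact Filter.Eventually.of_forall fun x => GG_add u v x
  map_smul' c u := by
    rw [RingHom.id_apply, ← MemLp.toLp_const_smul]
    apply MemLp.toLp_congr
    exact Filter.Eventually.of_forall fun x => GG_smul c u x

theorem TA_norm {d : ℕ} {S : ℝ} (Ω : Set (EuclideanSpace ℝ (Fin d))) (u : XX d S) :
    ‖TA S Ω u‖ ^ 2 = ∫ x in Ω, ‖𝓕 (gu u) x‖ ^ 2 := toLp_normsq (f_memLp Ω u)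

theorem TB_norm {d : ℕ} {S : ℝ} (Ω : Set (EuclideanSpace ℝ (Fin d))) (u : XX d S) :
    ‖TB S Ω u‖ ^ 2 = ∫ x in Ω, gradSq d (𝓕 (gu u)) x := by
  rw [← funext (GG_norm u)]
  exact toLp_normsq (GG_memLp Ω u)

theorem TA_inner {d : ℕ} {S : ℝ} (Ω : Set (EuclideanSpace ℝ (Fin d))) (u v : XX d S) :
    inner ℂ (TA S Ω u) (TA S Ω v) = ∫ x in Ω, (starRingEnd ℂ) (𝓕 (gu u) x) * 𝓕 (gu v) x := by
  rw [L2.inner_def]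
  apply integral_congr_ae
  filter_upwards [(f_memLp Ω u).coeFn_toLp, (f_memLp Ω v).coeFn_toLp] with x h1 h2
  change inner ℂ ((f_memLp Ω u).toLp _ x) ((f_memLp Ω v).toLp _ x) = _
  rw [h1, h2, RCLike.inner_apply, mul_comm]

theorem TA_TB {d : ℕ} {S : ℝ} (Ω : Set (EuclideanSpace ℝ (Fin d))) (hΩ : IsOpen Ω) (u : XX d S)
    (h : TA S Ω u = 0) : TB S Ω u = 0 := by
  have h1 : 𝓕 (gu u) =ᵐ[volume.restrict Ω] (fun _ => (0 : ℂ)) := by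
    have h2 := (f_memLp Ω u).coeFn_toLp
    have h3 : (f_memLp Ω u).toLp _ = 0 := h
    rw [h3] at h2
    filter_upwards [h2, Lp.coeFn_zero ℂ 2 (volume.restrict Ω)] with x h4 h5
    rw [← h4, h5]; rfl
  have h2 := Measure.eqOn_open_of_ae_eq h1 hΩ (contDiff_f u).continuous.continuousOn continuousOn_const
  have h3 : ‖TB S Ω u‖ ^ 2 = 0 := by
    rw [TB_norm]
    apply setIntegral_eq_zero_of_forall_eq_zero
    intro x hx
    have h4 : 𝓕 (gu u) =ᶠ[nhds x] (fun _ => (0 : ℂ)) :=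
      Filter.eventuallyEq_of_mem (hΩ.mem_nhds hx) h2
    unfold gradSq
    rw [h4.fderiv_eq]
    simp
  simpa using h3

theorem gu_normsq {d : ℕ} {S : ℝ} (u : XX d S) :
    ∫⁻ x, ‖gu u x‖ₑ ^ 2 = ENNReal.ofReal (‖u‖ ^ 2) := by
  have h1 : ∀ x, ‖gu u x‖ₑ ^ 2 = (Metric.closedBall (0 : EuclideanSpace ℝ (Fin d)) S).indicator
      (fun x => ‖u x‖ₑ ^ 2) x := by
    intro x
    unfold gu
    by_cases h : x ∈ Metric.closedBall (0 : EuclideanSpace ℝ (Fin d)) S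
    · simp only [Set.indicator_of_mem h]
    · simp only [Set.indicator_of_notMem h]; simp
  simp_rw [h1]
  rw [lintegral_indicator Metric.isClosed_closedBall.measurableSet]
  have h2 : ‖u‖ₑ = eLpNorm u 2 _ := Lp.enorm_def u
  rw [ENNReal.ofReal_pow (norm_nonneg _), ofReal_norm, h2]
  have h3 := eLpNorm_nnreal_pow_eq_lintegral (f := u) (p := 2)
    (μ := (volume : Measure (EuclideanSpace ℝ (Fin d))).restrict (Metric.closedBall 0 S)) (by norm_num)
  simpa using h3.symm

theorem lint_to_int {d : ℕ} {S : ℝ} (Ω : Set (EuclideanSpace ℝ (Fin d))) (u : XX d S) :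
    ENNReal.ofReal (‖TA S Ω u‖ ^ 2) = ∫⁻ x in Ω, ‖𝓕 (gu u) x‖ₑ ^ 2 := by
  rw [TA_norm, ofReal_integral_eq_lintegral_ofReal]
  · congr 1; funext x
    rw [← ofReal_norm, ENNReal.ofReal_pow (norm_nonneg _)]
  · exact (f_memLp Ω u).norm.integrable_sq
  · exact Filter.Eventually.of_forall fun x => by positivity

theorem inradius_approx {d : ℕ} (hd : 1 ≤ d) {θ : ℝ} (hθ : θ ∈ Set.Ioo (0 : ℝ) 1)
    (Ω : Set (EuclideanSpace ℝ (Fin d))) (hΩ : volume Ω < ∞) {t : ℝ} (ht : 0 < t) :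
    ∃ ρ : ℝ, 0 < ρ ∧ (∀ x : EuclideanSpace ℝ (Fin d),
      volume (Ω ∩ Metric.ball x ρ) ≤ ENNReal.ofReal θ * volume (Metric.ball x ρ)) ∧
      ρ ≤ (regInradius d θ Ω).toReal + t := by
  set A := {ρ : ℝ | 0 < ρ ∧ ∀ x : EuclideanSpace ℝ (Fin d),
      volume (Ω ∩ Metric.ball x ρ) ≤ ENNReal.ofReal θ * volume (Metric.ball x ρ)} with hA
  have hne : A.Nonempty := by
    set v := (volume (Metric.ball (0 : EuclideanSpace ℝ (Fin d)) 1)).toReal with hv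
    have hv0 : 0 < v := ENNReal.toReal_pos (Metric.measure_ball_pos _ _ one_pos).ne'
      measure_ball_lt_top.ne
    set V := (volume Ω).toReal with hV
    set ρ := V / (θ * v) + 1 with hρ
    have hθ0 := hθ.1
    have hV0 : 0 ≤ V := ENNReal.toReal_nonneg
    have hq : 0 ≤ V / (θ * v) := by positivity
    have hρ1 : 1 ≤ ρ := by linarith
    have : Nonempty (Fin d) := ⟨⟨0, hd⟩⟩
    have : Nontrivial (EuclideanSpace ℝ (Fin d)) := inferInstance
    refine ⟨ρ, by linarith, fun x => ?_⟩
    refine (measure_mono Set.inter_subset_left).trans ?_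
    rw [Measure.addHaar_ball _ _ (by linarith), finrank_euclideanSpace, Fintype.card_fin,
      ← ENNReal.ofReal_toReal hΩ.ne, ← ENNReal.ofReal_toReal
        (measure_ball_lt_top (μ := volume) (x := (0 : EuclideanSpace ℝ (Fin d))) (r := 1)).ne,
      ← ENNReal.ofReal_mul (by positivity), ← ENNReal.ofReal_mul (by positivity)]
    apply ENNReal.ofReal_le_ofReal
    rw [← hv, ← hV]
    have h1 : ρ ≤ ρ ^ d := le_self_pow₀ hρ1 (by omega)
    calc V = θ * (V / (θ * v) * v) := by field_simp
      _ ≤ θ * (ρ ^ d * v) := by gcongr; linarith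
  have hfin : regInradius d θ Ω ≠ ∞ := by
    obtain ⟨ρ, hρ⟩ := hne
    exact ne_top_of_le_ne_top ENNReal.ofReal_ne_top (sInf_le ⟨ρ, hρ, rfl⟩)
  have hlt : regInradius d θ Ω < regInradius d θ Ω + ENNReal.ofReal t :=
    ENNReal.lt_add_right hfin (by simpa using ht)
  have hlt' : sInf (ENNReal.ofReal '' A) < regInradius d θ Ω + ENNReal.ofReal t := hlt
  rw [sInf_lt_iff] at hlt'
  obtain ⟨_, ⟨ρ, hρ, rfl⟩, h2⟩ := hlt'
  refine ⟨ρ, hρ.1, hρ.2, ?_⟩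
  have h3 := ENNReal.toReal_mono (by simp [hfin]) h2.le
  rw [ENNReal.toReal_ofReal hρ.1.le, ENNReal.toReal_add hfin ENNReal.ofReal_ne_top,
    ENNReal.toReal_ofReal ht.le] at h3
  exact h3

end KI

namespace KI
open FourierTransform

theorem main_thm
    (d : ℕ) (hd : 1 ≤ d) (θ : ℝ) (hθ : θ ∈ Set.Ioo (0 : ℝ) 1) :
    ∃ c c' : ℝ, 0 < c ∧ 0 < c' ∧
      ∀ (Ω : Set (EuclideanSpace ℝ (Fin d))), IsOpen Ω → volume Ω < ∞ →
      ∀ Λ : ℝ, 0 < Λ → ∀ ε : ℝ, 0 < ε →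
      ∃ (N : ℕ) (φ : Fin N → EuclideanSpace ℝ (Fin d) → ℂ),
        (∀ j, ContDiffOn ℝ (⊤ : ℕ∞) (φ j) Ω) ∧
        (∀ i j, ∫ x in Ω, (starRingEnd ℂ) (φ i x) * φ j x = if i = j then 1 else 0) ∧
        (∀ j, IntegrableOn (fun x => gradSq d (φ j) x) Ω volume) ∧
        semiclassicalConst d * (volume Ω).toReal * Λ ^ (1 + (d : ℝ) / 2) *
            (1 + c * Real.exp (-c' * Real.sqrt Λ * (regInradius d θ Ω).toReal)) - ε
          < ∑ j : Fin N, (Λ - ∫ x in Ω, gradSq d (φ j) x) := by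
  obtain ⟨c, c', hc, hc', hc2, hls⟩ := ls2 d θ hθ
  refine ⟨c * Real.exp (-c'), c', by positivity, hc', ?_⟩
  intro Ω hΩo hΩ Λ hΛ ε hε
  have hsq : 0 < √Λ := Real.sqrt_pos.2 hΛ
  obtain ⟨ρ, hρ, hth, hρle⟩ := inradius_approx hd hθ Ω hΩ (t := 1 / √Λ) (by positivity)
  set S := √Λ / (2 * π) with hS
  have hS0 : 0 < S := by positivity
  set δ := c * Real.exp (-c' * (2 * π * S * ρ)) with hδ
  have hδ0 : 0 < δ := by positivity
  have hδ2 : δ ≤ 1 / 2 := by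
    have : Real.exp (-c' * (2 * π * S * ρ)) ≤ 1 := Real.exp_le_one_iff.2 (by
      have : 0 ≤ c' * (2 * π * S * ρ) := by positivity
      linarith)
    calc δ ≤ c * 1 := by rw [hδ]; gcongr
      _ ≤ _ := by linarith
  have hδlow : c * Real.exp (-c') * Real.exp (-c' * √Λ * (regInradius d θ Ω).toReal) ≤ δ := by
    rw [hδ, mul_assoc, ← Real.exp_add]
    gcongr
    have h1 : 2 * π * S * ρ = √Λ * ρ := by rw [hS]; field_simp
    have h2 : √Λ * ρ ≤ √Λ * (regInradius d θ Ω).toReal + 1 := by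
      calc √Λ * ρ ≤ √Λ * ((regInradius d θ Ω).toReal + 1 / √Λ) := by gcongr
        _ = _ := by field_simp
    rw [h1]
    nlinarith
  have hbound : ∀ u : XX d S, ‖TA S Ω u‖ ^ 2 ≤ (1 - δ) * ‖u‖ ^ 2 := by
    intro u
    have h1 := hls Ω hΩo.measurableSet ρ hρ hth S hS0.le (gu u) (gu_int u) (gu_memLp u) (gu_sm u)
      (gu_supp u)
    rw [gu_normsq, ← lint_to_int, ← hδ, ← ENNReal.ofReal_mul (by linarith)] at h1
    have h2 : 0 ≤ 1 - δ := by linarith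
    exact (ENNReal.ofReal_le_ofReal_iff (by positivity)).1 h1
  obtain ⟨w, b, -⟩ := exists_hilbertBasis ℂ (XX d S)
  set Tot := semiclassicalConst d * (volume Ω).toReal * Λ ^ (1 + (d : ℝ) / 2) with hTot
  have hTot0 : 0 ≤ Tot := by
    have : 0 < Real.Gamma (2 + (d : ℝ) / 2) := Real.Gamma_pos_of_pos (by positivity)
    have h2 : 0 < Real.Gamma 2 := Real.Gamma_pos_of_pos (by positivity)
    rw [hTot, semiclassicalConst]
    positivity
  have htr := trace_sum hd hΛ b Ω hΩ
  obtain ⟨s, hs⟩ := (htr.eventually (lt_mem_nhds (show Tot - ε / 2 < Tot by linarith))).exists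
  obtain ⟨N, cc, horth, hsum⟩ := absG (fun k : s => TA S Ω (b k)) (fun k : s => TB S Ω (b k))
    (by
      intro cf h
      simp only [← map_smul, ← map_sum] at h ⊢
      exact TA_TB Ω hΩo _ h) (1 - δ)
    (by
      intro cf
      simp only [← map_smul, ← map_sum]
      refine (hbound _).trans (le_of_eq ?_)
      congr 1
      have ho : Orthonormal ℂ (fun k : s => b k) := b.orthonormal.comp _ Subtype.val_injective
      have h1 := ho.inner_sum cf cf Finset.univ
      rw [inner_self_eq_norm_sq_to_K] at h1
      simp_rw [Complex.conj_mul'] at h1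
      apply Complex.ofReal_injective
      push_cast
      exact h1) Λ
  refine ⟨N, fun j => 𝓕 (gu (∑ k, cc j k • b k)), ?_, ?_, ?_, ?_⟩
  · intro j
    exact (contDiff_f _).contDiffOn
  · intro i j
    rw [← TA_inner]
    rw [orthonormal_iff_ite] at horth
    have := horth i j
    simp only [← map_smul, ← map_sum] at this
    exact this
  · intro j
    exact (gradSq_int _).integrableOn
  · have h1 : ∀ j, ∫ x in Ω, gradSq d (𝓕 (gu (∑ k, cc j k • b k))) x =
        ‖∑ k, cc j k • TB S Ω (b k)‖ ^ 2 := by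
      intro j
      rw [← TB_norm]
      simp only [← map_smul, ← map_sum]
    simp_rw [h1]
    simp only [TA_norm, TB_norm] at hsum
    rw [Finset.sum_coe_sort s (fun k => Λ * (∫ x in Ω, ‖𝓕 (gu (b k)) x‖ ^ 2) -
      ∫ x in Ω, gradSq d (𝓕 (gu (b k))) x)] at hsum
    set R := ∑ j, (Λ - ‖∑ k, cc j k • TB S Ω (b k)‖ ^ 2) with hR
    have h2 : Tot - ε / 2 < (1 - δ) * R := lt_of_lt_of_le hs hsum
    have h3 : Tot * (1 + c * Real.exp (-c') * Real.exp (-c' * √Λ * (regInradius d θ Ω).toReal)) ≤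
        Tot * (1 + δ) := by gcongr
    have h4 : (1 - δ) * (Tot * (1 + δ) - ε) < (1 - δ) * R := by
      nlinarith [mul_nonneg hTot0 (sq_nonneg δ)]
    have h5 := lt_of_mul_lt_mul_left h4 (by linarith)
    linarith

end KI

/-- **Improved Kröger inequality with regularized inradius (γ = 1, variational form).**
For every `d ≥ 1` and `θ ∈ (0,1)` there are `c, c' > 0` such that for every open
`Ω ⊆ ℝ^d` of finite measure, every `Λ > 0` and every `ε > 0`, there exist `N ∈ ℕ` and
smooth functions `φ_1, …, φ_N` on `Ω`, orthonormal in `L²(Ω)` and with `|∇φ_j| ∈ L²(Ω)`,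
such that `Σ_j (Λ − ∫_Ω |∇φ_j|²) > L^sc_{1,d} |Ω| Λ^{1+d/2} (1 + c e^{−c' √Λ ρ_θ(Ω)}) − ε`. -/
theorem improved_kroger_inradius
    (d : ℕ) (hd : 1 ≤ d) (θ : ℝ) (hθ : θ ∈ Set.Ioo (0 : ℝ) 1) :
    ∃ c c' : ℝ, 0 < c ∧ 0 < c' ∧
      ∀ (Ω : Set (EuclideanSpace ℝ (Fin d))), IsOpen Ω → volume Ω < ∞ →
      ∀ Λ : ℝ, 0 < Λ → ∀ ε : ℝ, 0 < ε →
      ∃ (N : ℕ) (φ : Fin N → EuclideanSpace ℝ (Fin d) → ℂ),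
        (∀ j, ContDiffOn ℝ (⊤ : ℕ∞) (φ j) Ω) ∧
        (∀ i j, ∫ x in Ω, (starRingEnd ℂ) (φ i x) * φ j x = if i = j then 1 else 0) ∧
        (∀ j, IntegrableOn (fun x => gradSq d (φ j) x) Ω volume) ∧
        semiclassicalConst d * (volume Ω).toReal * Λ ^ (1 + (d : ℝ) / 2) *
            (1 + c * Real.exp (-c' * Real.sqrt Λ * (regInradius d θ Ω).toReal)) - ε
          < ∑ j : Fin N, (Λ - ∫ x in Ω, gradSq d (φ j) x) := by
  exact KI.main_thm d hd θ hθ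
end
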